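/- Let 𝓘^u be the span in A(𝓗^+) of the elements E^u_{ab} for all 1 ≤ a,b ≤ ℓ, and 𝓘^t the span of the E^t_{ab}, and 𝓘 = 𝓘^u ⊕ 𝓘^t. Then 𝓘^u and 𝓘^t are two-sided ideals of A(𝓗^+), each isomorphic as an associative algebra to the ℓ×ℓ matrix algebra Mat_ℓ(ℂ) via E^*_{ab} ↦ E_{ab}, and 𝓘^u * 𝓘^t = 𝓘^t * 𝓘^u = 0. -/

import Mathlib

/-!
Common framework: vertex operator algebras over ℂ encoded via their modes,
weak/admissible/ordinary modules, twisted modules, Zhu's algebra data,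
and the free bosonic (Heisenberg) vertex operator algebra `𝓗 = M(1)` of rank `ℓ`
together with its `θ`-fixed subalgebra `𝓗⁺`.
-/

open scoped BigOperators DirectSum TensorProduct

noncomputable section

/-- Generalized binomial coefficient `(q choose n)` for `q : ℚ`. -/
def qchoose (q : ℚ) : ℕ → ℚ
  | 0 => 1
  | n + 1 => qchoose q n * (q - n) / (n + 1)

/-- Generalized binomial coefficient of an integer, as a complex number. -/
def zchoose (m : ℤ) (n : ℕ) : ℂ := ((qchoose (m : ℚ) n : ℚ) : ℂ)

/-- A vertex operator algebra over `ℂ`, encoded through its modes: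
`Y u n : Module.End ℂ V` is the `n`-th mode `u_n` of the vertex operator `Y(u,z)`.
The axioms are: truncation, the vacuum and creation axioms, the (component form of
the) Jacobi/Borcherds identity, a lower-truncated `ℤ`-grading by `L(0)`-eigenvalues
with finite dimensional homogeneous pieces compatible with the modes, the Virasoro
relations for the conformal vector and the `L(-1)`-derivative (translation) axiom. -/
structure VOA (V : Type) [AddCommGroup V] [Module ℂ V] : Type where
  Y : V →ₗ[ℂ] ℤ → Module.End ℂ V
  one : V
  omega : V
  wt : ℤ → Submodule ℂ V
  centralCharge : ℂ
  internal : DirectSum.IsInternal wt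
  one_wt : one ∈ wt 0
  omega_wt : omega ∈ wt 2
  one_ne_zero : one ≠ 0
  fdim : ∀ n : ℤ, FiniteDimensional ℂ (wt n)
  bounded_below : ∃ N : ℤ, ∀ n : ℤ, n < N → wt n = ⊥
  trunc : ∀ u v : V, ∃ N : ℤ, ∀ n : ℤ, N ≤ n → Y u n v = 0
  vacuum_act : ∀ n : ℤ, Y one n = if n = -1 then (1 : Module.End ℂ V) else 0
  create : ∀ u : V, Y u (-1) one = u
  create_ge : ∀ (u : V) (n : ℤ), 0 ≤ n → Y u n one = 0
  mode_wt : ∀ (k : ℤ) (u : V), u ∈ wt k → ∀ (m n : ℤ) (v : V), v ∈ wt m →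
    Y u n v ∈ wt (m + k - n - 1)
  L0_diag : ∀ (n : ℤ) (v : V), v ∈ wt n → Y omega 1 v = (n : ℂ) • v
  translation : ∀ (u : V) (n : ℤ), Y (Y omega 0 u) n = (-(n : ℂ)) • Y u (n - 1)
  virasoro : ∀ m n : ℤ,
    Y omega (m + 1) * Y omega (n + 1) - Y omega (n + 1) * Y omega (m + 1)
      = ((m : ℂ) - (n : ℂ)) • Y omega (m + n + 1)
        + (if m + n = 0 then (((m ^ 3 - m : ℤ) : ℂ) / 12) * centralCharge else 0)
            • (1 : Module.End ℂ V)
  borcherds : ∀ (u v w : V) (p m n : ℤ),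
    ∑ᶠ i : ℕ, zchoose m i • Y (Y u (p + i) v) (m + n - i) w
      = ∑ᶠ i : ℕ, ((-1 : ℂ) ^ i * zchoose p i) •
          (Y u (m + p - i) (Y v (n + i) w)
            - ((-1 : ℂ) ^ p) • Y v (n + p - i) (Y u (m + i) w))

variable {V : Type} [AddCommGroup V] [Module ℂ V]

/-- Simplicity of a vertex operator algebra: the only subspaces invariant under
all modes are `0` and the whole space. -/
def VOA.Simple (A : VOA V) : Prop :=
  ∀ U : Submodule ℂ V, (∀ (u : V) (n : ℤ) (v : V), v ∈ U → A.Y u n v ∈ U) → U = ⊥ ∨ U = ⊤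

/-- The decomposition of a vertex operator algebra into its homogeneous pieces. -/
noncomputable def VOA.decompose (A : VOA V) : V ≃ₗ[ℂ] ⨁ n : ℤ, A.wt n :=
  (LinearEquiv.ofBijective (DirectSum.coeLinearMap A.wt) A.internal).symm

/-- The homogeneous component of weight `n` of a vector. -/
noncomputable def VOA.hcomp (A : VOA V) (n : ℤ) (u : V) : V := (A.decompose u n : V)

/-- Zhu's product `u * v` for `u` (treated as) homogeneous of weight `k`:
`u*v = ∑_{i≥0} (k choose i) u_{i-1} v`. -/
noncomputable def VOA.mulAux (A : VOA V) (k : ℤ) (u v : V) : V :=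
  ∑ᶠ i : ℕ, zchoose k i • A.Y u ((i : ℤ) - 1) v

/-- Zhu's circle product `u ∘ v` for `u` (treated as) homogeneous of weight `k`:
`u∘v = ∑_{i≥0} (k choose i) u_{i-2} v`. -/
noncomputable def VOA.circAux (A : VOA V) (k : ℤ) (u v : V) : V :=
  ∑ᶠ i : ℕ, zchoose k i • A.Y u ((i : ℤ) - 2) v

/-- Zhu's product `u * v`, extended bilinearly via homogeneous components of `u`. -/
noncomputable def VOA.star (A : VOA V) (u v : V) : V :=
  ∑ᶠ k : ℤ, A.mulAux k (A.hcomp k u) v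

/-- The subspace `O(V)` spanned by all circle products `u ∘ v` with `u` homogeneous;
Zhu's algebra is `A(V) = V/O(V)` with product induced by `VOA.star`. -/
def VOA.Osub (A : VOA V) : Submodule ℂ V :=
  Submodule.span ℂ {w | ∃ (k : ℤ) (u v : V), u ∈ A.wt k ∧ w = A.circAux k u v}

/-- A weak module for a vertex operator algebra, given by modes satisfying
truncation, the vacuum axiom and the Borcherds identity. -/
structure WkMod (A : VOA V) (M : Type) [AddCommGroup M] [Module ℂ M] : Type where
  act : V →ₗ[ℂ] ℤ → Module.End ℂ M
  trunc : ∀ (u : V) (w : M), ∃ N : ℤ, ∀ n : ℤ, N ≤ n → act u n w = 0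
  vacuum_act : ∀ n : ℤ, act A.one n = if n = -1 then (1 : Module.End ℂ M) else 0
  borcherds : ∀ (u v : V) (w : M) (p m n : ℤ),
    ∑ᶠ i : ℕ, zchoose m i • act (A.Y u (p + i) v) (m + n - i) w
      = ∑ᶠ i : ℕ, ((-1 : ℂ) ^ i * zchoose p i) •
          (act u (m + p - i) (act v (n + i) w)
            - ((-1 : ℂ) ^ p) • act v (n + p - i) (act u (m + i) w))

/-- An admissible (`ℕ`-gradable) module for a vertex operator algebra:
a weak module with an `ℕ`-grading with nonzero top level, compatible with weights. -/
structure AdmMod (A : VOA V) (M : Type) [AddCommGroup M] [Module ℂ M]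
    extends WkMod A M : Type where
  gr : ℕ → Submodule ℂ M
  grInternal : DirectSum.IsInternal gr
  top_ne_bot : gr 0 ≠ ⊥
  gr_mode : ∀ (k : ℤ) (u : V), u ∈ A.wt k → ∀ (m : ℤ) (n : ℕ) (w : M), w ∈ gr n →
    act u m w ∈
      if 0 ≤ (n : ℤ) + k - m - 1 then gr ((n : ℤ) + k - m - 1).toNat else ⊥

/-- An ordinary module for a vertex operator algebra: a weak module on which `L(0)`
acts semisimply with finite dimensional eigenspaces whose weights are truncated from
below in each coset `λ + ℤ`. -/
structure OrdMod (A : VOA V) (M : Type) [AddCommGroup M] [Module ℂ M]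
    extends WkMod A M : Type where
  wtm : ℂ → Submodule ℂ M
  indep : iSupIndep wtm
  spans : ⨆ c : ℂ, wtm c = ⊤
  L0_diag : ∀ (c : ℂ) (w : M), w ∈ wtm c → act A.omega 1 w = c • w
  fdim : ∀ c : ℂ, FiniteDimensional ℂ (wtm c)
  bounded_below : ∀ c : ℂ, ∃ N : ℤ, ∀ m : ℤ, m < N → wtm (c + m) = ⊥

/-- Irreducibility of a weak module. -/
def WkMod.Irreducible {A : VOA V} {M : Type} [AddCommGroup M] [Module ℂ M]
    (P : WkMod A M) : Prop :=
  (∃ w : M, w ≠ 0) ∧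
    ∀ U : Submodule ℂ M, (∀ (u : V) (n : ℤ) (w : M), w ∈ U → P.act u n w ∈ U) →
      U = ⊥ ∨ U = ⊤

/-- Isomorphism of two weak modules over the same vertex operator algebra. -/
def ModIso (A : VOA V) {M N : Type} [AddCommGroup M] [Module ℂ M]
    [AddCommGroup N] [Module ℂ N] (P : WkMod A M) (Q : WkMod A N) : Prop :=
  ∃ f : M ≃ₗ[ℂ] N, ∀ (u : V) (n : ℤ) (w : M), f (P.act u n w) = Q.act u n (f w)

/-- The action of the zero-mode `o(u) = u_{wt u - 1}` (extended linearly from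
homogeneous vectors) on a weak module; it preserves the top level of an
admissible module. -/
noncomputable def WkMod.oAct {A : VOA V} {M : Type} [AddCommGroup M] [Module ℂ M]
    (Q : WkMod A M) (u : V) (w : M) : M :=
  ∑ᶠ k : ℤ, Q.act (A.hcomp k u) (k - 1) w

/-- Action of a word of creation operators `h_{a_1}(-n_1) ⋯ h_{a_k}(-n_k)`. -/
def wordAct {ℓ : ℕ} {M : Type} (f : Fin ℓ → ℤ → M → M) : List (Fin ℓ × ℕ+) → M → M
  | [], w => w
  | (a, n) :: L, w => f a (-((n : ℕ) : ℤ)) (wordAct f L w)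

/-- Action of a word of twisted creation operators
`h_{a_1}(-n_1+1/2) ⋯ h_{a_k}(-n_k+1/2)` (indices doubled). -/
def twWordAct {ℓ : ℕ} {M : Type} (f : Fin ℓ → ℤ → M → M) : List (Fin ℓ × ℕ+) → M → M
  | [], w => w
  | (a, n) :: L, w => f a (-(2 * ((n : ℕ) : ℤ) - 1)) (twWordAct f L w)

/-- `A` is the rank `ℓ` free bosonic (Heisenberg) vertex operator algebra
`𝓗 = M(1)`, with generators `hgen a = h_a(-1)𝟏` for an orthonormal basis
`h_1, …, h_ℓ` of `𝔥`: the generators have weight one, their modes satisfy the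
Heisenberg commutation relations `[h_a(m), h_b(n)] = m δ_{ab} δ_{m+n,0}`, the
conformal vector is `ω = (1/2) ∑_a h_a(-1)²𝟏`, and `V` is spanned by the vectors
`h_{a_1}(-n_1) ⋯ h_{a_k}(-n_k)𝟏`. -/
structure IsHeisenberg {ℓ : ℕ} (A : VOA V) (hgen : Fin ℓ → V) : Prop where
  wt_one : ∀ a, hgen a ∈ A.wt 1
  heis_comm : ∀ (a b : Fin ℓ) (m n : ℤ),
    A.Y (hgen a) m * A.Y (hgen b) n - A.Y (hgen b) n * A.Y (hgen a) m
      = (if a = b ∧ m + n = 0 then (m : ℂ) else 0) • (1 : Module.End ℂ V)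
  omega_eq : A.omega
      = (1 / 2 : ℂ) • ∑ a : Fin ℓ, A.Y (hgen a) (-1) (A.Y (hgen a) (-1) A.one)
  span_words : Submodule.span ℂ
      {v : V | ∃ L : List (Fin ℓ × ℕ+),
        v = wordAct (fun a k w => A.Y (hgen a) k w) L A.one} = ⊤

/-- `θ` is the automorphism of the free bosonic vertex operator algebra induced
by `-1` on `𝔥`. -/
structure IsThetaAut {ℓ : ℕ} (A : VOA V) (hgen : Fin ℓ → V) (θ : V ≃ₗ[ℂ] V) : Prop where
  map_one : θ A.one = A.one
  map_omega : θ A.omega = A.omega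
  map_Y : ∀ (u : V) (n : ℤ) (v : V), θ (A.Y u n v) = A.Y (θ u) n (θ v)
  map_gen : ∀ a, θ (hgen a) = -hgen a
  map_wt : ∀ (k : ℤ) (v : V), v ∈ A.wt k → θ v ∈ A.wt k

/-- `B` (with underlying space `W`, embedded in `V` by `ι`) is the fixed point
vertex operator subalgebra `V^θ` of the involution `θ`. -/
structure IsFixedSubVOA {W : Type} [AddCommGroup W] [Module ℂ W]
    (A : VOA V) (θ : V ≃ₗ[ℂ] V) (B : VOA W) (ι : W →ₗ[ℂ] V) : Prop where
  inj : Function.Injective ι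
  range_eq : LinearMap.range ι
      = Module.End.eigenspace (θ.toLinearMap : Module.End ℂ V) 1
  map_one : ι B.one = A.one
  map_omega : ι B.omega = A.omega
  map_Y : ∀ (u : W) (n : ℤ) (v : W), ι (B.Y u n v) = A.Y (ι u) n (ι v)
  map_wt : ∀ (k : ℤ) (w : W), w ∈ B.wt k ↔ ι w ∈ A.wt k

/-- `P` is (isomorphic to) the Fock module `M(1,λ)` over the rank `ℓ` Heisenberg
vertex operator algebra: it has a nonzero vector `v₀` with `h_a(n)v₀ = 0` for
`n ≥ 1`, `h_a(0)v₀ = λ_a v₀`, which generates `M` under the creation operators. -/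
def IsFockModule {ℓ : ℕ} {M : Type} [AddCommGroup M] [Module ℂ M]
    (A : VOA V) (hgen : Fin ℓ → V) (P : WkMod A M) (lam : Fin ℓ → ℂ) : Prop :=
  ∃ v0 : M, v0 ≠ 0 ∧ (∀ (a : Fin ℓ) (n : ℤ), 1 ≤ n → P.act (hgen a) n v0 = 0) ∧
    (∀ a : Fin ℓ, P.act (hgen a) 0 v0 = lam a • v0) ∧
    Submodule.span ℂ {w : M | ∃ L : List (Fin ℓ × ℕ+),
      w = wordAct (fun a k x => P.act (hgen a) k x) L v0} = ⊤

/-- A weak `θ`-twisted module (for an involution `θ`): the modes are indexed by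
`(1/2)ℤ`, encoded here by doubling (so `act u k` is the mode `u_{k/2}`); on the
eigenspace `θ = (-1)^r` only modes with `k ≡ r (mod 2)` act, and the component
form of the twisted Jacobi identity holds. -/
structure TwMod (A : VOA V) (θ : V ≃ₗ[ℂ] V) (M : Type) [AddCommGroup M]
    [Module ℂ M] : Type where
  act : V →ₗ[ℂ] ℤ → Module.End ℂ M
  trunc : ∀ (u : V) (w : M), ∃ N : ℤ, ∀ n : ℤ, N ≤ n → act u n w = 0
  vacuum_act : ∀ n : ℤ, act A.one n = if n = -2 then (1 : Module.End ℂ M) else 0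
  moding : ∀ (u : V) (r : ℤ), θ u = ((-1 : ℂ) ^ r) • u →
    ∀ k : ℤ, (k - r) % 2 ≠ 0 → act u k = 0
  borcherds : ∀ (u v : V) (r s : ℤ), θ u = ((-1 : ℂ) ^ r) • u →
    θ v = ((-1 : ℂ) ^ s) • v → ∀ (w : M) (p K N : ℤ),
    ∑ᶠ i : ℕ, ((qchoose ((K : ℚ) / 2) i : ℚ) : ℂ) • act (A.Y u (p + i) v) (K + N - 2 * i) w
      = ∑ᶠ i : ℕ, ((-1 : ℂ) ^ i * zchoose p i) •
          (act u (K + 2 * p - 2 * i) (act v (N + 2 * i) w)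
            - ((-1 : ℂ) ^ p) • act v (N + 2 * p - 2 * i) (act u (K + 2 * i) w))

/-- Irreducibility of a twisted module. -/
def TwMod.Irreducible {A : VOA V} {θ : V ≃ₗ[ℂ] V} {M : Type} [AddCommGroup M]
    [Module ℂ M] (T : TwMod A θ M) : Prop :=
  (∃ w : M, w ≠ 0) ∧
    ∀ U : Submodule ℂ M, (∀ (u : V) (k : ℤ) (w : M), w ∈ U → T.act u k w ∈ U) →
      U = ⊥ ∨ U = ⊤

/-- `T` is (isomorphic to) the canonical irreducible `θ`-twisted module
`𝓗(θ) = S(𝔥 ⊗ t^{-1/2}ℂ[t^{-1/2}])` of the rank `ℓ` free bosonic vertex operator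
algebra: it has a nonzero vector killed by all modes `h_a(k/2)`, `k ≥ 1`, which
generates it under the twisted creation operators. -/
def IsCanonicalTwMod {ℓ : ℕ} {M : Type} [AddCommGroup M] [Module ℂ M]
    (A : VOA V) (hgen : Fin ℓ → V) {θ : V ≃ₗ[ℂ] V} (T : TwMod A θ M) : Prop :=
  ∃ v0 : M, v0 ≠ 0 ∧ (∀ (a : Fin ℓ) (k : ℤ), 1 ≤ k → T.act (hgen a) k v0 = 0) ∧
    Submodule.span ℂ {w : M | ∃ L : List (Fin ℓ × ℕ+),
      w = twWordAct (fun a k x => T.act (hgen a) k x) L v0} = ⊤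

/-- `σ` is the canonical involution of the twisted module `𝓗(θ)` (acting by
`(-1)^k` on monomials of length `k`): it is an involution compatible with `θ`
through the twisted action and fixing the lowest weight vectors. -/
def TwInvolution {ℓ : ℕ} {M : Type} [AddCommGroup M] [Module ℂ M]
    (A : VOA V) (hgen : Fin ℓ → V) {θ : V ≃ₗ[ℂ] V} (T : TwMod A θ M)
    (σ : M ≃ₗ[ℂ] M) : Prop :=
  (∀ w : M, σ (σ w) = w) ∧
  (∀ (u : V) (k : ℤ) (w : M), σ (T.act u k w) = T.act (θ u) k (σ w)) ∧
  (∀ v0 : M, (∀ (a : Fin ℓ) (k : ℤ), 1 ≤ k → T.act (hgen a) k v0 = 0) → σ v0 = v0)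

/-- The weak `B = V^θ`-module `Q` "is" the eigenspace `V^{(ε)}` of `θ` on `V`
(e.g. `𝓗⁺` itself for `ε = 1` and `𝓗⁻` for `ε = -1`), with action obtained by
restricting the vertex operators of `V`. -/
def IsEigenPartModule {W N : Type} [AddCommGroup W] [Module ℂ W]
    [AddCommGroup N] [Module ℂ N] (A : VOA V) (θ : V ≃ₗ[ℂ] V) {B : VOA W}
    (ι : W →ₗ[ℂ] V) (ε : ℂ) (Q : WkMod B N) : Prop :=
  ∃ j : N →ₗ[ℂ] V, Function.Injective j ∧
    LinearMap.range j = Module.End.eigenspace (θ.toLinearMap : Module.End ℂ V) ε ∧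
    ∀ (u : W) (n : ℤ) (w : N), j (Q.act u n w) = A.Y (ι u) n (j w)

/-- The weak `B = V^θ`-module `Q` "is" the eigenspace `𝓗(θ)^{(ε)}` of the
involution `σ` on the twisted module `𝓗(θ)`, with the restricted twisted action
(`u ∈ V^θ` acts by its integral modes). -/
def IsTwEigenPartModule {W MT N : Type} [AddCommGroup W] [Module ℂ W]
    [AddCommGroup MT] [Module ℂ MT] [AddCommGroup N] [Module ℂ N]
    (A : VOA V) {θ : V ≃ₗ[ℂ] V} {B : VOA W} (ι : W →ₗ[ℂ] V)
    (T : TwMod A θ MT) (σ : MT ≃ₗ[ℂ] MT) (ε : ℂ) (Q : WkMod B N) : Prop :=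
  ∃ j : N →ₗ[ℂ] MT, Function.Injective j ∧
    LinearMap.range j = Module.End.eigenspace (σ.toLinearMap : Module.End ℂ MT) ε ∧
    ∀ (u : W) (n : ℤ) (w : N), j (Q.act u n w) = T.act (ι u) (2 * n) (j w)

/-- The weak `B = 𝓗⁺`-module `Q` "is" the restriction to `𝓗⁺` of the Fock module
`M(1,λ)`. -/
def IsFockRestriction {ℓ : ℕ} {W N : Type} [AddCommGroup W] [Module ℂ W]
    [AddCommGroup N] [Module ℂ N] (A : VOA V) (hgen : Fin ℓ → V) {B : VOA W}
    (ι : W →ₗ[ℂ] V) (lam : Fin ℓ → ℂ) (Q : WkMod B N) : Prop :=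
  ∃ P : WkMod A N, IsFockModule A hgen P lam ∧
    ∀ (u : W) (n : ℤ), Q.act u n = P.act (ι u) n

/-- A realization of Zhu's algebra `A(V) = V/O(V)` of a vertex operator algebra
as an abstract associative `ℂ`-algebra `R`. -/
structure ZhuRealization (A : VOA V) (R : Type) [Ring R] [Algebra ℂ R] : Type where
  π : V →ₗ[ℂ] R
  surj : Function.Surjective π
  ker_eq : LinearMap.ker π = A.Osub
  map_star : ∀ u v : V, π (A.star u v) = π u * π v
  map_one : π A.one = 1

/-- The `R = A(V)`-module `M` "is" the top level `N(0)` of the admissible module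
`N`, where `[u] ∈ A(V)` acts on the top level by the zero-mode `o(u)`. -/
def IsTopLevelOf {R : Type} [Ring R] [Algebra ℂ R] {A : VOA V}
    (Z : ZhuRealization A R) {N : Type} [AddCommGroup N] [Module ℂ N]
    (Qa : AdmMod A N) (M : Type) [AddCommGroup M] [Module R M] : Prop :=
  ∃ f : M →+ N, Function.Injective f ∧ (∀ m : M, f m ∈ Qa.gr 0) ∧
    (∀ w ∈ Qa.gr 0, ∃ m : M, f m = w) ∧
    ∀ (u : V) (m : M), f (Z.π u • m) = Qa.toWkMod.oAct u (f m)

/-- Iterated Zhu product of a list of elements (an empty product is `[𝟏]`). -/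
noncomputable def starList (A : VOA V) : List V → V
  | [] => A.one
  | x :: L => A.star x (starList A L)

/-- The linear span of all Zhu-monomials in a set of generators; modulo `O(V)`
this is the subalgebra of `A(V)` generated by the images of the generators. -/
def genMonomials (A : VOA V) (gens : Set V) : Submodule ℂ V :=
  Submodule.span ℂ {w : V | ∃ L : List V, (∀ g ∈ L, g ∈ gens) ∧ w = starList A L}

/-- The subspace `𝓦^α ⊆ 𝓗` spanned by the monomials
`h_{a_1}(-n_1) ⋯ h_{a_k}(-n_k)𝟏` whose number of letters from `𝓗_c` is odd
exactly for `c ∈ α`; thus `wordSpanV A hgen ∅ = 𝓦 = 𝓗₁⁺ ⊗ ⋯ ⊗ 𝓗_ℓ⁺`. -/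
def wordSpanV {ℓ : ℕ} (A : VOA V) (hgen : Fin ℓ → V) (α : Finset (Fin ℓ)) :
    Submodule ℂ V :=
  Submodule.span ℂ {v : V | ∃ L : List (Fin ℓ × ℕ+),
    (∀ c : Fin ℓ, c ∈ α ↔ ¬ Even ((L.map Prod.fst).count c)) ∧
    v = wordAct (fun a k w => A.Y (hgen a) k w) L A.one}

/-- The element `S_{ab}(m,n) = h_a(-m)h_b(-n)𝟏` of `𝓗`. -/
def SV {ℓ : ℕ} (A : VOA V) (hgen : Fin ℓ → V) (a b : Fin ℓ) (m n : ℤ) : V :=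
  A.Y (hgen a) (-m) (A.Y (hgen b) (-n) A.one)

/-- The element `ω_a = (1/2) h_a(-1)²𝟏` of `𝓗⁺`. -/
def omegaV {ℓ : ℕ} (A : VOA V) (hgen : Fin ℓ → V) (a : Fin ℓ) : V :=
  (1 / 2 : ℂ) • SV A hgen a a 1 1

/-- The element `J_a = h_a(-1)⁴𝟏 - 2h_a(-3)h_a(-1)𝟏 + (3/2)h_a(-2)²𝟏` of `𝓗⁺`. -/
def JV {ℓ : ℕ} (A : VOA V) (hgen : Fin ℓ → V) (a : Fin ℓ) : V :=
  A.Y (hgen a) (-1) (A.Y (hgen a) (-1) (A.Y (hgen a) (-1) (A.Y (hgen a) (-1) A.one)))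
    - (2 : ℂ) • SV A hgen a a 3 1 + (3 / 2 : ℂ) • SV A hgen a a 2 2

variable {W : Type} [AddCommGroup W] [Module ℂ W]

/-- `E^u_{ab}` (for `a ≠ b`), as a combination of the `S_{ab}(1,m)`. -/
def EuW {ℓ : ℕ} (s : Fin ℓ → Fin ℓ → ℤ → ℤ → W) (a b : Fin ℓ) : W :=
  (5 : ℂ) • s a b 1 2 + (25 : ℂ) • s a b 1 3 + (36 : ℂ) • s a b 1 4 + (16 : ℂ) • s a b 1 5

/-- `E^t_{ab}` (for `a ≠ b`), as a combination of the `S_{ab}(1,m)`. -/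
def EtW {ℓ : ℕ} (s : Fin ℓ → Fin ℓ → ℤ → ℤ → W) (a b : Fin ℓ) : W :=
  (-16 : ℂ) • ((3 : ℂ) • s a b 1 2 + (14 : ℂ) • s a b 1 3 + (19 : ℂ) • s a b 1 4
    + (8 : ℂ) • s a b 1 5)

/-- `Λ_{ab}` (for `a ≠ b`), as a combination of the `S_{ab}(1,m)`. -/
def LamW {ℓ : ℕ} (s : Fin ℓ → Fin ℓ → ℤ → ℤ → W) (a b : Fin ℓ) : W :=
  (45 : ℂ) • s a b 1 2 + (190 : ℂ) • s a b 1 3 + (240 : ℂ) • s a b 1 4 + (96 : ℂ) • s a b 1 5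

/-- The full setting of the paper: `A = 𝓗` is the rank `ℓ` free bosonic vertex
operator algebra with Heisenberg generators `hgen`, `θ` is its `-1` involution,
and `B = 𝓗⁺` is the fixed point vertex operator subalgebra, embedded by `ι`. -/
structure HeisenbergPlusSetting (ℓ : ℕ) (V W : Type) [AddCommGroup V] [Module ℂ V]
    [AddCommGroup W] [Module ℂ W] : Type where
  A : VOA V
  hgen : Fin ℓ → V
  heis : IsHeisenberg A hgen
  θ : V ≃ₗ[ℂ] V
  thetaAut : IsThetaAut A hgen θ
  B : VOA W
  ι : W →ₗ[ℂ] V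
  fixedSub : IsFixedSubVOA A θ B ι

/-- Bundled weak module over a vertex operator algebra. -/
structure ARep (A : VOA V) : Type 1 where
  carrier : Type
  [acg : AddCommGroup carrier]
  [mod : Module ℂ carrier]
  str : WkMod A carrier

attribute [instance] ARep.acg ARep.mod

/-- Bundled admissible module over a vertex operator algebra. -/
structure BRep (A : VOA V) : Type 1 where
  carrier : Type
  [acg : AddCommGroup carrier]
  [mod : Module ℂ carrier]
  adm : AdmMod A carrier

attribute [instance] BRep.acg BRep.mod

/-- Bundled twisted module over a vertex operator algebra with involution. -/
structure TwRep (A : VOA V) (θ : V ≃ₗ[ℂ] V) : Type 1 where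
  carrier : Type
  [acg : AddCommGroup carrier]
  [mod : Module ℂ carrier]
  str : TwMod A θ carrier

attribute [instance] TwRep.acg TwRep.mod

end

section
namespace Zhu

/-- Generalized binomial coefficient of a complex number. -/
noncomputable def cch (x : ℂ) : ℕ → ℂ
  | 0 => 1
  | n + 1 => cch x n * (x - n) / (n + 1)

lemma zchoose_eq (m : ℤ) (n : ℕ) : zchoose m n = cch (m : ℂ) n := by
  induction n with
  | zero => simp [zchoose, qchoose, cch]
  | succ n ih =>
    have h : zchoose m (n+1) = zchoose m n * ((m:ℂ) - n) / (n + 1) := by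
      simp only [zchoose, qchoose]; push_cast; ring
    rw [h, ih, cch]

@[simp] lemma cch_zero (x : ℂ) : cch x 0 = 1 := rfl

lemma cch_succ (x : ℂ) (n : ℕ) : cch x (n+1) = cch x n * (x - n) / (n + 1) := rfl

lemma cch_succ_mul (x : ℂ) (n : ℕ) : ((n:ℂ) + 1) * cch x (n+1) = cch x n * (x - n) := by
  rw [cch_succ]; field_simp

lemma cch_pascal (x : ℂ) (n : ℕ) : cch (x+1) (n+1) = cch x n + cch x (n+1) := by
  induction n with
  | zero => simp [cch]; ring
  | succ n ih =>
    have h2 : ((n:ℂ) + 1 + 1) ≠ 0 := by exact_mod_cast Nat.succ_ne_zero (n+1)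
    have h3 : ((n:ℂ) + 1) ≠ 0 := by exact_mod_cast Nat.succ_ne_zero n
    rw [cch_succ (x+1), ih, cch_succ x (n+1), cch_succ x n]
    push_cast
    field_simp
    ring

lemma cch_natCast (k n : ℕ) : cch (k:ℂ) n = (k.choose n : ℂ) := by
  induction k generalizing n with
  | zero =>
    cases n with
    | zero => simp
    | succ n =>
      simp only [Nat.choose_zero_succ, Nat.cast_zero]
      induction n with
      | zero => simp [cch]
      | succ n ih => rw [cch_succ, ih]; simp
  | succ k ih =>
    cases n with
    | zero => simp
    | succ n =>
      push_cast
      rw [cch_pascal, ih, ih, Nat.choose_succ_succ]; push_cast; ring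

lemma cch_neg_one (n : ℕ) : cch (-1) n = (-1)^n := by
  induction n with
  | zero => simp
  | succ n ih =>
    have h3 : ((n:ℂ) + 1) ≠ 0 := by exact_mod_cast Nat.succ_ne_zero n
    rw [cch_succ, ih]; field_simp; ring

lemma cch_neg_two (n : ℕ) : cch (-2) n = (-1)^n * (n+1) := by
  induction n with
  | zero => simp
  | succ n ih =>
    have h3 : ((n:ℂ) + 1) ≠ 0 := by exact_mod_cast Nat.succ_ne_zero n
    rw [cch_succ, ih]; push_cast; field_simp; ring

lemma zchoose_natCast (k n : ℕ) : zchoose (k:ℤ) n = (k.choose n : ℂ) := by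
  rw [zchoose_eq]; push_cast; exact cch_natCast k n

/-- `cch (x-1) r = ∑_{p≤r} (-1)^p cch x (r-p)`. -/
lemma cch_sub_one (x : ℂ) (r : ℕ) :
    cch (x-1) r = ∑ p ∈ Finset.range (r+1), (-1)^p * cch x (r-p) := by
  induction r with
  | zero => simp
  | succ r ih =>
    have h := cch_pascal (x-1) r
    rw [sub_add_cancel] at h
    rw [Finset.sum_range_succ', eq_sub_of_add_eq' h.symm, ih]
    simp only [pow_succ, Nat.add_sub_add_right]
    simp [Finset.sum_neg_distrib]
    ring

section bs
variable {M : Type*} [AddCommGroup M] [Module ℂ M]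

/-- shift operator on sequences -/
def shiftL (M : Type*) [AddCommGroup M] [Module ℂ M] : Module.End ℂ (ℤ → M) where
  toFun f := fun n => f (n+1)
  map_add' _ _ := rfl
  map_smul' _ _ := rfl

/-- `∑_i C(w,i) f(N+i)` -/
def bs (w : ℕ) (f : ℤ → M) : ℤ → M := ((1 + shiftL M) ^ w) f

@[simp] lemma bs_zero (f : ℤ → M) : bs 0 f = f := by simp [bs]

lemma bs_succ (w : ℕ) (f : ℤ → M) (N : ℤ) : bs (w+1) f N = bs w f N + bs w f (N+1) := by
  simp [bs, pow_succ', shiftL]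

lemma bs_add (w k : ℕ) (f : ℤ → M) : bs (w+k) f = bs w (bs k f) := by
  simp [bs, pow_add]

lemma shiftL_pow (k : ℕ) (f : ℤ → M) (N : ℤ) : ((shiftL M)^k) f N = f (N+k) := by
  induction k generalizing N with
  | zero => simp
  | succ k ih =>
    have : ((shiftL M)^(k+1)) f N = ((shiftL M)^k) f (N+1) := by
      rw [pow_succ']; rfl
    rw [this, ih]; congr 1; push_cast; ring

lemma bs_eq (w : ℕ) (f : ℤ → M) (N : ℤ) :
    bs w f N = ∑ i ∈ Finset.range (w+1), (w.choose i : ℂ) • f (N+i) := by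
  induction w generalizing N with
  | zero => simp
  | succ w ih =>
    rw [bs_succ, ih, ih]
    rw [Finset.sum_range_succ' (fun i => ((w+1).choose i : ℂ) • f (N+i))]
    simp only [Nat.choose_succ_succ, Nat.cast_add, add_smul, Finset.sum_add_distrib]
    rw [Finset.sum_range_succ (fun i => (w.choose (i+1) : ℂ) • f (N + _))]
    rw [Finset.sum_range_succ' (fun i => (w.choose i : ℂ) • f (N+i))]
    simp only [Nat.choose_succ_self, Nat.cast_zero, zero_smul, add_zero, Nat.choose_zero_right]
    have : ∀ i : ℕ, N + 1 + (i:ℤ) = N + ((i+1 : ℕ):ℤ) := by intro i; push_cast; ring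
    simp only [this]
    push_cast
    abel

lemma bs_eq_of_le (w K : ℕ) (hK : w < K) (f : ℤ → M) (N : ℤ) :
    bs w f N = ∑ i ∈ Finset.range K, (w.choose i : ℂ) • f (N+i) := by
  rw [bs_eq]
  apply Finset.sum_subset
  · intro x; simp; omega
  · intro x _ hx
    rw [Nat.choose_eq_zero_of_lt (by simp at hx; omega)]; simp

lemma bs_apply {M' : Type*} [AddCommGroup M'] [Module ℂ M'] (g : M →ₗ[ℂ] M') (w : ℕ) (f : ℤ → M) (N : ℤ) :
    g (bs w f N) = bs w (fun n => g (f n)) N := by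
  simp [bs_eq]

lemma bs_comp_add (w : ℕ) (f : ℤ → M) (c N : ℤ) : bs w (fun n => f (n + c)) N = bs w f (N + c) := by
  simp only [bs_eq]; refine Finset.sum_congr rfl fun i _ => ?_; congr 2; ring

lemma bs_congr_zero (w : ℕ) (f : ℤ → M) (N : ℤ) (h : ∀ n, N ≤ n → f n = 0) : bs w f N = 0 := by
  rw [bs_eq]; exact Finset.sum_eq_zero fun i _ => by rw [h _ (by omega), smul_zero]

lemma bs_choose (α i : ℕ) (f : ℤ → M) (N : ℤ) :
    ∑ m ∈ Finset.range (α+1), ((α.choose m : ℂ) * (m.choose i : ℂ)) • f (N + m - i)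
      = (α.choose i : ℂ) • bs (α - i) f N := by
  by_cases h : α < i
  · rw [Nat.choose_eq_zero_of_lt h]
    simp only [Nat.cast_zero, zero_smul]
    apply Finset.sum_eq_zero
    intro m hm
    rw [Nat.choose_eq_zero_of_lt (n := m) (k := i) (by simp at hm; omega)]; simp
  · push Not at h
    obtain ⟨k, rfl⟩ := Nat.exists_eq_add_of_le h
    rw [show i + k - i = k by omega, bs_eq, show i + k + 1 = i + (k+1) by ring, Finset.sum_range_add,
      Finset.smul_sum]
    rw [Finset.sum_eq_zero, zero_add]
    · refine Finset.sum_congr rfl fun j hj => ?_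
      simp only [Finset.mem_range] at hj
      rw [smul_smul]
      rw [show N + ((i+j : ℕ):ℤ) - i = N + j by push_cast; ring]
      congr 1
      · have := Nat.choose_mul (n := i+k) (k := i+j) (s := i) (by omega)
        simp only [show i + k - i = k by omega, show i + j - i = j by omega] at this
        exact_mod_cast this
    · intro m hm
      rw [Nat.choose_eq_zero_of_lt (n := m) (k := i) (by simpa using hm)]; simp

end bs
end Zhu
end

section
namespace Zhu
open Filter

lemma finsum_eventually {M : Type*} [AddCommMonoid M] (f : ℕ → M) (K0 : ℕ) (h : ∀ i, K0 ≤ i → f i = 0) :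
    ∀ᶠ K in atTop, ∑ᶠ i, f i = ∑ i ∈ Finset.range K, f i := by
  filter_upwards [eventually_ge_atTop K0] with K hK
  apply finsum_eq_finsetSum_of_support_subset
  intro i hi
  simp only [Finset.coe_range, Set.mem_Iio]
  by_contra hc
  exact hi (h i (by omega))

variable {W : Type} [AddCommGroup W] [Module ℂ W] (B : VOA W)

lemma trunc_nat (u v : W) (p : ℤ) : ∃ K : ℕ, ∀ i : ℕ, K ≤ i → B.Y u (p + i) v = 0 := by
  obtain ⟨N, hN⟩ := B.trunc u v
  exact ⟨(N - p).toNat, fun i hi => hN _ (by omega)⟩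

lemma borcherds_ev (u v w : W) (p m n : ℤ) : ∀ᶠ K in atTop,
    ∑ i ∈ Finset.range K, zchoose m i • B.Y (B.Y u (p + i) v) (m + n - i) w
      = ∑ i ∈ Finset.range K, ((-1 : ℂ) ^ i * zchoose p i) •
          (B.Y u (m + p - i) (B.Y v (n + i) w)
            - ((-1 : ℂ) ^ p) • B.Y v (n + p - i) (B.Y u (m + i) w)) := by
  obtain ⟨K1, h1⟩ := trunc_nat B u v p
  obtain ⟨K2, h2⟩ := trunc_nat B v w n
  obtain ⟨K3, h3⟩ := trunc_nat B u w m
  have e1 := finsum_eventually (fun i : ℕ => zchoose m i • B.Y (B.Y u (p + i) v) (m + n - i) w) K1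
    (fun i hi => by simp [h1 i hi])
  have e2 := finsum_eventually (fun i : ℕ => ((-1 : ℂ) ^ i * zchoose p i) •
          (B.Y u (m + p - i) (B.Y v (n + i) w)
            - ((-1 : ℂ) ^ p) • B.Y v (n + p - i) (B.Y u (m + i) w))) (max K2 K3)
    (fun i hi => by simp [h2 i (le_trans (le_max_left _ _) hi), h3 i (le_trans (le_max_right _ _) hi)])
  filter_upwards [e1, e2] with K h1 h2
  rw [← h1, ← h2, B.borcherds]

/-- modes as a linear map -/
def Ym (n : ℤ) : W →ₗ[ℂ] Module.End ℂ W := (LinearMap.proj n) ∘ₗ B.Y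

/-- `Res Y(u,z)(1+z)^w z^N` -/
def md (w : ℕ) (N : ℤ) : W →ₗ[ℂ] Module.End ℂ W := bs w (fun n => Ym B n) N

lemma md_bs (w : ℕ) (N : ℤ) (u v : W) : md B w N u v = bs w (fun n => B.Y u n v) N := by
  have h1 := bs_apply (LinearMap.applyₗ (R := ℂ) (M := W) (M₂ := Module.End ℂ W) u) w (fun n => Ym B n) N
  have h2 := bs_apply (LinearMap.applyₗ (R := ℂ) (M := W) (M₂ := W) v) w (fun n => Ym B n u) N
  simp only [LinearMap.applyₗ_apply_apply] at h1 h2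
  rw [md, h1, h2]; rfl

lemma md_eq (w : ℕ) (N : ℤ) (u v : W) :
    md B w N u v = ∑ i ∈ Finset.range (w+1), (w.choose i : ℂ) • B.Y u (N+i) v := by
  rw [md_bs, bs_eq]

lemma md_add (w k : ℕ) (N : ℤ) (u v : W) : md B (w + k) N u v = bs k (fun n => md B w n u v) N := by
  rw [md_bs, add_comm, bs_add]; congr 1; funext n; rw [md_bs]

lemma md_succ (w : ℕ) (N : ℤ) (u v : W) : md B (w+1) N u v = md B w N u v + md B w (N+1) u v := by
  rw [md_bs, md_bs, md_bs, bs_succ]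

lemma md_trunc (w : ℕ) (u v : W) (p : ℤ) : ∃ K : ℕ, ∀ i : ℕ, K ≤ i → md B w (p + i) u v = 0 := by
  obtain ⟨K, hK⟩ := trunc_nat B u v p
  refine ⟨K, fun i hi => ?_⟩
  rw [md_bs]
  refine bs_congr_zero _ _ _ fun n hn => ?_
  have := hK (n - p).toNat (by omega)
  rwa [show p + ((n-p).toNat:ℤ) = n by omega] at this

lemma md_borcherds (a b w : W) (α β : ℕ) (p N : ℤ) : ∀ᶠ K in atTop,
    ∑ i ∈ Finset.range K, (α.choose i : ℂ) • md B (α - i + β) N (B.Y a (p+i) b) w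
      = ∑ i ∈ Finset.range K, ((-1 : ℂ) ^ i * zchoose p i) •
        (md B α (p-i) a (md B β (N+i) b w) - ((-1:ℂ)^p) • md B β (N+p-i) b (md B α i a w)) := by
  have key : ∀ᶠ K in atTop, ∀ m ∈ Finset.range (α+1), ∀ n ∈ Finset.range (β+1),
      ∑ i ∈ Finset.range K, zchoose m i • B.Y (B.Y a (p + i) b) (m + (N + n) - i) w
      = ∑ i ∈ Finset.range K, ((-1 : ℂ) ^ i * zchoose p i) •
          (B.Y a (m + p - i) (B.Y b (N + n + i) w)
            - ((-1 : ℂ) ^ p) • B.Y b (N + n + p - i) (B.Y a (m + i) w)) := by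
    rw [eventually_all_finset]; intro m _
    rw [eventually_all_finset]; intro n _
    exact borcherds_ev B a b w p m (N+n)
  filter_upwards [key] with K hK
  have h2 : ∑ m ∈ Finset.range (α+1), ∑ n ∈ Finset.range (β+1), ((α.choose m : ℂ) * (β.choose n : ℂ)) •
      ∑ i ∈ Finset.range K, zchoose m i • B.Y (B.Y a (p + i) b) (m + (N + n) - i) w
      = ∑ m ∈ Finset.range (α+1), ∑ n ∈ Finset.range (β+1), ((α.choose m : ℂ) * (β.choose n : ℂ)) •
      ∑ i ∈ Finset.range K, ((-1 : ℂ) ^ i * zchoose p i) •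
          (B.Y a (m + p - i) (B.Y b (N + n + i) w)
            - ((-1 : ℂ) ^ p) • B.Y b (N + n + p - i) (B.Y a (m + i) w)) := by
    refine Finset.sum_congr rfl fun m hm => Finset.sum_congr rfl fun n hn => ?_
    rw [hK m hm n hn]
  have swap : ∀ F : ℕ → ℕ → ℕ → W, 
      ∑ m ∈ Finset.range (α+1), ∑ n ∈ Finset.range (β+1), ((α.choose m : ℂ) * (β.choose n : ℂ)) •
      ∑ i ∈ Finset.range K, F m n i = ∑ i ∈ Finset.range K, ∑ m ∈ Finset.range (α+1), ∑ n ∈ Finset.range (β+1), 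
      ((α.choose m : ℂ) * (β.choose n : ℂ)) • F m n i := by
    intro F
    simp only [Finset.smul_sum]
    rw [Finset.sum_comm (s := Finset.range K)]
    refine (Finset.sum_congr rfl fun m _ => ?_)
    rw [Finset.sum_comm]
  rw [swap, swap] at h2
  convert h2 using 1
  · refine Finset.sum_congr rfl fun i _ => ?_
    rw [md_bs, bs_add, ← bs_choose]
    refine Finset.sum_congr rfl fun m _ => ?_
    rw [bs_eq, Finset.smul_sum]
    refine Finset.sum_congr rfl fun n _ => ?_
    rw [zchoose_natCast, smul_smul, smul_smul]
    congr 1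
    · ring
    · congr 2; ring
  · refine Finset.sum_congr rfl fun i _ => ?_
    simp only [smul_sub, Finset.sum_sub_distrib]
    congr 1
    · rw [md_eq]
      simp only [md_eq, map_sum, map_smul, Finset.smul_sum]
      refine Finset.sum_congr rfl fun m _ => Finset.sum_congr rfl fun n _ => ?_
      simp only [smul_smul]
      congr 1
      · ring
      · congr 2
        · ring
        · congr 2; ring
    · rw [md_eq, Finset.sum_comm]
      simp only [md_eq, map_sum, map_smul, Finset.smul_sum]
      refine Finset.sum_congr rfl fun m _ => Finset.sum_congr rfl fun n _ => ?_
      simp only [smul_smul]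
      congr 1
      · ring
      · congr 2
        · ring
        · congr 2; ring
end Zhu
end

section
namespace Zhu
open Filter
variable {W : Type} [AddCommGroup W] [Module ℂ W] (B : VOA W)

lemma decompose_of {k : ℤ} {u : W} (hu : u ∈ B.wt k) :
    B.decompose u = DirectSum.lof ℂ ℤ (fun n => B.wt n) k ⟨u, hu⟩ := by
  have h : B.decompose.symm (DirectSum.lof ℂ ℤ (fun n => B.wt n) k ⟨u, hu⟩) = u := by
    change DirectSum.coeLinearMap B.wt (DirectSum.lof ℂ ℤ (fun n => B.wt n) k ⟨u, hu⟩) = u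
    rw [DirectSum.coeLinearMap_lof]
  rw [← B.decompose.symm.injective.eq_iff, h, LinearEquiv.symm_apply_apply]

/-- The extension of `md` to all vectors by linearity over homogeneous components. -/
noncomputable def zm (N : ℤ) : W →ₗ[ℂ] Module.End ℂ W :=
  (DirectSum.toModule ℂ ℤ (Module.End ℂ W) (fun k => (md B k.toNat N) ∘ₗ (B.wt k).subtype)) ∘ₗ
    B.decompose.toLinearMap

lemma zm_of' {k : ℤ} {u : W} (hu : u ∈ B.wt k) (N : ℤ) : zm B N u = md B k.toNat N u := by
  simp [zm, decompose_of B hu]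

lemma zm_of {k : ℕ} {u : W} (hu : u ∈ B.wt k) (N : ℤ) : zm B N u = md B k N u := by
  simp [zm_of' B hu N]

lemma zero_of_neg (hn : ∀ n : ℤ, n < 0 → B.wt n = ⊥) {k : ℤ} (hk : k < 0) {u : W} (hu : u ∈ B.wt k) : u = 0 := by
  rw [hn k hk] at hu; simpa using hu

lemma hom_ind (hn : ∀ n : ℤ, n < 0 → B.wt n = ⊥) {P : W → Prop} (h0 : P 0)
    (ha : ∀ u v, P u → P v → P (u + v)) (hk : ∀ (k : ℕ) (u : W), u ∈ B.wt k → P u) (u : W) : P u := by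
  have : u ∈ ⨆ n, B.wt n := by rw [B.internal.submodule_iSup_eq_top]; trivial
  refine Submodule.iSup_induction _ (motive := P) this (fun k x hx => ?_) h0 ha
  by_cases h : k < 0
  · rw [zero_of_neg B hn h hx]; exact h0
  · lift k to ℕ using by omega
    exact hk k x hx

open Classical in
lemma decompose_sum (u : W) : u = ∑ k ∈ (B.decompose u).support, B.hcomp k u := by
  conv_lhs => rw [← B.decompose.symm_apply_apply u]
  have : (B.decompose.symm (B.decompose u)) = DirectSum.coeLinearMap B.wt (B.decompose u) := by
    rw [VOA.decompose]; rfl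
  rw [this, DirectSum.coeLinearMap_eq_dfinsuppSum]
  rfl

lemma mulAux_eq (hn : ∀ n : ℤ, n < 0 → B.wt n = ⊥) {k : ℤ} {u : W} (hu : u ∈ B.wt k) (v : W) :
    B.mulAux k u v = zm B (-1) u v := by
  by_cases h : k < 0
  · rw [zero_of_neg B hn h hu]; simp [VOA.mulAux]
  · lift k to ℕ using by omega
    rw [zm_of B hu, md_eq, VOA.mulAux]
    rw [finsum_eq_finsetSum_of_support_subset (s := Finset.range (k+1))]
    · refine Finset.sum_congr rfl fun i _ => ?_
      rw [zchoose_natCast, neg_add_eq_sub]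
    · intro i hi
      simp only [Finset.coe_range, Set.mem_Iio]
      by_contra hc
      apply hi
      simp only [zchoose_natCast]
      rw [Nat.choose_eq_zero_of_lt (by omega)]; simp

lemma circAux_eq (hn : ∀ n : ℤ, n < 0 → B.wt n = ⊥) {k : ℤ} {u : W} (hu : u ∈ B.wt k) (v : W) :
    B.circAux k u v = zm B (-2) u v := by
  by_cases h : k < 0
  · rw [zero_of_neg B hn h hu]; simp [VOA.circAux]
  · lift k to ℕ using by omega
    rw [zm_of B hu, md_eq, VOA.circAux]
    rw [finsum_eq_finsetSum_of_support_subset (s := Finset.range (k+1))]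
    · refine Finset.sum_congr rfl fun i _ => ?_
      rw [zchoose_natCast, neg_add_eq_sub]
    · intro i hi
      simp only [Finset.coe_range, Set.mem_Iio]
      by_contra hc
      apply hi
      simp only [zchoose_natCast]
      rw [Nat.choose_eq_zero_of_lt (by omega)]; simp

lemma hcomp_mem (k : ℤ) (u : W) : B.hcomp k u ∈ B.wt k := (B.decompose u k).2

lemma star_eq (hn : ∀ n : ℤ, n < 0 → B.wt n = ⊥) (u v : W) : B.star u v = zm B (-1) u v := by
  classical
  rw [VOA.star]
  have h1 : ∀ k, B.mulAux k (B.hcomp k u) v = zm B (-1) (B.hcomp k u) v := fun k =>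
    mulAux_eq B hn (hcomp_mem B k u) v
  simp only [h1]
  rw [finsum_eq_finsetSum_of_support_subset (s := (B.decompose u).support)]
  · conv_rhs => rw [decompose_sum B u]
    simp
  · intro k hk
    by_contra hc
    apply hk
    have : B.hcomp k u = 0 := by
      simp only [SetLike.mem_coe, DFinsupp.mem_support_toFun, ne_eq, not_not] at hc
      simp [VOA.hcomp, hc]
    simp [this]

lemma Osub_le (hn : ∀ n : ℤ, n < 0 → B.wt n = ⊥) (P : Submodule ℂ W)
    (h : ∀ (k : ℕ) (u v : W), u ∈ B.wt k → zm B (-2) u v ∈ P) : B.Osub ≤ P := by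
  rw [VOA.Osub, Submodule.span_le]
  rintro w ⟨k, u, v, hu, rfl⟩
  rw [circAux_eq B hn hu]
  by_cases hk : k < 0
  · rw [zero_of_neg B hn hk hu]; simp
  · lift k to ℕ using by omega
    exact h k u v hu

lemma bs_deriv {M : Type*} [AddCommGroup M] [Module ℂ M] (f : ℤ → M) (w : ℕ) (N : ℤ) :
    bs (w+1) (fun n => (n:ℂ) • f (n-1)) N = (N:ℂ) • bs w f (N-1) + ((N:ℂ) + w + 1) • bs w f N := by
  induction w generalizing N with
  | zero => simp [bs_succ]
  | succ w ih =>
    rw [bs_succ, ih, ih, bs_succ, bs_succ, sub_add_cancel, add_sub_cancel_right]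
    push_cast
    module

lemma L1_wt {k : ℤ} {u : W} (hu : u ∈ B.wt k) : B.Y B.omega 0 u ∈ B.wt (k+1) := by
  have := B.mode_wt 2 _ B.omega_wt k 0 u hu
  convert this using 2; ring

lemma zm_mem_O (hn : ∀ n : ℤ, n < 0 → B.wt n = ⊥) (u v : W) (N : ℤ) (hN : N ≤ -2) : zm B N u v ∈ B.Osub := by
  obtain ⟨j, rfl⟩ : ∃ j : ℕ, N = -2 - j := ⟨(-2 - N).toNat, by omega⟩
  clear hN
  refine hom_ind B hn (P := fun u => zm B (-2 - (j:ℤ)) u v ∈ B.Osub) (by simp) (fun a b ha hb => by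
    simpa using add_mem ha hb) ?_ u
  clear u
  induction j with
  | zero =>
    intro k u hu
    apply Submodule.subset_span
    exact ⟨k, u, v, hu, by rw [circAux_eq B hn hu]; simp⟩
  | succ j ih =>
    intro k u hu
    have h1 := ih k u hu
    have h2 := ih (k+1) _ (by exact_mod_cast L1_wt B hu)
    have e := bs_deriv (fun n => B.Y u n v) k (-2 - j)
    have e2 : zm B (-2 - (j:ℤ)) (B.Y B.omega 0 u) v = - (((-2 - (j:ℤ) : ℤ):ℂ) • zm B (-2 - ((j+1:ℕ):ℤ)) u v
        + (((-2 - (j:ℤ) : ℤ):ℂ) + k + 1) • zm B (-2 - (j:ℤ)) u v) := by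
      rw [zm_of B hu, zm_of B hu, zm_of B (k := k+1) (by exact_mod_cast L1_wt B hu), md_bs, md_bs, md_bs,
        show (-2 - ((j+1:ℕ):ℤ)) = -2 - (j:ℤ) - 1 by push_cast; ring, ← e]
      simp only [B.translation, bs_eq, LinearMap.smul_apply, LinearMap.neg_apply, ← Finset.sum_neg_distrib, neg_smul, smul_neg]
    have hc : (((-2 - (j:ℤ) : ℤ):ℂ)) ≠ 0 := by
      exact_mod_cast (by omega : (-2 - (j:ℤ)) ≠ 0)
    have e3 : zm B (-2 - ((j+1:ℕ):ℤ)) u v = (((-2 - (j:ℤ) : ℤ):ℂ))⁻¹ • (- zm B (-2 - (j:ℤ)) (B.Y B.omega 0 u) v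
       - (((-2 - (j:ℤ) : ℤ):ℂ) + k + 1) • zm B (-2 - (j:ℤ)) u v) := by
      rw [e2, eq_inv_smul_iff₀ hc]; module
    rw [e3]
    exact Submodule.smul_mem _ _ (sub_mem (neg_mem h2) (Submodule.smul_mem _ _ h1))

lemma zm_one (N : ℤ) (v : W) : zm B N B.one v = if N = -1 then v else 0 := by
  rw [zm_of B (k := 0) (by exact_mod_cast B.one_wt), md_eq]
  simp only [B.vacuum_act]
  split_ifs <;> simp_all

lemma md_vac (w : ℕ) (u : W) : md B w (-1) u B.one = u := by
  rw [md_eq, Finset.sum_range_succ', Finset.sum_eq_zero]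
  · simp [B.create]
  · intro i _
    rw [B.create_ge _ _ (by push_cast; omega), smul_zero]

lemma zm_vac (hn : ∀ n : ℤ, n < 0 → B.wt n = ⊥) (u : W) : zm B (-1) u B.one = u := by
  refine hom_ind B hn (P := fun u => zm B (-1) u B.one = u) (by simp) (fun a b ha hb => by
    simp [ha, hb]) ?_ u
  intro k u hu
  rw [zm_of B hu, md_vac]

lemma trans_mem (hn : ∀ n : ℤ, n < 0 → B.wt n = ⊥) {k : ℕ} {u : W} (hu : u ∈ B.wt k) :
    B.Y u (-2) B.one + (k:ℂ) • u ∈ B.Osub := by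
  have h := zm_mem_O B hn u B.one (-2) le_rfl
  rw [zm_of B hu, md_bs] at h
  cases k with
  | zero => simpa using h
  | succ k =>
    rw [bs_eq, Finset.sum_range_succ', Finset.sum_range_succ', Finset.sum_eq_zero] at h
    · have e : (-2 + ((0+1:ℕ):ℤ)) = -1 := by norm_num
      rw [e, B.create] at h
      simp only [Nat.choose_zero_right] at h
      convert h using 1
      push_cast
      simp
      abel
    · intro i _
      rw [B.create_ge _ _ (by push_cast; omega), smul_zero]

end Zhu
end

section
namespace Zhu
open Filter
variable {W : Type} [AddCommGroup W] [Module ℂ W] (B : VOA W)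

lemma zm_wt_sub {α β : ℕ} {a b : W} (ha : a ∈ B.wt α) (hb : b ∈ B.wt β)
    (j : ℤ) (k : ℕ) (hk : (β:ℤ) + α - j - 1 = k) (N : ℤ) : zm B N (B.Y a j b) = md B k N (B.Y a j b) := by
  apply zm_of
  have := B.mode_wt α a ha β j b hb
  rwa [hk] at this

lemma zm_assoc (hn : ∀ n : ℤ, n < 0 → B.wt n = ⊥) {α β : ℕ} {a b : W} (ha : a ∈ B.wt α) (hb : b ∈ B.wt β)
    (N : ℤ) (w : W) : ∀ᶠ K in atTop, zm B N (zm B (-1) a b) w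
      = ∑ i ∈ Finset.range K, (zm B (-1 - i) a (zm B (N+i) b w) + zm B (N-1-i) b (zm B i a w)) := by
  filter_upwards [md_borcherds B a b w α β (-1) N, eventually_gt_atTop α] with K hK hα
  rw [zm_of B ha, md_bs, bs_eq_of_le _ K hα, map_sum, LinearMap.sum_apply]
  convert hK using 1
  · refine Finset.sum_congr rfl fun i _ => ?_
    by_cases hi : i ≤ α
    · rw [map_smul, LinearMap.smul_apply, zm_wt_sub B ha hb _ (α - i + β) (by omega)]
    · rw [Nat.choose_eq_zero_of_lt (by omega)]; simp
  · refine Finset.sum_congr rfl fun i _ => ?_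
    have hc : (-1:ℂ)^i * zchoose (-1) i = 1 := by
      rw [zchoose_eq]; push_cast; rw [cch_neg_one, ← mul_pow]; simp
    rw [hc, one_smul, zm_of B ha, zm_of B hb, zm_of B ha, zm_of B hb]
    simp [sub_eq_add_neg]

lemma assoc_mem (hn : ∀ n : ℤ, n < 0 → B.wt n = ⊥) (a b w : W) (N : ℤ) (hN : N ≤ -1) :
    zm B N (zm B (-1) a b) w - zm B (-1) a (zm B N b w) ∈ B.Osub := by
  revert b
  refine hom_ind B hn (P := fun a => ∀ b, zm B N (zm B (-1) a b) w - zm B (-1) a (zm B N b w) ∈ B.Osub) (by simp)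
    (fun u v hu hv b => by simpa [add_sub_add_comm] using add_mem (hu b) (hv b)) ?_ a
  intro α a ha b
  refine hom_ind B hn (P := fun b => zm B N (zm B (-1) a b) w - zm B (-1) a (zm B N b w) ∈ B.Osub) (by simp)
    (fun u v hu hv => by simpa [add_sub_add_comm] using add_mem hu hv) ?_ b
  intro β b hb
  obtain ⟨K, hK, hK0⟩ := ((zm_assoc B hn ha hb N w).and (eventually_ge_atTop 1)).exists
  obtain ⟨K, rfl⟩ := Nat.exists_eq_add_of_le' hK0
  rw [hK, Finset.sum_range_succ']
  simp only [Nat.cast_zero, sub_zero, add_zero]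
  rw [add_sub_assoc, add_sub_cancel_left]
  refine add_mem (sum_mem fun i _ => ?_) ?_
  · refine add_mem (zm_mem_O B hn _ _ _ ?_) (zm_mem_O B hn _ _ _ ?_) <;> push_cast <;> omega
  · exact zm_mem_O B hn _ _ _ (by omega)

lemma circ_mul_mem (hn : ∀ n : ℤ, n < 0 → B.wt n = ⊥) {α β : ℕ} {a b : W} (ha : a ∈ B.wt α) (hb : b ∈ B.wt β)
    (w : W) : zm B (-1) (zm B (-2) a b) w ∈ B.Osub := by
  obtain ⟨K, hK, hα⟩ := ((md_borcherds B a b w α (β+1) (-2) (-1)).and (eventually_gt_atTop α)).exists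
  have e : zm B (-1) (zm B (-2) a b) w = 
    ∑ i ∈ Finset.range K, (α.choose i : ℂ) • md B (α - i + (β+1)) (-1) (B.Y a (-2+i) b) w := by
    rw [zm_of B ha, md_bs, bs_eq_of_le _ K hα, map_sum, LinearMap.sum_apply]
    refine Finset.sum_congr rfl fun i _ => ?_
    by_cases hi : i ≤ α
    · rw [map_smul, LinearMap.smul_apply, zm_wt_sub B ha hb _ (α - i + (β+1)) (by omega)]
    · rw [Nat.choose_eq_zero_of_lt (by omega)]; simp
  rw [e, hK]
  refine sum_mem fun i _ => Submodule.smul_mem _ _ (sub_mem ?_ (Submodule.smul_mem _ _ ?_))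
  · rw [← zm_of B ha]; exact zm_mem_O B hn _ _ _ (by omega)
  · rw [md_succ, ← zm_of B hb, ← zm_of B hb]
    exact add_mem (zm_mem_O B hn _ _ _ (by omega)) (zm_mem_O B hn _ _ _ (by omega))

lemma O_mul_mem (hn : ∀ n : ℤ, n < 0 → B.wt n = ⊥) {o : W} (ho : o ∈ B.Osub) (w : W) :
    zm B (-1) o w ∈ B.Osub := by
  have : B.Osub ≤ (B.Osub).comap ((zm B (-1)).flip w) := by
    apply Osub_le B hn
    intro k u v hu
    simp only [Submodule.mem_comap, LinearMap.flip_apply]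
    refine hom_ind B hn (P := fun v => zm B (-1) (zm B (-2) u v) w ∈ B.Osub) (by simp)
      (fun a b ha hb => by simpa using add_mem ha hb) ?_ v
    intro k' v hv
    exact circ_mul_mem B hn hu hv w
  exact this ho

lemma mul_O_mem (hn : ∀ n : ℤ, n < 0 → B.wt n = ⊥) {o : W} (ho : o ∈ B.Osub) (a : W) :
    zm B (-1) a o ∈ B.Osub := by
  have : B.Osub ≤ (B.Osub).comap (zm B (-1) a) := by
    apply Osub_le B hn
    intro k u v hu
    simp only [Submodule.mem_comap]
    have h := assoc_mem B hn a u v (-2) (by norm_num)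
    have h2 := zm_mem_O B hn (zm B (-1) a u) v (-2) le_rfl
    have := sub_mem h2 h
    simpa using this
  exact this ho

/-- commutator identity -/
lemma zm_comm (hn : ∀ n : ℤ, n < 0 → B.wt n = ⊥) {α β : ℕ} {a b : W} (ha : a ∈ B.wt α) (hb : b ∈ B.wt β)
    (N : ℤ) (w : W) : ∀ᶠ K in atTop, zm B (-1) a (zm B N b w) - zm B N b (zm B (-1) a w)
      = ∑ r ∈ Finset.range K, ∑ p ∈ Finset.range (r+1), ((-1)^p * (α.choose (r-p) : ℂ)) •
          bs (p+1) (fun n => zm B n (B.Y a r b) w) (N-1-p) := by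
  have key : ∀ᶠ K in atTop, ∀ m ∈ Finset.range (α+1), ∀ n ∈ Finset.range (β+1),
      ∑ i ∈ Finset.range K, zchoose ((m:ℤ)-1) i • B.Y (B.Y a (0 + i) b) ((m:ℤ) - 1 + (N + n) - i) w
      = ∑ i ∈ Finset.range K, ((-1 : ℂ) ^ i * zchoose 0 i) •
          (B.Y a ((m:ℤ) - 1 + 0 - i) (B.Y b (N + n + i) w)
            - ((-1 : ℂ) ^ (0:ℤ)) • B.Y b (N + n + 0 - i) (B.Y a ((m:ℤ) - 1 + i) w)) := by
    rw [eventually_all_finset]; intro m _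
    rw [eventually_all_finset]; intro n _
    exact borcherds_ev B a b w 0 ((m:ℤ)-1) (N+n)
  filter_upwards [key, eventually_ge_atTop 1] with K hK hK1
  have hK' : ∀ m ∈ Finset.range (α+1), ∀ n ∈ Finset.range (β+1), 
     B.Y a (-1 + m) (B.Y b (N+n) w) - B.Y b (N+n) (B.Y a (-1+m) w) = 
     ∑ i ∈ Finset.range K, zchoose ((m:ℤ)-1) i • B.Y (B.Y a i b) (N - 1 - i + m + n) w := by
    intro m hm n hn
    obtain ⟨K, rfl⟩ := Nat.exists_eq_add_of_le' hK1
    have := (hK m hm n hn).trans (Finset.sum_eq_single_of_mem 0 (by simp) (fun i _ hi => by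
      obtain ⟨i, rfl⟩ := Nat.exists_eq_succ_of_ne_zero hi
      have : zchoose 0 (i+1) = 0 := by
        have := zchoose_natCast 0 (i+1); simpa using this
      rw [Nat.succ_eq_add_one, this]; simp))
    simp only [zchoose_eq] at this ⊢
    simp at this
    rw [neg_add_eq_sub, ← this]
    refine Finset.sum_congr rfl fun i _ => ?_
    push_cast
    congr 3; ring
  have e1 : zm B (-1) a (zm B N b w) - zm B N b (zm B (-1) a w) = 
     ∑ m ∈ Finset.range (α+1), ∑ n ∈ Finset.range (β+1), ((α.choose m : ℂ) * (β.choose n : ℂ)) • 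
       (B.Y a (-1 + m) (B.Y b (N+n) w) - B.Y b (N+n) (B.Y a (-1+m) w)) := by
    rw [zm_of B ha, zm_of B hb]
    simp only [smul_sub, Finset.sum_sub_distrib]
    congr 1
    · rw [Finset.sum_comm]
      simp only [md_eq, map_sum, map_smul, Finset.smul_sum, smul_smul]
      refine Finset.sum_congr rfl fun m _ => Finset.sum_congr rfl fun n _ => ?_
      rw [mul_comm]
    · simp only [md_eq, map_sum, map_smul, Finset.smul_sum, smul_smul]
  rw [e1]
  have e2 : ∑ m ∈ Finset.range (α+1), ∑ n ∈ Finset.range (β+1), ((α.choose m : ℂ) * (β.choose n : ℂ)) • 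
       (B.Y a (-1 + m) (B.Y b (N+n) w) - B.Y b (N+n) (B.Y a (-1+m) w)) = 
      ∑ r ∈ Finset.range K, ∑ p ∈ Finset.range (r+1), ∑ m ∈ Finset.range (α+1), 
       ((-1)^p * ((α.choose m : ℂ) * (m.choose (r-p):ℂ))) • bs β (fun n => B.Y (B.Y a r b) n w) (N-1-r+m) := by
    have : ∀ m ∈ Finset.range (α+1), ∑ n ∈ Finset.range (β+1), ((α.choose m : ℂ) * (β.choose n : ℂ)) • 
       (B.Y a (-1 + m) (B.Y b (N+n) w) - B.Y b (N+n) (B.Y a (-1+m) w)) = 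
       ∑ r ∈ Finset.range K, ((α.choose m : ℂ) * zchoose ((m:ℤ)-1) r) • bs β (fun n => B.Y (B.Y a r b) n w) (N-1-r+m) := by
      intro m hm
      rw [Finset.sum_congr rfl (fun n hn => by rw [hK' m hm n hn])]
      simp only [Finset.smul_sum, bs_eq]
      rw [Finset.sum_comm]
      refine Finset.sum_congr rfl fun r _ => Finset.sum_congr rfl fun n _ => ?_
      simp only [smul_smul]; congr 1; ring
    rw [Finset.sum_congr rfl this, Finset.sum_comm]
    refine Finset.sum_congr rfl fun r _ => ?_
    rw [Finset.sum_comm]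
    refine Finset.sum_congr rfl fun m _ => ?_
    rw [← Finset.sum_smul]
    congr 1
    rw [zchoose_eq]; push_cast
    rw [cch_sub_one, Finset.mul_sum]
    refine Finset.sum_congr rfl fun p _ => ?_
    rw [cch_natCast]; ring
  rw [e2]
  refine Finset.sum_congr rfl fun r _ => Finset.sum_congr rfl fun p hp => ?_
  simp only [Finset.mem_range] at hp
  have e3 := bs_choose α (r-p) (bs β (fun n => B.Y (B.Y a r b) n w)) (N-1-p)
  simp only [mul_smul, ← Finset.smul_sum] at e3 ⊢
  congr 1
  have e4 : ∀ m : ℕ, (N - 1 - (p:ℤ) + (m:ℤ) - ((r-p : ℕ):ℤ)) = N - 1 - r + m := by intro m; omega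
  simp only [e4] at e3
  rw [e3]
  by_cases h1 : r - p ≤ α
  swap
  · rw [Nat.choose_eq_zero_of_lt (by omega)]; simp
  congr 1
  rw [← bs_add]
  have hw := B.mode_wt α a ha β r b hb
  by_cases h2 : (β:ℤ) + α - r - 1 < 0
  · rw [zero_of_neg B hn h2 hw]; simp [bs_eq]
  · obtain ⟨k, hk⟩ : ∃ k : ℕ, (β:ℤ) + α - r - 1 = k := ⟨((β:ℤ) + α - r - 1).toNat, by omega⟩
    have e5 : (fun n => zm B n (B.Y a r b) w) = fun n => md B k n (B.Y a r b) w := by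
      funext n; rw [zm_wt_sub B ha hb _ k hk]
    rw [e5, ← md_add, md_bs]
    congr 1; omega

lemma comm_mem (hn : ∀ n : ℤ, n < 0 → B.wt n = ⊥) {α β : ℕ} {a b : W} (ha : a ∈ B.wt α) (hb : b ∈ B.wt β)
    (N : ℤ) (hN : N ≤ -2) (w : W) (P : Submodule ℂ W)
    (hP : ∀ (r : ℕ) (M : ℤ), M ≤ -2 → zm B M (B.Y a r b) w ∈ P) :
    zm B (-1) a (zm B N b w) - zm B N b (zm B (-1) a w) ∈ P := by
  obtain ⟨K, hK⟩ := (zm_comm B hn ha hb N w).exists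
  rw [hK]
  refine sum_mem fun r _ => sum_mem fun p _ => Submodule.smul_mem _ _ ?_
  rw [bs_eq]
  refine sum_mem fun i hi => Submodule.smul_mem _ _ (hP _ _ ?_)
  simp only [Finset.mem_range] at hi
  omega

lemma comm_formula (hn : ∀ n : ℤ, n < 0 → B.wt n = ⊥) {α β : ℕ} {a b : W} (ha : a ∈ B.wt (α+1:ℕ)) (hb : b ∈ B.wt β) :
    zm B (-1) a b - zm B (-1) b a - ∑ r ∈ Finset.range (α+1), (α.choose r : ℂ) • B.Y a r b ∈ B.Osub := by
  obtain ⟨K, hK, hK1⟩ := ((zm_comm B hn ha hb (-1) B.one).and (eventually_gt_atTop α)).exists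
  rw [zm_vac B hn, zm_vac B hn] at hK
  have : ∑ r ∈ Finset.range (α+1), (α.choose r : ℂ) • B.Y a r b = ∑ r ∈ Finset.range K, ∑ p ∈ Finset.range (r+1),
     ((-1)^p * ((α+1).choose (r-p) : ℂ)) • B.Y a r b := by
    have : ∑ r ∈ Finset.range (α+1), (α.choose r : ℂ) • B.Y a r b = ∑ r ∈ Finset.range K, (α.choose r : ℂ) • B.Y a r b := by
      apply Finset.sum_subset
      · intro x; simp; omega
      · intro x _ hx; rw [Nat.choose_eq_zero_of_lt (by simp at hx; omega)]; simp
    rw [this]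
    refine Finset.sum_congr rfl fun r _ => ?_
    rw [← Finset.sum_smul]
    congr 1
    have := cch_sub_one ((α+1:ℕ):ℂ) r
    simp only [cch_natCast] at this
    rw [← this, ← cch_natCast]; push_cast; congr 1; ring
  rw [hK, this, ← Finset.sum_sub_distrib]
  refine sum_mem fun r _ => ?_
  rw [← Finset.sum_sub_distrib]
  refine sum_mem fun p _ => ?_
  rw [← smul_sub]
  refine Submodule.smul_mem _ _ ?_
  rw [bs_eq, Finset.sum_range_succ, Nat.choose_self, Nat.cast_one, one_smul]
  have : (-1 - 1 - (p:ℤ) + ((p+1:ℕ):ℤ)) = -1 := by push_cast; ring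
  rw [this, zm_vac B hn, add_sub_cancel_right]
  refine sum_mem fun i hi => Submodule.smul_mem _ _ (zm_mem_O B hn _ _ _ ?_)
  simp only [Finset.mem_range] at hi
  omega

end Zhu
end

section
namespace Zhu
variable {W : Type} [AddCommGroup W] [Module ℂ W] (B : VOA W)

/-- Zhu's product on the quotient, as a bilinear map. -/
noncomputable def zmul (hn : ∀ n : ℤ, n < 0 → B.wt n = ⊥) :
    (W ⧸ B.Osub) →ₗ[ℂ] (W ⧸ B.Osub) →ₗ[ℂ] (W ⧸ B.Osub) :=
  B.Osub.liftQ
    { toFun := fun a => B.Osub.mapQ B.Osub (zm B (-1) a) (fun _ ho => mul_O_mem B hn ho a)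
      map_add' := fun a b => by
        apply Submodule.linearMap_qext; ext v; simp
      map_smul' := fun c a => by
        apply Submodule.linearMap_qext; ext v; simp }
    (fun o ho => by
      rw [LinearMap.mem_ker]
      apply Submodule.linearMap_qext; ext v
      simpa using O_mul_mem B hn ho v)

lemma zmul_mk (hn : ∀ n : ℤ, n < 0 → B.wt n = ⊥) (u v : W) :
    zmul B hn (B.Osub.mkQ u) (B.Osub.mkQ v) = B.Osub.mkQ (zm B (-1) u v) := by
  simp [zmul]

/-- ring structure -/
@[reducible] noncomputable def zring (hn : ∀ n : ℤ, n < 0 → B.wt n = ⊥) : Ring (W ⧸ B.Osub) :=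
  { (inferInstance : AddCommGroup (W ⧸ B.Osub)) with
    mul := fun a b => zmul B hn a b
    one := B.Osub.mkQ B.one
    left_distrib := fun a b c => map_add (zmul B hn a) b c
    right_distrib := fun a b c => by
      change zmul B hn (a+b) c = zmul B hn a c + zmul B hn b c
      simp
    zero_mul := fun a => by change zmul B hn 0 a = 0; simp
    mul_zero := fun a => by change zmul B hn a 0 = 0; simp
    mul_assoc := fun a b c => by
      change zmul B hn (zmul B hn a b) c = zmul B hn a (zmul B hn b c)
      obtain ⟨a, rfl⟩ := B.Osub.mkQ_surjective a
      obtain ⟨b, rfl⟩ := B.Osub.mkQ_surjective b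
      obtain ⟨c, rfl⟩ := B.Osub.mkQ_surjective c
      simp only [zmul_mk]
      rw [← sub_eq_zero, ← map_sub, Submodule.mkQ_apply, Submodule.Quotient.mk_eq_zero]
      exact assoc_mem B hn a b c (-1) le_rfl
    one_mul := fun a => by
      change zmul B hn (B.Osub.mkQ B.one) a = a
      obtain ⟨a, rfl⟩ := B.Osub.mkQ_surjective a
      rw [zmul_mk, zm_one]; simp
    mul_one := fun a => by
      change zmul B hn a (B.Osub.mkQ B.one) = a
      obtain ⟨a, rfl⟩ := B.Osub.mkQ_surjective a
      rw [zmul_mk, zm_vac B hn] }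

/-- algebra structure -/
@[reducible] noncomputable def zalg (hn : ∀ n : ℤ, n < 0 → B.wt n = ⊥) : @Algebra ℂ (W ⧸ B.Osub) _ (zring B hn).toSemiring :=
  letI := zring B hn
  Algebra.ofModule (R := ℂ) (A := W ⧸ B.Osub)
    (fun r x y => by change zmul B hn (r • x) y = r • zmul B hn x y; simp)
    (fun r x y => by change zmul B hn x (r • y) = r • zmul B hn x y; simp)

theorem exists_zhu (hn : ∀ n : ℤ, n < 0 → B.wt n = ⊥) :
    ∃ (R : Type) (_ : Ring R) (_ : Algebra ℂ R), Nonempty (ZhuRealization B R) := by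
  refine ⟨W ⧸ B.Osub, zring B hn, zalg B hn, ⟨?_⟩⟩
  letI := zring B hn
  letI := zalg B hn
  exact {
    π := { toFun := fun x => B.Osub.mkQ x, map_add' := fun a b => by simpa using map_add B.Osub.mkQ a b,
           map_smul' := fun a b => by simpa using map_smul B.Osub.mkQ a b }
    surj := B.Osub.mkQ_surjective
    ker_eq := by
      ext x
      rw [LinearMap.mem_ker]
      exact Submodule.Quotient.mk_eq_zero _
    map_star := fun u v => by
      rw [star_eq B hn]
      exact (zmul_mk B hn u v).symm
    map_one := rfl }

end Zhu
end

section
namespace Zhu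
open Filter

lemma cch_succ' (x : ℂ) (k : ℕ) : ((k:ℂ)+1) * cch x (k+1) = x * cch (x-1) k := by
  induction k with
  | zero => simp [cch]
  | succ k ih =>
    have h1 := cch_succ_mul x (k+1)
    have h2 := cch_succ_mul (x-1) k
    have h3 : ((k:ℂ) + 1) ≠ 0 := by exact_mod_cast Nat.succ_ne_zero k
    push_cast at *
    apply mul_left_cancel₀ h3
    linear_combination ((k:ℂ)+1) * h1 + (x - (k+1)) * ih - x * h2

section
variable {ℓ : ℕ} {V : Type} [AddCommGroup V] [Module ℂ V] {A : VOA V} {h : Fin ℓ → V}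

/-- `h_b(-(k+1))𝟏` -/
def hv (A : VOA V) (h : Fin ℓ → V) (b : Fin ℓ) (k : ℕ) : V := A.Y (h b) (-(k+1)) A.one

/-- `h_a(-(i+1))h_b(-(j+1))𝟏` -/
def sv (A : VOA V) (h : Fin ℓ → V) (a b : Fin ℓ) (i j : ℕ) : V := A.Y (h a) (-(i+1)) (hv A h b j)

lemma comm_apply (H : IsHeisenberg A h) (a b : Fin ℓ) (m n : ℤ) (v : V) :
    A.Y (h a) m (A.Y (h b) n v) = A.Y (h b) n (A.Y (h a) m v) +
      (if a = b ∧ m + n = 0 then (m : ℂ) else 0) • v := by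
  have := congrArg (fun f : Module.End ℂ V => f v) (H.heis_comm a b m n)
  simp only [LinearMap.sub_apply, Module.End.mul_apply, LinearMap.smul_apply, Module.End.one_apply] at this
  rw [← this]; abel

lemma word_ind (H : IsHeisenberg A h) {P : V → Prop} (h0 : P 0) (hadd : ∀ u v, P u → P v → P (u+v))
    (hsmul : ∀ (c : ℂ) u, P u → P (c • u))
    (h1 : P A.one) (hc : ∀ a (n : ℕ) v, P v → P (A.Y (h a) (-(n+1)) v)) (v : V) : P v := by
  have hw : ∀ L : List (Fin ℓ × ℕ+), P (wordAct (fun a k w => A.Y (h a) k w) L A.one) := by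
    intro L
    induction L with
    | nil => exact h1
    | cons x L ih =>
      obtain ⟨a, n⟩ := x
      have := hc a n.natPred _ ih
      rw [wordAct]
      convert this using 3
      have := n.natPred_add_one
      omega
  have hv : v ∈ Submodule.span ℂ {v : V | ∃ L : List (Fin ℓ × ℕ+),
        v = wordAct (fun a k w => A.Y (h a) k w) L A.one} := by rw [H.span_words]; trivial
  induction hv using Submodule.span_induction with
  | mem x hx => obtain ⟨L, rfl⟩ := hx; exact hw L
  | zero => exact h0
  | add x y _ _ hx hy => exact hadd x y hx hy
  | smul c x _ hx => exact hsmul c x hx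

lemma H_zero (H : IsHeisenberg A h) (a : Fin ℓ) (v : V) : A.Y (h a) 0 v = 0 := by
  refine word_ind H (P := fun v => A.Y (h a) 0 v = 0) (by simp) (fun u v hu hv => by simp [hu, hv])
    (fun c u hu => by simp [hu]) (A.create_ge _ _ le_rfl) (fun b n v hv => ?_) v
  rw [comm_apply H, hv]; simp

lemma hv_mode (H : IsHeisenberg A h) (b : Fin ℓ) (k : ℕ) (K : ℤ) :
    A.Y (hv A h b k) K = ((-1)^k * cch (K:ℂ) k) • A.Y (h b) (K - k) := by
  induction k generalizing K with
  | zero => simp [hv, A.create]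
  | succ k ih =>
    have h3 : ((k:ℂ) + 1) ≠ 0 := by exact_mod_cast Nat.succ_ne_zero k
    have e0 : A.Y A.omega 0 (hv A h b k) = A.Y (hv A h b k) (-2) A.one := by
      have := A.create (A.Y A.omega 0 (hv A h b k))
      rw [A.translation] at this
      rw [← this]; simp
    have e1 : A.Y A.omega 0 (hv A h b k) = ((k:ℂ)+1) • hv A h b (k+1) := by
      rw [e0, ih, hv]
      simp only [LinearMap.smul_apply]
      push_cast
      rw [cch_neg_two, ← mul_assoc, ← mul_pow]
      simp
      congr 3; ring
    have e2 := A.translation (hv A h b k) K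
    rw [e1, map_smul, Pi.smul_apply] at e2
    have e3 : A.Y (hv A h b (k+1)) K = ((k:ℂ)+1)⁻¹ • (-(K:ℂ)) • A.Y (hv A h b k) (K-1) := by
      rw [← e2, inv_smul_smul₀ h3]
    rw [e3, ih, smul_smul, smul_smul]
    have : K - 1 - (k:ℤ) = K - ((k+1:ℕ):ℤ) := by push_cast; ring
    rw [this]
    congr 1
    have := cch_succ' (K:ℂ) k
    push_cast
    field_simp
    linear_combination (-1)^k * this

lemma ann_hv (H : IsHeisenberg A h) (c b : Fin ℓ) (i j : ℕ) :
    A.Y (h c) i (hv A h b j) = (if c = b ∧ i = j + 1 then (i:ℂ) else 0) • A.one := by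
  rw [hv, comm_apply H, A.create_ge _ _ (by omega), map_zero, zero_add]
  congr 1
  have : ((i:ℤ) + -((j:ℤ)+1) = 0) ↔ i = j + 1 := by omega
  simp only [this, Int.cast_natCast]

lemma ann_sv (H : IsHeisenberg A h) (c a b : Fin ℓ) (r i j : ℕ) :
    A.Y (h c) r (sv A h a b i j) = (if c = b ∧ r = j + 1 then (r:ℂ) else 0) • hv A h a i
      + (if c = a ∧ r = i + 1 then (r:ℂ) else 0) • hv A h b j := by
  rw [sv, comm_apply H, ann_hv H]
  have : ((r:ℤ) + -((i:ℤ)+1) = 0) ↔ r = i + 1 := by omega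
  simp only [this, map_smul, hv, Int.cast_natCast]

lemma comm_borcherds (A : VOA V) (u v w : V) (m n : ℤ) : ∀ᶠ K in atTop,
    A.Y u m (A.Y v n w) - A.Y v n (A.Y u m w) =
    ∑ i ∈ Finset.range K, cch (m:ℂ) i • A.Y (A.Y u i v) (m + n - i) w := by
  filter_upwards [borcherds_ev A u v w 0 m n, eventually_ge_atTop 1] with K hK hK1
  have := hK.trans (Finset.sum_eq_single_of_mem 0 (by simp; omega) (fun i _ hi => by
      obtain ⟨i, rfl⟩ := Nat.exists_eq_succ_of_ne_zero hi
      have : zchoose 0 (i+1) = 0 := by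
        have := zchoose_natCast 0 (i+1); simpa using this
      rw [Nat.succ_eq_add_one, this]; simp))
  simp only [zchoose_eq] at this ⊢
  simp at this
  exact this.symm

lemma comm_sv (H : IsHeisenberg A h) (c a b : Fin ℓ) (i j : ℕ) (k N : ℤ) (w : V) :
    A.Y (sv A h a b i j) N (A.Y (h c) k w) = A.Y (h c) k (A.Y (sv A h a b i j) N w)
      - (if c = a then (((i:ℂ)+1) * cch k (i+1) * ((-1)^j * cch (k+N-(i+1):ℤ) j)) • A.Y (h b) (k+N-i-1-j) w else 0)
      - (if c = b then (((j:ℂ)+1) * cch k (j+1) * ((-1)^i * cch (k+N-(j+1):ℤ) i)) • A.Y (h a) (k+N-i-1-j) w else 0)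
      := by
  obtain ⟨K, hK, hK1⟩ := ((comm_borcherds A (h c) (sv A h a b i j) w k N).and (eventually_gt_atTop (i+1+j+1))).exists
  have e : ∑ r ∈ Finset.range K, cch (k:ℂ) r • A.Y (A.Y (h c) r (sv A h a b i j)) (k + N - r) w =
     (if c = a then (((i:ℂ)+1) * cch k (i+1) * ((-1)^j * cch (k+N-(i+1):ℤ) j)) • A.Y (h b) (k+N-i-1-j) w else 0)
      + (if c = b then (((j:ℂ)+1) * cch k (j+1) * ((-1)^i * cch (k+N-(j+1):ℤ) i)) • A.Y (h a) (k+N-i-1-j) w else 0) := by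
    simp only [ann_sv H, map_add, map_smul, Pi.add_apply, Pi.smul_apply, LinearMap.add_apply, LinearMap.smul_apply,
      smul_add, Finset.sum_add_distrib]
    rw [add_comm]
    congr 1
    · by_cases hc : c = a
      · simp only [hc, true_and, if_true]
        rw [Finset.sum_eq_single_of_mem (i+1) (by simp; omega) (fun r _ hr => by simp [hr])]
        rw [hv_mode H]
        simp only [if_true, LinearMap.smul_apply, smul_smul]
        push_cast
        congr 1
        · ring
        · congr 2; ring
      · simp [hc]
    · by_cases hc : c = b
      · simp only [hc, true_and, if_true]
        rw [Finset.sum_eq_single_of_mem (j+1) (by simp; omega) (fun r _ hr => by simp [hr])]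
        rw [hv_mode H]
        simp only [if_true, LinearMap.smul_apply, smul_smul]
        push_cast
        congr 1
        · ring
        · congr 2; ring
      · simp [hc]
  rw [e] at hK
  rw [sub_sub, ← hK]; abel

end
end Zhu
end

section
namespace Zhu
open Filter

section
variable {ℓ : ℕ} {V : Type} [AddCommGroup V] [Module ℂ V] {A : VOA V} {h : Fin ℓ → V}

lemma cre_wt (H : IsHeisenberg A h) (a : Fin ℓ) (n : ℕ) {k : ℤ} {v : V} (hv : v ∈ A.wt k) :
    A.Y (h a) (-(n+1)) v ∈ A.wt (k + n + 1) := by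
  have := A.mode_wt 1 (h a) (H.wt_one a) k (-(n+1)) v hv
  convert this using 2; ring

lemma hv_wt (H : IsHeisenberg A h) (a : Fin ℓ) (i : ℕ) : hv A h a i ∈ A.wt ((i+1:ℕ):ℤ) := by
  have := cre_wt H a i A.one_wt
  rw [hv]
  convert this using 2; push_cast; ring

lemma sv_wt (H : IsHeisenberg A h) (a b : Fin ℓ) (i j : ℕ) : sv A h a b i j ∈ A.wt ((i+j+2:ℕ):ℤ) := by
  have := cre_wt H a i (hv_wt H b j)
  rw [sv]
  convert this using 2; push_cast; ring

lemma cre_comm (H : IsHeisenberg A h) (a b : Fin ℓ) (i j : ℕ) (v : V) :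
    A.Y (h a) (-(i+1)) (A.Y (h b) (-(j+1)) v) = A.Y (h b) (-(j+1)) (A.Y (h a) (-(i+1)) v) := by
  have e : ¬ (a = b ∧ -((i:ℤ)+1) + -((j:ℤ)+1) = 0) := by rintro ⟨_, h⟩; omega
  rw [comm_apply H, if_neg e, zero_smul, add_zero]

lemma wt_neg (H : IsHeisenberg A h) (n : ℤ) (hn : n < 0) : A.wt n = ⊥ := by
  have hi := A.internal.submodule_iSupIndep
  have htop : (⨆ (j : ℤ) (_ : j ≠ n), A.wt j) = ⊤ := by
    rw [eq_top_iff]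
    intro v _
    have key : v ∈ ⨆ k : ℕ, A.wt (k:ℤ) := by
      refine word_ind H (P := fun v => v ∈ ⨆ k : ℕ, A.wt (k:ℤ)) (zero_mem _) (fun _ _ => add_mem)
        (fun c _ => Submodule.smul_mem _ c) (Submodule.mem_iSup_of_mem 0 A.one_wt) ?_ v
      intro a n v hv
      have : (⨆ k : ℕ, A.wt (k:ℤ)) ≤ (⨆ k : ℕ, A.wt (k:ℤ)).comap (A.Y (h a) (-(n+1))) := by
        refine iSup_le fun k u hu => ?_
        refine Submodule.mem_iSup_of_mem (k+n+1) ?_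
        have := cre_wt H a n hu
        push_cast
        exact this
      exact this hv
    have : (⨆ k : ℕ, A.wt (k:ℤ)) ≤ (⨆ (j : ℤ) (_ : j ≠ n), A.wt j) := by
      refine iSup_le fun k u hu => ?_
      exact Submodule.mem_iSup_of_mem (k:ℤ) (Submodule.mem_iSup_of_mem (by omega) hu)
    exact this key
  have := hi n
  rw [htop] at this
  simpa using this

/-- words -/
def wd (A : VOA V) (h : Fin ℓ → V) : List (Fin ℓ × ℕ) → V
  | [] => A.one
  | x :: L => A.Y (h x.1) (-(x.2+1)) (wd A h L)

/-- words of length at most `k` and of the parity of `k` -/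
def Fd (A : VOA V) (h : Fin ℓ → V) (k : ℕ) : Submodule ℂ V :=
  Submodule.span ℂ {v | ∃ L, L.length ≤ k ∧ L.length % 2 = k % 2 ∧ v = wd A h L}

lemma wd_mem (L : List (Fin ℓ × ℕ)) (k : ℕ) (h1 : L.length ≤ k) (h2 : L.length % 2 = k % 2) :
    wd A h L ∈ Fd A h k := Submodule.subset_span ⟨L, h1, h2, rfl⟩

lemma Fd_mono (k : ℕ) : Fd A h k ≤ Fd A h (k+2) := by
  refine Submodule.span_mono ?_
  rintro v ⟨L, h1, h2, rfl⟩
  exact ⟨L, by omega, by omega, rfl⟩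

lemma Fd_map {k j : ℕ} (f : V →ₗ[ℂ] V) (hf : ∀ L : List (Fin ℓ × ℕ), L.length ≤ k → L.length % 2 = k % 2 →
    f (wd A h L) ∈ Fd A h j) {v : V} (hv : v ∈ Fd A h k) : f v ∈ Fd A h j := by
  have : Fd A h k ≤ (Fd A h j).comap f := by
    refine Submodule.span_le.2 ?_
    rintro v ⟨L, h1, h2, rfl⟩
    exact hf L h1 h2
  exact this hv

lemma Fd_le {k j : ℕ} (h1 : k ≤ j) (h2 : k % 2 = j % 2) : Fd A h k ≤ Fd A h j := by
  refine Submodule.span_mono ?_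
  rintro v ⟨L, h1, h2, rfl⟩
  exact ⟨L, by omega, by omega, rfl⟩

lemma Fd_cre (a : Fin ℓ) (n : ℕ) {k : ℕ} {v : V} (hv : v ∈ Fd A h k) :
    A.Y (h a) (-(n+1)) v ∈ Fd A h (k+1) := by
  refine Fd_map (A.Y (h a) (-(n+1))) (fun L h1 h2 => ?_) hv
  exact wd_mem ((a,n)::L) _ (by simp; omega) (by simp; omega)

lemma Fd_ann (H : IsHeisenberg A h) (a : Fin ℓ) (n : ℤ) {k : ℕ} {v : V} (hv : v ∈ Fd A h k) :
    A.Y (h a) n v ∈ Fd A h (k+1) := by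
  by_cases hn : n < 0
  · obtain ⟨m, rfl⟩ : ∃ m : ℕ, n = -(m+1) := ⟨(-n-1).toNat, by omega⟩
    exact Fd_cre a m hv
  refine Fd_map (A.Y (h a) n) (fun L h1 h2 => ?_) hv
  have : A.Y (h a) n (wd A h L) ∈ Fd A h (L.length+1) := by
    clear h1 h2
    induction L with
    | nil => rw [wd, A.create_ge _ _ (by omega)]; exact zero_mem _
    | cons x L ih =>
      rw [wd, comm_apply H]
      refine add_mem (Fd_cre _ _ ih) (Submodule.smul_mem _ _ ?_)
      exact wd_mem _ _ (by simp; omega) (by simp; omega)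
  exact Fd_le (by omega) (by omega) this

lemma Fd_sv (H : IsHeisenberg A h) (a b : Fin ℓ) (i j : ℕ) (N : ℤ) (hN : 0 ≤ N) {k : ℕ} {v : V} (hv : v ∈ Fd A h k) :
    A.Y (sv A h a b i j) N v ∈ Fd A h k := by
  refine Fd_map (A.Y (sv A h a b i j) N) (fun L h1 h2 => ?_) hv
  refine Fd_le h1 h2 ?_
  clear h1 h2
  induction L with
  | nil => rw [wd, A.create_ge _ _ hN]; exact zero_mem _
  | cons x L ih =>
    rw [wd, comm_sv H]
    have hL : wd A h L ∈ Fd A h L.length := wd_mem _ _ le_rfl rfl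
    refine sub_mem (sub_mem (Fd_cre _ _ ih) ?_) ?_
    · split_ifs
      · exact Submodule.smul_mem _ _ (Fd_ann H _ _ hL)
      · exact zero_mem _
    · split_ifs
      · exact Submodule.smul_mem _ _ (Fd_ann H _ _ hL)
      · exact zero_mem _

lemma Fd_sv_one (H : IsHeisenberg A h) (a b : Fin ℓ) (i j : ℕ) {k : ℕ} {v : V} (hv : v ∈ Fd A h k) :
    A.Y (sv A h a b i j) (-1) v - A.Y (h a) (-(i+1)) (A.Y (h b) (-(j+1)) v) ∈ Fd A h k := by
  have := Fd_map (j := k) (A.Y (sv A h a b i j) (-1) - A.Y (h a) (-(i+1)) * (A.Y (h b) (-(j+1)))) (fun L h1 h2 => ?_) hv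
  · simpa using this
  refine Fd_le h1 h2 ?_
  clear h1 h2
  induction L with
  | nil => simp only [LinearMap.sub_apply, Module.End.mul_apply, wd, A.create]; rw [sv, Zhu.hv, sub_self]; exact zero_mem _
  | cons x L ih =>
    simp only [LinearMap.sub_apply, Module.End.mul_apply, wd] at ih ⊢
    rw [comm_sv H]
    have hL : wd A h L ∈ Fd A h L.length := wd_mem _ _ le_rfl rfl
    rw [cre_comm H b x.1, cre_comm H a x.1]
    have e := Fd_cre (A := A) (h := h) x.1 x.2 ih
    rw [map_sub] at e
    have e' : ∀ X i1 i2 Y : V, X - i1 - i2 - Y = (X-Y)-(i1+i2) := by intros; abel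
    rw [e']
    refine sub_mem e (add_mem ?_ ?_)
    · split_ifs
      · exact Submodule.smul_mem _ _ (Fd_ann H _ _ hL)
      · exact zero_mem _
    · split_ifs
      · exact Submodule.smul_mem _ _ (Fd_ann H _ _ hL)
      · exact zero_mem _

lemma zm_sv_lead (H : IsHeisenberg A h) (a b : Fin ℓ) (i j : ℕ) {k : ℕ} {v : V} (hv : v ∈ Fd A h k) :
    zm A (-1) (sv A h a b i j) v - A.Y (h a) (-(i+1)) (A.Y (h b) (-(j+1)) v) ∈ Fd A h k := by
  rw [zm_of A (sv_wt H a b i j), md_eq, Finset.sum_range_succ', add_sub_assoc]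
  refine add_mem (sum_mem fun t _ => Submodule.smul_mem _ _ (Fd_sv H _ _ _ _ _ (by push_cast; omega) hv)) ?_
  simpa using Fd_sv_one H a b i j hv

lemma gen_Fd (H : IsHeisenberg A h) (P : Submodule ℂ V) (h1 : A.one ∈ P)
    (hP : ∀ a b i j w, w ∈ P → zm A (-1) (sv A h a b i j) w ∈ P) (k : ℕ) : Fd A h (2*k) ≤ P := by
  induction k with
  | zero =>
    refine Submodule.span_le.2 ?_
    rintro v ⟨L, h1, h2, rfl⟩
    have : L = [] := by simpa using h1
    subst this; simpa [wd]
  | succ k ih =>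
    refine Submodule.span_le.2 ?_
    rintro v ⟨L, h1, h2, rfl⟩
    match L, h1, h2 with
    | [], _, _ => simpa [wd]
    | [x], h1, h2 => simp at h2
    | x :: y :: L, h1, h2 =>
      simp at h1 h2
      have hL : wd A h L ∈ Fd A h (2*k) := wd_mem _ _ (by omega) (by omega)
      have := sub_mem (hP x.1 y.1 x.2 y.2 _ (ih hL)) (ih (zm_sv_lead H x.1 y.1 x.2 y.2 hL))
      simpa [wd] using this

end
end Zhu
end

section
namespace Zhu
open Filter

lemma zm_assoc' {W : Type} [AddCommGroup W] [Module ℂ W] (B : VOA W)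
    (hn : ∀ n : ℤ, n < 0 → B.wt n = ⊥) {α : ℕ} {a : W} (ha : a ∈ B.wt α) (b : W)
    (N : ℤ) (w : W) : ∀ᶠ K in atTop, zm B N (zm B (-1) a b) w
      = ∑ i ∈ Finset.range K, (zm B (-1 - i) a (zm B (N+i) b w) + zm B (N-1-i) b (zm B i a w)) := by
  refine hom_ind B hn (P := fun b => ∀ᶠ K in atTop, zm B N (zm B (-1) a b) w
      = ∑ i ∈ Finset.range K, (zm B (-1 - i) a (zm B (N+i) b w) + zm B (N-1-i) b (zm B i a w))) (by simp) ?_ ?_ b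
  · intro u v hu hv
    filter_upwards [hu, hv] with K h1 h2
    simp only [map_add, LinearMap.add_apply, h1, h2, ← Finset.sum_add_distrib]
    refine Finset.sum_congr rfl fun i _ => ?_
    abel
  · intro k u hu
    exact zm_assoc B hn ha hu N w

section
variable {ℓ : ℕ} {V W : Type} [AddCommGroup V] [Module ℂ V] [AddCommGroup W] [Module ℂ W]
  (S : HeisenbergPlusSetting ℓ V W)

lemma wtB_neg (n : ℤ) (hn : n < 0) : S.B.wt n = ⊥ := by
  rw [eq_bot_iff]
  intro w hw
  have := (S.fixedSub.map_wt n w).1 hw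
  rw [wt_neg S.heis n hn] at this
  have h0 : S.ι w = S.ι 0 := by simpa using this
  exact S.fixedSub.inj h0

lemma iota_zm {k : ℕ} {u : W} (hu : u ∈ S.B.wt k) (N : ℤ) (v : W) :
    S.ι (zm S.B N u v) = zm S.A N (S.ι u) (S.ι v) := by
  rw [zm_of S.B hu, zm_of S.A ((S.fixedSub.map_wt _ _).1 hu), md_eq, md_eq, map_sum]
  simp only [map_smul, S.fixedSub.map_Y]

lemma theta_wd (L : List (Fin ℓ × ℕ)) : S.θ (wd S.A S.hgen L) = (-1:ℂ)^L.length • wd S.A S.hgen L := by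
  induction L with
  | nil => simp [wd, S.thetaAut.map_one]
  | cons x L ih =>
    rw [wd, S.thetaAut.map_Y, ih, S.thetaAut.map_gen]
    simp [pow_succ]

lemma mem_range_iff (v : V) : v ∈ LinearMap.range S.ι ↔ S.θ v = v := by
  rw [S.fixedSub.range_eq, Module.End.mem_eigenspace_iff]; simp

lemma plus_Fd (v : V) (hv : S.θ v = v) : v ∈ ⨆ k : ℕ, Fd S.A S.hgen (2*k) := by
  have key : ∀ v, v + S.θ v ∈ ⨆ k : ℕ, Fd S.A S.hgen (2*k) := by
    have hw : ∀ v : V, v ∈ Submodule.span ℂ (Set.range (wd S.A S.hgen)) := by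
      refine word_ind S.heis (zero_mem _) (fun _ _ => add_mem) (fun c _ => Submodule.smul_mem _ c) 
        (Submodule.subset_span ⟨[], rfl⟩) ?_
      intro a n v hv
      have : Submodule.span ℂ (Set.range (wd S.A S.hgen)) ≤ 
         (Submodule.span ℂ (Set.range (wd S.A S.hgen))).comap (S.A.Y (S.hgen a) (-(n+1))) := by
        refine Submodule.span_le.2 ?_
        rintro _ ⟨L, rfl⟩
        exact Submodule.subset_span ⟨(a,n)::L, rfl⟩
      exact this hv
    intro v
    have : Submodule.span ℂ (Set.range (wd S.A S.hgen)) ≤ 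
       (⨆ k : ℕ, Fd S.A S.hgen (2*k)).comap (LinearMap.id + S.θ.toLinearMap) := by
      refine Submodule.span_le.2 ?_
      rintro _ ⟨L, rfl⟩
      simp only [Submodule.comap_coe, Set.mem_preimage, LinearMap.add_apply, LinearMap.id_apply, 
        LinearEquiv.coe_coe, theta_wd, SetLike.mem_coe]
      rcases Nat.even_or_odd' L.length with ⟨k, hk | hk⟩
      · exact Submodule.mem_iSup_of_mem k (add_mem (wd_mem _ _ (by omega) (by omega)) 
          (Submodule.smul_mem _ _ (wd_mem _ _ (by omega) (by omega))))
      · rw [hk]; simp [pow_succ, pow_mul]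
    exact this (hw v)
  have := Submodule.smul_mem _ (1/2:ℂ) (key v)
  rw [hv, ← two_smul ℂ, smul_smul] at this
  simpa using this

lemma gen_W (P : Submodule ℂ W) (s : Fin ℓ → Fin ℓ → ℕ → ℕ → W) (hs : ∀ a b i j, S.ι (s a b i j) = sv S.A S.hgen a b i j)
    (h1 : S.B.one ∈ P)
    (hP : ∀ a b i j w, w ∈ P → zm S.B (-1) (s a b i j) w ∈ P) (w : W) : w ∈ P := by
  have hs' : ∀ a b i j, s a b i j ∈ S.B.wt ((i+j+2:ℕ):ℤ) := fun a b i j => by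
    rw [S.fixedSub.map_wt, hs]; exact sv_wt S.heis a b i j
  have h2 : (⨆ k : ℕ, Fd S.A S.hgen (2*k)) ≤ P.map S.ι := by
    refine iSup_le (gen_Fd S.heis _ ⟨_, h1, S.fixedSub.map_one⟩ ?_)
    rintro a b i j _ ⟨w, hw, rfl⟩
    refine ⟨_, hP a b i j w hw, ?_⟩
    rw [iota_zm S (hs' a b i j), hs]
  obtain ⟨w', hw', e⟩ := h2 (plus_Fd S (S.ι w) ((mem_range_iff S _).1 ⟨w, rfl⟩))
  rwa [← S.fixedSub.inj e]

/-- degree two words lie in the span of the `s` and the vacuum -/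
lemma mem_Fd2 (s : Fin ℓ → Fin ℓ → ℕ → ℕ → W) (hs : ∀ a b i j, S.ι (s a b i j) = sv S.A S.hgen a b i j)
    (w : W) (hw : S.ι w ∈ Fd S.A S.hgen 2) : 
    w ∈ Submodule.span ℂ (insert S.B.one {v | ∃ a b i j, v = s a b i j}) := by
  have h2 : Fd S.A S.hgen 2 ≤ (Submodule.span ℂ (insert S.B.one {v | ∃ a b i j, v = s a b i j})).map S.ι := by
    refine Submodule.span_le.2 ?_
    rintro v ⟨L, h1, h2, rfl⟩
    match L, h1, h2 with
    | [], _, _ => exact ⟨S.B.one, Submodule.subset_span (Set.mem_insert _ _), S.fixedSub.map_one⟩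
    | [x], h1, h2 => simp at h2
    | [x, y], h1, h2 => 
      exact ⟨s x.1 y.1 x.2 y.2, Submodule.subset_span (Set.mem_insert_of_mem _ ⟨_, _, _, _, rfl⟩), by rw [hs]; rfl⟩
    | x :: y :: z :: L, h1, h2 => simp at h1
  obtain ⟨w', hw', e⟩ := h2 hw
  rwa [← S.fixedSub.inj e]

lemma Osub_gen (P : Submodule ℂ W) (s : Fin ℓ → Fin ℓ → ℕ → ℕ → W) (hs : ∀ a b i j, S.ι (s a b i j) = sv S.A S.hgen a b i j)
    (hP : ∀ a b i j N w, N ≤ -2 → zm S.B N (s a b i j) w ∈ P) : S.B.Osub ≤ P := by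
  have hn := wtB_neg S
  have hs' : ∀ a b i j, s a b i j ∈ S.B.wt ((i+j+2:ℕ):ℤ) := fun a b i j => by
    rw [S.fixedSub.map_wt, hs]; exact sv_wt S.heis a b i j
  let Q : Submodule ℂ W := Submodule.span ℂ {v | ∃ a b i j N w, N ≤ -2 ∧ v = zm S.B N (s a b i j) w}
  have hQP : Q ≤ P := by
    refine Submodule.span_le.2 ?_
    rintro _ ⟨a, b, i, j, N, w, hN, rfl⟩
    exact hP a b i j N w hN
  refine le_trans ?_ hQP
  have hQ : ∀ a b i j N w, N ≤ -2 → zm S.B N (s a b i j) w ∈ Q := fun a b i j N w hN => 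
    Submodule.subset_span ⟨a, b, i, j, N, w, hN, rfl⟩
  -- left multiplication
  have hmul : ∀ a b i j, ∀ o ∈ Q, zm S.B (-1) (s a b i j) o ∈ Q := by
    intro a b i j
    have : Q ≤ Q.comap (zm S.B (-1) (s a b i j)) := by
      refine Submodule.span_le.2 ?_
      rintro _ ⟨a', b', i', j', N, w, hN, rfl⟩
      have h1 := comm_mem S.B hn (hs' a b i j) (hs' a' b' i' j') N hN w Q ?_
      · have := add_mem h1 (hQ a' b' i' j' N (zm S.B (-1) (s a b i j) w) hN)
        simpa using this
      · intro r M hM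
        have h2 : S.B.Y (s a b i j) r (s a' b' i' j') ∈ Submodule.span ℂ (insert S.B.one {v | ∃ a b i j, v = s a b i j}) := by
          refine mem_Fd2 S s hs _ ?_
          rw [S.fixedSub.map_Y, hs, hs]
          exact Fd_sv S.heis _ _ _ _ _ (by omega) (wd_mem [(a',i'),(b',j')] 2 (by simp) (by simp))
        have h3 : Submodule.span ℂ (insert S.B.one {v | ∃ a b i j, v = s a b i j}) ≤ Q.comap ((zm S.B M).flip w) := by
          refine Submodule.span_le.2 ?_
          rintro v (rfl | ⟨a, b, i, j, rfl⟩)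
          · simp only [Submodule.comap_coe, Set.mem_preimage, LinearMap.flip_apply]
            rw [zm_one, if_neg (by omega)]; exact zero_mem _
          · exact hQ _ _ _ _ _ _ hM
        exact h3 h2
    exact fun o ho => this ho
  let G : Submodule ℂ W := ⨅ (N : ℤ) (_ : N ≤ -2) (w : W), Q.comap ((zm S.B N).flip w)
  have hGm : ∀ u, u ∈ G ↔ ∀ N : ℤ, N ≤ -2 → ∀ w, zm S.B N u w ∈ Q := by
    intro u; simp [G, Submodule.mem_iInf]
  have hG : ∀ u, u ∈ G := by
    refine gen_W S G s hs ?_ ?_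
    · rw [hGm]; intro N hN w; rw [zm_one, if_neg (by omega)]; exact zero_mem _
    · intro a b i j u hu
      rw [hGm] at hu ⊢
      intro N hN w
      obtain ⟨K, hK⟩ := (zm_assoc' S.B hn (hs' a b i j) u N w).exists
      rw [hK]
      refine sum_mem fun t _ => add_mem ?_ (hu _ (by omega) _)
      rcases Nat.eq_zero_or_pos t with rfl | ht
      · have := hmul a b i j _ (hu N hN w)
        simpa using this
      · exact hQ _ _ _ _ _ _ (by omega)
  exact Osub_le S.B hn Q fun k u v _ => (hGm u).1 (hG u) _ le_rfl _
end
end Zhu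
end

section
namespace Zhu
open Filter

/-- contraction coefficient -/
noncomputable def Pc (i j k : ℕ) (N : ℤ) : ℂ :=
  ((i:ℂ)+1) * cch (-(k+1):ℤ) (i+1) * ((-1)^j * cch ((-(k+1)+N-(i+1)):ℤ) j)

section
variable {ℓ : ℕ} {V : Type} [AddCommGroup V] [Module ℂ V] {A : VOA V} {h : Fin ℓ → V}

lemma sv_symm (H : IsHeisenberg A h) (a b : Fin ℓ) (i j : ℕ) : sv A h a b i j = sv A h b a j i := by
  rw [sv, sv, hv, hv, cre_comm H]

lemma sv_hv (H : IsHeisenberg A h) (a b d : Fin ℓ) (i j l : ℕ) (N : ℤ) (hN : -1 ≤ N) (h1 : d ≠ a) (h2 : d ≠ b) :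
    A.Y (sv A h a b i j) N (hv A h d l) = if N = -1 then wd A h [(d,l),(a,i),(b,j)] else 0 := by
  rw [hv, comm_sv H, if_neg h1, if_neg h2, sub_zero, sub_zero]
  split_ifs with hN1
  · subst hN1; rw [A.create]; rfl
  · rw [A.create_ge _ _ (by omega), map_zero]

lemma sv_sv (H : IsHeisenberg A h) (a b c d : Fin ℓ) (i j k l : ℕ) (N : ℤ) (hN : -1 ≤ N) (hN' : N ≤ i + j + 1)
    (h1 : d ≠ a) (h2 : d ≠ b) :
    A.Y (sv A h a b i j) N (sv A h c d k l) = (if N = -1 then wd A h [(c,k),(d,l),(a,i),(b,j)] else 0)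
      - (if c = a then Pc i j k N • sv A h b d (k + (i+j+1-N).toNat) l else 0)
      - (if c = b then Pc j i k N • sv A h a d (k + (i+j+1-N).toNat) l else 0) := by
  have e : (-((k:ℤ)+1)+N-i-1-j) = -(((k + ((i:ℤ)+j+1-N).toNat : ℕ) : ℤ) + 1) := by
    push_cast; rw [Int.toNat_of_nonneg (by omega)]; ring
  rw [sv.eq_1 A h c d, comm_sv H, sv_hv H a b d i j l N hN h1 h2, e]
  simp only [sv, Pc]
  congr 2
  split_ifs with hN1
  · rfl
  · simp

lemma wd_swap (H : IsHeisenberg A h) (x y : Fin ℓ × ℕ) (L : List (Fin ℓ × ℕ)) :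
    wd A h (x :: y :: L) = wd A h (y :: x :: L) := by
  simp only [wd]; rw [cre_comm H]

lemma omega_zero (A : VOA V) (u : V) : A.Y A.omega 0 u = A.Y u (-2) A.one := by
  have := A.create (A.Y A.omega 0 u)
  rw [A.translation] at this
  rw [← this]; simp

lemma omega_zero_comm (u v : V) (n : ℤ) :
    A.Y A.omega 0 (A.Y u n v) = A.Y u n (A.Y A.omega 0 v) + (-(n:ℂ)) • A.Y u (n-1) v := by
  obtain ⟨K, hK, hK1⟩ := ((comm_borcherds A A.omega u v 0 n).and (eventually_ge_atTop 1)).exists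
  obtain ⟨K, rfl⟩ := Nat.exists_eq_add_of_le' hK1
  rw [Finset.sum_range_succ', Finset.sum_eq_zero] at hK
  · have e := A.translation u n
    simp only [Nat.cast_zero, Int.cast_zero, sub_zero, zero_add, cch_zero, one_smul] at hK
    rw [e] at hK
    rw [LinearMap.smul_apply] at hK
    rw [← hK]; abel
  · intro i _
    have : cch ((0:ℤ):ℂ) (i+1) = 0 := by
      have := cch_natCast 0 (i+1); simpa using this
    rw [this, zero_smul]

lemma trans_sv (a b : Fin ℓ) (i j : ℕ) : A.Y (sv A h a b i j) (-2) A.one = 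
    ((i:ℂ)+1) • sv A h a b (i+1) j + ((j:ℂ)+1) • sv A h a b i (j+1) := by
  rw [← omega_zero, sv, omega_zero_comm, hv, omega_zero_comm, omega_zero, A.vacuum_act]
  simp only [sv, hv]
  rw [if_neg (by norm_num)]
  simp only [LinearMap.zero_apply, map_zero, zero_add, map_smul]
  rw [add_comm]
  push_cast
  congr 1
  · congr 1
    · ring
  · congr 1
    · ring

lemma sq_sv (H : IsHeisenberg A h) (a b : Fin ℓ) (hab : a ≠ b) (t : ℕ) (ht : t ≤ 2) : 
    A.Y (sv A h a b 0 0) (-1 + t) (sv A h a b 0 0) = (if t = 0 then wd A h [(a,0),(b,0),(a,0),(b,0)] else 0)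
     + sv A h a a 0 (2-t) + sv A h b b 0 (2-t) := by
  have e : (-1 + (-1 + (t:ℤ)) - 1) = -(((2-t:ℕ):ℤ)+1) := by omega
  have e1 : cch (-1) 1 = -1 := by simp [cch]
  rw [show A.Y (sv A h a b 0 0) (-1+t) (sv A h a b 0 0) = A.Y (sv A h a b 0 0) (-1+t) (A.Y (h a) (-((0:ℕ)+1)) (A.Y (h b) (-((0:ℕ)+1)) A.one)) from rfl, 
    comm_sv H, comm_sv H]
  simp only [hab, hab.symm, if_true, if_false, sub_zero, Nat.cast_zero, zero_add, cch_zero, pow_zero, mul_one, one_mul]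
  rw [e]
  push_cast
  rw [e1]
  have e2 : A.Y (h b) (-(((2-t:ℕ):ℤ)+1)) (A.Y (h b) (-1) A.one) = sv A h b b 0 (2-t) := by
    rw [sv_symm H]; simp [sv, hv]
  have e3 : A.Y (h a) (-1) (A.Y (h a) (-(((2-t:ℕ):ℤ)+1)) A.one) = sv A h a a 0 (2-t) := by
    simp [sv, hv]
  have e4 : A.Y (h a) (-1) (A.Y (h b) (-1) (A.Y (sv A h a b 0 0) (-1+t) A.one)) = 
      (if t = 0 then wd A h [(a,0),(b,0),(a,0),(b,0)] else 0) := by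
    split_ifs with h0
    · subst h0; simp only [Nat.cast_zero, add_zero, A.create]; simp [wd, sv, hv]
    · rw [A.create_ge _ _ (by omega)]; simp
  simp only [map_add, neg_smul, one_smul, map_neg, e2, e3, e4, sub_neg_eq_add, map_add]
end
end Zhu
end

section
namespace Zhu
open Filter

/-- The relations of the Zhu algebra that are used. `T a b i j` is the class of `S_ab(i+1,j+1)`. -/
structure RData {ℓ : ℕ} {R : Type} [Ring R] [Algebra ℂ R] (T : Fin ℓ → Fin ℓ → ℕ → ℕ → R)
    (Wd : (Fin ℓ × ℕ) → (Fin ℓ × ℕ) → (Fin ℓ × ℕ) → (Fin ℓ × ℕ) → R) : Prop where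
  symm : ∀ (a b : Fin ℓ) (i j : ℕ), T a b i j = T b a j i
  trans : ∀ (a b : Fin ℓ) (i j : ℕ), ((i:ℂ)+1) • T a b (i+1) j + ((j:ℂ)+1) • T a b i (j+1) + ((i:ℂ)+j+2) • T a b i j = 0
  wd12 : ∀ x y z w, Wd x y z w = Wd y x z w
  wd23 : ∀ x y z w, Wd x y z w = Wd x z y w
  wd34 : ∀ x y z w, Wd x y z w = Wd x y w z
  mul : ∀ (a b c d : Fin ℓ) (i j k l : ℕ), d ≠ a → d ≠ b → T a b i j * T c d k l = Wd (c,k) (d,l) (a,i) (b,j)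
    - ∑ t ∈ Finset.range (i+j+3), ((i+j+2).choose t : ℂ) •
      ((if c = a then Pc i j k (t-1) • T b d (k + (i+j+2-t)) l else 0)
       + (if c = b then Pc j i k (t-1) • T a d (k + (i+j+2-t)) l else 0))
  comm : ∀ (a b c d : Fin ℓ) (i j k l : ℕ), d ≠ a → d ≠ b → T a b i j * T c d k l - T c d k l * T a b i j =
    - ∑ t ∈ Finset.range (i+j+2), ((i+j+1).choose t : ℂ) •
      ((if c = a then Pc i j k t • T b d (k + (i+j+1-t)) l else 0)
       + (if c = b then Pc j i k t • T a d (k + (i+j+1-t)) l else 0))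
  sq : ∀ a b, a ≠ b → T a b 0 0 * T a b 0 0 = Wd (a,0) (b,0) (a,0) (b,0)
    + ((T a a 0 2 + (2:ℂ) • T a a 0 1 + T a a 0 0) + (T b b 0 2 + (2:ℂ) • T b b 0 1 + T b b 0 0))
  cen : ∀ x : R, (∑ a, T a a 0 0) * x = x * ∑ a, T a a 0 0
  gen : ∀ P : Submodule ℂ R, 1 ∈ P → (∀ a b i j x, x ∈ P → T a b i j * x ∈ P) → P = ⊤

section
variable {ℓ : ℕ} {V W : Type} [AddCommGroup V] [Module ℂ V] [AddCommGroup W] [Module ℂ W]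
  (S : HeisenbergPlusSetting ℓ V W)

lemma zr_mul {R : Type} [Ring R] [Algebra ℂ R] (Z : ZhuRealization S.B R) (u v : W) : Z.π u * Z.π v = Z.π (zm S.B (-1) u v) := by
  rw [← Z.map_star, star_eq S.B (wtB_neg S)]

lemma zr_zero {R : Type} [Ring R] [Algebra ℂ R] (Z : ZhuRealization S.B R) {u : W} (hu : u ∈ S.B.Osub) : Z.π u = 0 := by
  rwa [← Z.ker_eq] at hu

theorem exists_rdata {R : Type} [Ring R] [Algebra ℂ R] (Z : ZhuRealization S.B R) (s : Fin ℓ → Fin ℓ → ℕ → ℕ → W)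
    (hs : ∀ a b i j, S.ι (s a b i j) = sv S.A S.hgen a b i j) :
    ∃ Wd, RData (fun a b i j => Z.π (s a b i j)) Wd := by
  have hn := wtB_neg S
  have hs' : ∀ (a b : Fin ℓ) (i j : ℕ), s a b i j ∈ S.B.wt ((i+j+2:ℕ):ℤ) := fun a b i j => by
    rw [S.fixedSub.map_wt, hs]; exact sv_wt S.heis a b i j
  have hw : ∀ x y z w, ∃ v : W, S.ι v = wd S.A S.hgen [x,y,z,w] := by
    intro x y z w
    have := (mem_range_iff S (wd S.A S.hgen [x,y,z,w])).2 (by rw [theta_wd]; norm_num)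
    exact this
  choose W4 hW4 using hw
  have inj : ∀ u v, S.ι u = S.ι v → u = v := fun u v e => S.fixedSub.inj e
  have hY : ∀ (a b c d : Fin ℓ) (i j k l : ℕ) (N : ℤ), -1 ≤ N → N ≤ i + j + 1 → d ≠ a → d ≠ b → 
    S.B.Y (s a b i j) N (s c d k l) = (if N = -1 then W4 (c,k) (d,l) (a,i) (b,j) else 0)
      - (if c = a then Pc i j k N • s b d (k + (i+j+1-N).toNat) l else 0)
      - (if c = b then Pc j i k N • s a d (k + (i+j+1-N).toNat) l else 0) := by
    intro a b c d i j k l N h1 h2 h3 h4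
    apply inj
    rw [S.fixedSub.map_Y, hs, hs, sv_sv S.heis _ _ _ _ _ _ _ _ _ h1 h2 h3 h4]
    simp only [map_sub, apply_ite S.ι, map_smul, hs, hW4, map_zero]
  refine ⟨fun x y z w => Z.π (W4 x y z w), ?_, ?_, ?_, ?_, ?_, ?_, ?_, ?_, ?_, ?_⟩
  · intro a b i j
    congr 1; apply inj; rw [hs, hs, sv_symm S.heis]
  · intro a b i j
    have := zr_zero S Z (trans_mem S.B hn (hs' a b i j))
    have e : S.B.Y (s a b i j) (-2) S.B.one = ((i:ℂ)+1) • s a b (i+1) j + ((j:ℂ)+1) • s a b i (j+1) := by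
      apply inj
      rw [S.fixedSub.map_Y, hs, S.fixedSub.map_one, trans_sv]; simp only [map_add, map_smul, hs]
    rw [e] at this
    push_cast at this
    simpa only [map_add, map_smul] using this
  · intro x y z w; congr 1; apply inj; rw [hW4, hW4, wd_swap S.heis]
  · intro x y z w; congr 1; apply inj; rw [hW4, hW4]; have := wd_swap S.heis y z [w]; simp only [wd] at this ⊢; rw [this]
  · intro x y z w; congr 1; apply inj; rw [hW4, hW4]; have := wd_swap S.heis z w []; simp only [wd] at this ⊢; rw [this]
  · intro a b c d i j k l h1 h2
    rw [zr_mul, zm_of S.B (hs' a b i j), md_eq]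
    have : ∀ t ∈ Finset.range (i+j+2+1), ((i+j+2).choose t : ℂ) • S.B.Y (s a b i j) (-1 + t) (s c d k l) = 
       (if t = 0 then W4 (c,k) (d,l) (a,i) (b,j) else 0) - ((i+j+2).choose t : ℂ) •
      ((if c = a then Pc i j k (t-1) • s b d (k + (i+j+2-t)) l else 0)
       + (if c = b then Pc j i k (t-1) • s a d (k + (i+j+2-t)) l else 0)) := by
      intro t ht
      simp only [Finset.mem_range] at ht
      rw [hY _ _ _ _ _ _ _ _ _ (by omega) (by omega) h1 h2]
      have e1 : ((i:ℤ)+j+1-(-1+t)).toNat = i+j+2-t := by omega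
      have e2 : (-1 + (t:ℤ) = -1) ↔ t = 0 := by omega
      rw [e1, sub_sub, smul_sub]
      simp only [e2, neg_add_eq_sub]
      congr 1
      by_cases h0 : t = 0
      · subst h0; simp
      · rw [if_neg (by omega), if_neg h0, smul_zero]
    rw [Finset.sum_congr rfl this, Finset.sum_sub_distrib, Finset.sum_ite_eq' (Finset.range (i+j+2+1)) 0 (fun _ => W4 (c,k) (d,l) (a,i) (b,j)), if_pos (by simp)]
    simp only [map_sub, map_sum, map_smul, map_add, apply_ite Z.π, map_zero]
  · intro a b c d i j k l h1 h2
    have := zr_zero S Z (comm_formula S.B hn (α := i+j+1) (hs' a b i j) (hs' c d k l))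
    rw [map_sub, map_sub, ← zr_mul, ← zr_mul, sub_eq_zero] at this
    rw [this, ← Finset.sum_neg_distrib, map_sum]
    refine Finset.sum_congr rfl fun t ht => ?_
    simp only [Finset.mem_range] at ht
    rw [hY _ _ _ _ _ _ _ _ _ (by omega) (by omega) h1 h2]
    have e1 : ((i:ℤ)+j+1-t).toNat = i+j+1-t := by omega
    rw [e1, if_neg (by omega), zero_sub, ← neg_add', smul_neg, map_neg]
    simp only [map_smul, map_add, apply_ite Z.π, map_zero]
  · intro a b hab
    rw [zr_mul, zm_of S.B (hs' a b 0 0), md_eq]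
    have hq : ∀ t : ℕ, t ≤ 2 → S.B.Y (s a b 0 0) (-1 + t) (s a b 0 0) = 
       (if t = 0 then W4 (a,0) (b,0) (a,0) (b,0) else 0) + s a a 0 (2-t) + s b b 0 (2-t) := by
      intro t ht
      apply inj
      rw [S.fixedSub.map_Y, hs, sq_sv S.heis a b hab t ht]
      simp only [map_add, apply_ite S.ι, hs, hW4, map_zero]
    simp only [Finset.sum_range_succ, Finset.sum_range_zero]
    rw [hq 0 (by omega), hq 1 (by omega), hq 2 (by omega)]
    simp [two_smul]
    abel
  · have e : ∑ a, Z.π (s a a 0 0) = (2:ℂ) • Z.π S.B.omega := by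
      rw [← map_sum, ← map_smul]
      congr 1; apply inj
      rw [map_sum, map_smul, S.fixedSub.map_omega, S.heis.omega_eq, smul_smul]
      simp only [hs, sv, hv]; norm_num
    have hc : ∀ u, Z.π S.B.omega * Z.π u = Z.π u * Z.π S.B.omega := by
      refine hom_ind S.B hn (by simp) (fun u v hu hv => by simp [mul_add, add_mul, hu, hv]) ?_
      intro k u hu
      have := zr_zero S Z (comm_formula S.B hn (α := 1) S.B.omega_wt hu)
      rw [map_sub, map_sub, ← zr_mul, ← zr_mul, sub_eq_zero] at this
      rw [← sub_eq_zero, this]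
      rw [Finset.sum_range_succ, Finset.sum_range_succ]
      have h2 := zr_zero S Z (trans_mem S.B hn hu)
      rw [← omega_zero] at h2
      have h3 := S.B.L0_diag _ _ hu
      simp [h3] at h2 ⊢
      exact h2
    intro x
    obtain ⟨u, rfl⟩ := Z.surj x
    rw [e, smul_mul_assoc, mul_smul_comm, hc]
  · intro P h1 hP
    rw [eq_top_iff]
    intro x _
    obtain ⟨u, rfl⟩ := Z.surj x
    refine gen_W S (P.comap Z.π) s hs (by rw [Submodule.mem_comap, Z.map_one]; exact h1) ?_ u
    intro a b i j w hw
    rw [Submodule.mem_comap, ← zr_mul]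
    exact hP _ _ _ _ _ hw
end
end Zhu
end

section
namespace Zhu
open Filter Polynomial

/-- commutator with `w` -/
noncomputable def adm {R : Type} [Ring R] [Algebra ℂ R] (w : R) : Module.End ℂ R :=
  LinearMap.mulLeft ℂ w - LinearMap.mulRight ℂ w

lemma adm_apply {R : Type} [Ring R] [Algebra ℂ R] (w x : R) : adm w x = w * x - x * w := by
  simp [adm]

section
variable {ℓ : ℕ} {R : Type} [Ring R] [Algebra ℂ R] {T : Fin ℓ → Fin ℓ → ℕ → ℕ → R}
  {Wd : (Fin ℓ × ℕ) → (Fin ℓ × ℕ) → (Fin ℓ × ℕ) → (Fin ℓ × ℕ) → R}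

/-- `ω_a` -/
noncomputable def wz (T : Fin ℓ → Fin ℓ → ℕ → ℕ → R) (a : Fin ℓ) : R := (1/2:ℂ) • T a a 0 0

/-- `X_ab(p) = p(ad ω_a) S_ab(1,1)` -/
noncomputable def Xp (T : Fin ℓ → Fin ℓ → ℕ → ℕ → R) (a b : Fin ℓ) : ℂ[X] →ₗ[ℂ] R :=
  (LinearMap.applyₗ (T a b 0 0)) ∘ₗ (aeval (adm (wz T a))).toLinearMap

lemma Xp_apply (a b : Fin ℓ) (p : ℂ[X]) : Xp T a b p = aeval (adm (wz T a)) p (T a b 0 0) := rfl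

lemma Xp_one (a b : Fin ℓ) : Xp T a b 1 = T a b 0 0 := by simp [Xp_apply]

lemma Xp_X (a b : Fin ℓ) (p : ℂ[X]) : Xp T a b (X * p) = wz T a * Xp T a b p - Xp T a b p * wz T a := by
  rw [Xp_apply, map_mul, aeval_X, Module.End.mul_apply, adm_apply, Xp_apply]

/-- polynomials for `S_ab(r,1)` -/
noncomputable def bp : ℕ → ℂ[X]
  | 0 => 1
  | r+1 => C (1/((r:ℂ)+1)) * ((X - C ((r:ℂ)+1)) * bp r)

/-- polynomials for `S_ab(1,n)` -/
noncomputable def bn : ℕ → ℂ[X]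
  | 0 => 1
  | r+1 => C (-1/((r:ℂ)+1)) * ((X + C ((r:ℂ)+1)) * bn r)

lemma Pc00 (k : ℕ) (N : ℤ) : Pc 0 0 k N = -((k:ℂ)+1) := by
  simp [Pc, cch]

lemma w_comm (D : RData T Wd) {a b : Fin ℓ} (hab : a ≠ b) (k l : ℕ) :
    wz T a * T a b k l - T a b k l * wz T a = ((k:ℂ)+1) • (T a b (k+1) l + T a b k l) := by
  have := D.comm a a a b 0 0 k l hab.symm hab.symm
  simp only [Finset.sum_range_succ, Finset.sum_range_zero, Pc00, if_true] at this
  rw [wz, smul_mul_assoc, mul_smul_comm, ← smul_sub, this]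
  simp
  module

lemma w_comm0 (D : RData T Wd) {a b c : Fin ℓ} (hb : b ≠ c) (ha : a ≠ c) (k l n : ℕ) :
    T c c 0 n * T a b k l = T a b k l * T c c 0 n := by
  have := D.comm c c a b 0 n k l hb hb
  simp only [if_neg ha, add_zero, smul_zero, Finset.sum_const_zero, neg_zero] at this
  exact sub_eq_zero.1 this

lemma z_w (D : RData T Wd) (a b : Fin ℓ) (n : ℕ) : T a a 0 n * wz T b = wz T b * T a a 0 n := by
  have h0 : ∀ c, c ≠ a → T a a 0 n * T c c 0 0 = T c c 0 0 * T a a 0 n := fun c hc => w_comm0 D hc hc _ _ _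
  rw [wz, mul_smul_comm, smul_mul_assoc]
  congr 1
  by_cases hb : b = a
  · subst hb
    have h1 := D.cen (T b b 0 n)
    rw [← Finset.add_sum_erase _ _ (Finset.mem_univ b)] at h1
    rw [add_mul, mul_add, Finset.sum_mul, Finset.mul_sum] at h1
    rw [Finset.sum_congr rfl (fun c hc => (h0 c (Finset.ne_of_mem_erase hc)).symm)] at h1
    exact (add_right_cancel h1).symm
  · exact h0 b hb

lemma w_comm_b (D : RData T Wd) {a b : Fin ℓ} (hab : a ≠ b) :
    wz T b * T a b 0 0 - T a b 0 0 * wz T b = - (wz T a * T a b 0 0 - T a b 0 0 * wz T a) := by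
  have h1 := w_comm D hab 0 0
  have h2 := w_comm D hab.symm 0 0
  have h3 := D.trans a b 0 0
  rw [D.symm b a (0+1) 0, D.symm b a 0 0] at h2
  rw [h1, h2, eq_neg_iff_add_eq_zero]
  simp only [Nat.cast_zero, zero_add, one_smul] at h3 ⊢
  rw [← h3]; module

lemma adm_comm {u w : R} (h : u * w = w * u) : Commute (adm u) (adm w) := by
  ext x
  simp only [Module.End.mul_apply, adm_apply]
  have h' : ∀ y, u * (w * y) = w * (u * y) := fun y => by rw [← mul_assoc, h, mul_assoc]
  simp only [mul_sub, sub_mul, mul_assoc, h, h']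
  abel

lemma w_w (D : RData T Wd) (a b : Fin ℓ) : wz T a * wz T b = wz T b * wz T a := by
  have := z_w D a b 0
  rw [wz.eq_1 T a, smul_mul_assoc, mul_smul_comm, this]

/-- commutation with `w_b` -/
lemma Xp_X' (D : RData T Wd) {a b : Fin ℓ} (hab : a ≠ b) (p : ℂ[X]) :
    Xp T a b (X * p) = Xp T a b p * wz T b - wz T b * Xp T a b p := by
  have h1 : adm (wz T b) (Xp T a b p) = aeval (adm (wz T a)) p (adm (wz T b) (T a b 0 0)) := by
    have h : Commute (aeval (adm (wz T a)) p) (adm (wz T b)) := by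
      have hc := adm_comm (w_w D a b)
      induction p using Polynomial.induction_on' with
      | add p q hp hq => rw [map_add]; exact hp.add_left hq
      | monomial n c =>
        rw [aeval_monomial]
        exact (Algebra.commute_algebraMap_left _ _).mul_left (hc.pow_left n)
    rw [Xp_apply, ← Module.End.mul_apply, ← Module.End.mul_apply, h.eq]
  rw [adm_apply (wz T b) (T a b 0 0), w_comm_b D hab, ← adm_apply, map_neg, ← Module.End.mul_apply] at h1
  rw [adm_apply] at h1
  rw [mul_comm, Xp_apply, map_mul, aeval_X, ← neg_eq_iff_eq_neg.2 h1]; abel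

lemma Xp_swap (D : RData T Wd) {a b : Fin ℓ} (hab : a ≠ b) (p : ℂ[X]) :
    Xp T b a p = Xp T a b (p.comp (-X)) := by
  induction p using Polynomial.induction_on' with
  | add p q hp hq => rw [map_add, add_comp, map_add, hp, hq]
  | monomial n c =>
    rw [← C_mul_X_pow_eq_monomial, mul_comp, C_comp, ← smul_eq_C_mul, ← smul_eq_C_mul, map_smul, map_smul]
    congr 1
    induction n with
    | zero => simp [Xp_one, D.symm b a]
    | succ n ih =>
      rw [pow_succ', Xp_X, ih, mul_comp, X_comp, neg_mul, map_neg, Xp_X' D hab]; abel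

lemma T_bp (D : RData T Wd) {a b : Fin ℓ} (hab : a ≠ b) (r : ℕ) : T a b r 0 = Xp T a b (bp r) := by
  induction r with
  | zero => rw [bp, Xp_one]
  | succ r ih =>
    have h := w_comm D hab r 0
    rw [bp, ← smul_eq_C_mul, map_smul, sub_mul, map_sub, Xp_X, ← ih, h, ← smul_eq_C_mul, map_smul, ← ih, ← smul_sub,
      add_sub_cancel_right, smul_smul]
    rw [one_div, inv_mul_cancel₀ (Nat.cast_add_one_ne_zero _), one_smul]

lemma T_bn (D : RData T Wd) {a b : Fin ℓ} (hab : a ≠ b) (r : ℕ) : T a b 0 r = Xp T a b (bn r) := by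
  induction r with
  | zero => rw [bn, Xp_one]
  | succ r ih =>
    have h := w_comm D hab 0 r
    have h2 := D.trans a b 0 r
    have h0 : ((r:ℂ)+1) ≠ 0 := Nat.cast_add_one_ne_zero r
    rw [bn, ← smul_eq_C_mul, map_smul, add_mul, map_add, Xp_X, ← ih, h, ← smul_eq_C_mul, map_smul, ← ih]
    have h3 : ((r:ℂ)+1) • T a b 0 (r+1) = - (T a b 1 r + ((r:ℂ)+2) • T a b 0 r) := by
      rw [eq_neg_iff_add_eq_zero, ← h2]; simp only [Nat.cast_zero, zero_add]; module
    have h4 : T a b 0 (r+1) = (1/((r:ℂ)+1)) • (((r:ℂ)+1) • T a b 0 (r+1)) := by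
      rw [smul_smul, one_div, inv_mul_cancel₀ h0, one_smul]
    rw [h4, h3]; simp only [Nat.cast_zero, zero_add]; module

lemma T_mem (D : RData T Wd) {a b : Fin ℓ} (hab : a ≠ b) (i j : ℕ) : ∃ p, T a b i j = Xp T a b p := by
  induction i with
  | zero => exact ⟨_, T_bn D hab j⟩
  | succ i ih =>
    obtain ⟨p, hp⟩ := ih
    have h := w_comm D hab i j
    refine ⟨(1/((i:ℂ)+1)) • (X * p) - p, ?_⟩
    rw [map_sub, map_smul, Xp_X, ← hp, h, smul_smul, one_div, inv_mul_cancel₀ (Nat.cast_add_one_ne_zero _), one_smul]; abel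

lemma Taa_mem (D : RData T Wd) (a : Fin ℓ) (i j : ℕ) :
    T a a i j ∈ Submodule.span ℂ (Set.range (T a a 0)) := by
  induction i generalizing j with
  | zero => exact Submodule.subset_span ⟨j, rfl⟩
  | succ i ih =>
    have h2 := D.trans a a i j
    have h4 : T a a (i+1) j = (-(1/((i:ℂ)+1))) • (((j:ℂ)+1) • T a a i (j+1) + ((i:ℂ)+j+2) • T a a i j) := by
      have h3 : ((j:ℂ)+1) • T a a i (j+1) + ((i:ℂ)+j+2) • T a a i j = - (((i:ℂ)+1) • T a a (i+1) j) := by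
        rw [eq_neg_iff_add_eq_zero, ← h2]; abel
      rw [h3, smul_neg, neg_smul, neg_neg, smul_smul, one_div, inv_mul_cancel₀ (Nat.cast_add_one_ne_zero _), one_smul]
    rw [h4]
    exact Submodule.smul_mem _ _ (Submodule.add_mem _ (Submodule.smul_mem _ _ (ih _)) (Submodule.smul_mem _ _ (ih _)))

/-- the difference polynomial for `z_n y - z_1 S(n,1)` -/
noncomputable def Pz (n : ℕ) : ℂ[X] :=
  ∑ t ∈ Finset.range 3, (((2:ℕ).choose t : ℂ) * (2 * Pc 0 0 n (t-1))) • bp (n+(2-t))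
   - ∑ t ∈ Finset.range (n+3), (((n+2).choose t : ℂ) * (Pc 0 n 0 (t-1) + Pc n 0 0 (t-1))) • bp (n+2-t)

/-- the commutator polynomial of `z_n` with `y` -/
noncomputable def Gz (n : ℕ) : ℂ[X] :=
   - ∑ t ∈ Finset.range (n+2), (((n+1).choose t : ℂ) * (Pc 0 n 0 t + Pc n 0 0 t)) • bp (n+1-t)

lemma z_y (D : RData T Wd) {a b : Fin ℓ} (hab : a ≠ b) (n : ℕ) : 
    T a a 0 n * T a b 0 0 = T a a 0 0 * Xp T a b (bp n) + Xp T a b (Pz n) := by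
  have h1 := D.mul a a a b 0 n 0 0 hab.symm hab.symm
  have h2 := D.mul a a a b 0 0 n 0 hab.symm hab.symm
  have e : Wd (a,0) (b,0) (a,0) (a,n) = Wd (a,n) (b,0) (a,0) (a,0) := by
    rw [D.wd34, D.wd23, D.wd12, D.wd23, D.wd34, D.wd23]
  rw [h1, ← T_bp D hab, h2, e, Pz]
  simp only [map_sub, map_sum, map_smul, if_true, zero_add, ← T_bp D hab, ← add_smul, smul_smul, two_mul]
  abel

lemma z_y_comm (D : RData T Wd) {a b : Fin ℓ} (hab : a ≠ b) (n : ℕ) : 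
    T a a 0 n * T a b 0 0 - T a b 0 0 * T a a 0 n = Xp T a b (Gz n) := by
  have h1 := D.comm a a a b 0 n 0 0 hab.symm hab.symm
  rw [h1, Gz]
  simp only [map_neg, map_sum, map_smul, if_true, zero_add, ← T_bp D hab, ← add_smul, smul_smul]

end
end Zhu
end

section
namespace Zhu
open Filter Polynomial

section
variable {ℓ : ℕ} {R : Type} [Ring R] [Algebra ℂ R] {T : Fin ℓ → Fin ℓ → ℕ → ℕ → R}
  {Wd : (Fin ℓ × ℕ) → (Fin ℓ × ℕ) → (Fin ℓ × ℕ) → (Fin ℓ × ℕ) → R}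

/-- the cubic for `z_1 X(x)` -/
noncomputable def k0 : ℂ[X] := C (1/2) * (X * (X + 1)^2)
/-- the quartic for `Y y` -/
noncomputable def k1 : ℂ[X] := C (1/4) * (X^2 * (X + 1) * (3 * X + 1))
/-- the cubic for `y y` -/
noncomputable def c3 : ℂ[X] := C (1/6) * (X * (X + 1) * (2 * X + 1))
/-- the quintic -/
noncomputable def mm : ℂ[X] := X * (X^2 - 1) * (4 * X^2 - 1)

lemma Pz1 : Pz 1 = - k0 := by
  apply Polynomial.funext; intro r
  simp [Pz, k0, bp, Finset.sum_range_succ, Pc, cch]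
  norm_num [Nat.choose]
  ring

lemma Pz2 : (2:ℂ) • Pz 2 = k1 - k0 * (X - 3) := by
  apply Polynomial.funext; intro r
  simp [Pz, k0, k1, bp, Finset.sum_range_succ, Pc, cch]
  norm_num [Nat.choose]
  ring

lemma Pz3 : mm = (60:ℂ) • (k1 + k0 * (C (1/6) * (X^2-6*X+11)) + Pz 3) := by
  apply Polynomial.funext; intro r
  simp [Pz, k0, k1, mm, bp, Finset.sum_range_succ, Pc, cch]
  norm_num [Nat.choose]
  ring

lemma Gz2 : Gz 2 = X^3 + 2 * X := by
  apply Polynomial.funext; intro r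
  simp [Gz, bp, Finset.sum_range_succ, Pc, cch]
  norm_num [Nat.choose]
  ring

lemma Gz0 : Gz 0 = 2 * X := by
  apply Polynomial.funext; intro r
  simp [Gz, bp, Finset.sum_range_succ, Pc, cch]
  ring

/-- The left-right symmetric list of relations. -/
structure QData (Q : Fin ℓ → Fin ℓ → ℂ[X] →ₗ[ℂ] R) (z : Fin ℓ → ℕ → R) : Prop where
  xl : ∀ a b, a ≠ b → ∀ p, Q a b (X * p) = ((1/2:ℂ) • z a 0) * Q a b p - Q a b p * ((1/2:ℂ) • z a 0)
  swap : ∀ a b, a ≠ b → ∀ p, Q b a p = Q a b (p.comp (-X))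
  zw : ∀ a b n, z a n * z b 0 = z b 0 * z a n
  zx : ∀ a b c, a ≠ b → c ≠ a → c ≠ b → ∀ n p, z c n * Q a b p = Q a b p * z c n
  znl : ∀ a b, a ≠ b → ∀ n, ∃ k, z a n * Q a b X = Q a b k
  znr : ∀ a b, a ≠ b → ∀ n, ∃ k, Q b a X * z a n = Q b a k
  c3l : ∀ a b c, a ≠ b → c ≠ a → c ≠ b → Q c a 1 * Q a b X = Q c b c3
  c3r : ∀ a b c, a ≠ b → c ≠ a → c ≠ b → Q c a X * Q a b 1 = Q c b c3
  yl : ∀ a b, a ≠ b → ((2:ℂ) • (z a 2 - z a 0)) * Q a b 1 = Q a b k1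
  yr : ∀ a b, a ≠ b → Q b a 1 * ((2:ℂ) • (z a 2 - z a 0)) = Q b a k1
  m0 : ∀ a b, a ≠ b → Q a b mm = 0

lemma transf_l (D : RData T Wd) {a b : Fin ℓ} (hab : a ≠ b) {u : R} (hu : u * wz T b = wz T b * u)
    {p k : ℂ[X]} (h : u * Xp T a b p = Xp T a b k) (q : ℂ[X]) : u * Xp T a b (q * p) = Xp T a b (q * k) := by
  induction q using Polynomial.induction_on' with
  | add q r hq hr => rw [add_mul, add_mul, map_add, map_add, mul_add, hq, hr]
  | monomial n c =>
    rw [← C_mul_X_pow_eq_monomial, mul_assoc, mul_assoc, ← smul_eq_C_mul, ← smul_eq_C_mul, map_smul, map_smul, mul_smul_comm]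
    congr 1
    induction n with
    | zero => simpa using h
    | succ n ih =>
      rw [pow_succ', mul_assoc, mul_assoc, Xp_X' D hab, Xp_X' D hab, ← ih, mul_sub, ← mul_assoc, ← mul_assoc, hu, mul_assoc _ u]

lemma z1_eq (D : RData T Wd) (a : Fin ℓ) : T a a 0 1 = - T a a 0 0 := by
  have h := D.trans a a 0 0
  rw [D.symm a a (0+1) 0] at h
  simp only [Nat.cast_zero, zero_add, one_smul] at h
  have h2 : (2:ℂ) • (T a a 0 1 + T a a 0 0) = 0 := by rw [← h]; module
  rw [eq_neg_iff_add_eq_zero]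
  exact (smul_eq_zero.1 h2).resolve_left (by norm_num)

lemma z3_eq (D : RData T Wd) (a : Fin ℓ) : T a a 0 3 = T a a 0 0 - (2:ℂ) • T a a 0 2 := by
  have h1 := D.trans a a 0 1
  have h2 := D.trans a a 0 2
  have h3 := D.trans a a 1 1
  rw [D.symm a a (1+1) 1] at h3
  simp only [Nat.cast_zero, Nat.cast_one, Nat.cast_ofNat, zero_add, one_smul, z1_eq D, one_add_one_eq_two, Nat.reduceAdd] at h1 h2 h3
  have h4 : (3:ℂ) • (T a a 0 3 - (T a a 0 0 - (2:ℂ) • T a a 0 2)) = 0 := by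
    have e : (3:ℂ) • (T a a 0 3 - (T a a 0 0 - (2:ℂ) • T a a 0 2)) = 
      (T a a 1 2 + ((2:ℂ)+1) • T a a 0 3 + ((2:ℂ)+2) • T a a 0 2)
      - (1/4:ℂ) • ((2:ℂ) • T a a 1 2 + (2:ℂ) • T a a 1 2 + ((1:ℂ)+1+2) • T a a 1 1) 
      + (T a a 1 1 + (2:ℂ) • T a a 0 2 + ((1:ℂ)+2) • -T a a 0 0) := by module
    rw [e, h1, h2]
    rw [show ((1:ℂ)+1+2) = 2+2 by norm_num] at *
    rw [h3]; simp
  rw [← sub_eq_zero]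
  exact (smul_eq_zero.1 h4).resolve_left (by norm_num)

lemma z0_X (D : RData T Wd) {a b : Fin ℓ} (hab : a ≠ b) : T a a 0 0 * Xp T a b X = Xp T a b k0 := by
  have h := z_y D hab 1
  have e : bp 1 = X - 1 := by simp [bp]
  rw [Pz1, z1_eq D, e, map_sub, map_neg, Xp_one, mul_sub] at h
  rw [neg_mul] at h
  have h2 : T a a 0 0 * Xp T a b X - Xp T a b k0 = (T a a 0 0 * Xp T a b X - T a a 0 0 * T a b 0 0 + -Xp T a b k0)
    - (-(T a a 0 0 * T a b 0 0)) := by abel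
  rw [← sub_eq_zero, h2, ← h, sub_self]

lemma z0_Xq (D : RData T Wd) {a b : Fin ℓ} (hab : a ≠ b) (q : ℂ[X]) : 
    T a a 0 0 * Xp T a b (q * X) = Xp T a b (q * k0) :=
  transf_l D hab (z_w D a b 0) (z0_X D hab) q

lemma zn_y (D : RData T Wd) {a b : Fin ℓ} (hab : a ≠ b) (n : ℕ) {q : ℂ[X]} {c : ℂ} (hq : bp n = q * X + C c) :
    T a a 0 n * T a b 0 0 = c • (T a a 0 0 * T a b 0 0) + Xp T a b (q * k0 + Pz n) := by
  rw [z_y D hab, hq, map_add, mul_add, z0_Xq D hab, map_add, ← mul_one (C c), ← smul_eq_C_mul, map_smul, Xp_one, mul_smul_comm]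
  abel

lemma Y_y (D : RData T Wd) {a b : Fin ℓ} (hab : a ≠ b) : 
    ((2:ℂ) • (T a a 0 2 - T a a 0 0)) * T a b 0 0 = Xp T a b k1 := by
  have h := zn_y D hab 2 (q := C (1/2) * (X - 3)) (c := 1) (by
    apply Polynomial.funext; intro r; simp [bp]; ring)
  have e : k1 = (2:ℂ) • (C (1/2) * (X - 3) * k0 + Pz 2) := by
    rw [smul_add, Pz2]
    apply Polynomial.funext; intro r; simp; ring
  rw [smul_mul_assoc, sub_mul, h, e, map_smul]
  module

lemma X_mm (D : RData T Wd) {a b : Fin ℓ} (hab : a ≠ b) : Xp T a b mm = 0 := by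
  have h := zn_y D hab 3 (q := C (1/6) * (X^2 - 6 * X + 11)) (c := -1) (by
    apply Polynomial.funext; intro r; simp [bp]; ring)
  have h2 := Y_y D hab
  have e : mm = (60:ℂ) • (k1 + (C (1/6) * (X^2 - 6 * X + 11) * k0 + Pz 3)) := by
    rw [Pz3]; congr 1; ring
  rw [z3_eq D, sub_mul, smul_mul_assoc] at h
  rw [e, map_smul, map_add, ← h2]
  rw [← sub_eq_iff_eq_add'] at h
  rw [← h, smul_mul_assoc, sub_mul]
  module

lemma bp_div (n : ℕ) : ∃ q c, bp n = q * X + C c := 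
  ⟨divX (bp n), (bp n).coeff 0, (divX_mul_X_add _).symm⟩

lemma zn_X (D : RData T Wd) {a b : Fin ℓ} (hab : a ≠ b) (n : ℕ) : ∃ k, T a a 0 n * Xp T a b X = Xp T a b k := by
  obtain ⟨q, c, h⟩ := bp_div n
  have h1 := zn_y D hab n h
  have h2 : (T a a 0 n - c • T a a 0 0) * Xp T a b 1 = Xp T a b (q * k0 + Pz n) := by
    rw [sub_mul, Xp_one, h1, smul_mul_assoc]; abel
  have h3 := transf_l D hab (by rw [sub_mul, mul_sub, smul_mul_assoc, mul_smul_comm, z_w D, z_w D]) h2 X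
  rw [mul_one, sub_mul, smul_mul_assoc, z0_X D hab, sub_eq_iff_eq_add, ← map_smul, ← map_add] at h3
  exact ⟨_, h3⟩

lemma comm_X (D : RData T Wd) {a b : Fin ℓ} (hab : a ≠ b) (n : ℕ) (p : ℂ[X]) :
    T a a 0 n * Xp T a b p - Xp T a b p * T a a 0 n = Xp T a b (p * Gz n) := by
  induction p using Polynomial.induction_on' with
  | add q r hq hr => rw [add_mul, map_add, map_add, ← hq, ← hr, mul_add, add_mul]; abel
  | monomial m c =>
    rw [← C_mul_X_pow_eq_monomial, mul_assoc, ← smul_eq_C_mul, ← smul_eq_C_mul, map_smul, map_smul, mul_smul_comm,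
     smul_mul_assoc, ← smul_sub]
    congr 1
    induction m with
    | zero => rw [pow_zero, one_mul, Xp_one, z_y_comm D hab]
    | succ m ih =>
      rw [pow_succ', mul_assoc, Xp_X' D hab, Xp_X' D hab, ← ih]
      have := z_w D a b n
      simp only [mul_sub, sub_mul, mul_assoc, this]
      simp only [← mul_assoc, this]
      abel

lemma Xn_z (D : RData T Wd) {a b : Fin ℓ} (hab : a ≠ b) (n : ℕ) : ∃ k, Xp T b a X * T a a 0 n = Xp T b a k := by
  obtain ⟨k, hk⟩ := zn_X D hab n
  have h := comm_X D hab n X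
  refine ⟨(-(k - X * Gz n)).comp (-X), ?_⟩
  rw [Xp_swap D hab, ← Xp_swap D hab.symm, X_comp, map_neg, neg_mul, map_neg, map_sub, ← hk, ← h]
  abel

lemma y_Y (D : RData T Wd) {a b : Fin ℓ} (hab : a ≠ b) : 
    T b a 0 0 * ((2:ℂ) • (T a a 0 2 - T a a 0 0)) = Xp T b a k1 := by
  have h1 := Y_y D hab
  have h2 := comm_X D hab 2 1
  have h3 := comm_X D hab 0 1
  rw [Xp_one, one_mul, sub_eq_iff_eq_add, add_comm, ← sub_eq_iff_eq_add] at h2 h3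
  rw [D.symm b a, mul_smul_comm, mul_sub, ← h2, ← h3, Xp_swap D hab]
  have e : k1.comp (-X) = k1 - (2:ℂ) • (Gz 2 - Gz 0) := by
    rw [Gz2, Gz0]
    apply Polynomial.funext; intro r; simp [k1]; ring
  rw [e, map_sub, ← h1, map_smul, map_sub, smul_mul_assoc, sub_mul]
  module

end
end Zhu
end

section
namespace Zhu
open Filter Polynomial

section
variable {ℓ : ℕ} {R : Type} [Ring R] [Algebra ℂ R] {T : Fin ℓ → Fin ℓ → ℕ → ℕ → R}
  {Wd : (Fin ℓ × ℕ) → (Fin ℓ × ℕ) → (Fin ℓ × ℕ) → (Fin ℓ × ℕ) → R}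

lemma ca_ab (D : RData T Wd) {a b c : Fin ℓ} (hab : a ≠ b) (hca : c ≠ a) (hcb : c ≠ b) (j k : ℕ) :
    T c a 0 j * T a b k 0 = Wd (a,k) (b,0) (c,0) (a,j) 
      - Xp T c b (∑ t ∈ Finset.range (j+3), (((j+2).choose t : ℂ) * Pc j 0 k (t-1)) • bp (k+(j+2-t))) := by
  have h := D.mul c a a b 0 j k 0 hcb.symm hab.symm
  simp only [if_neg hca.symm, if_true, zero_add] at h
  rw [h]
  simp only [map_sum, map_smul, ← T_bp D hcb, smul_smul]

lemma w_Xp (D : RData T Wd) {a b c : Fin ℓ} (hab : a ≠ b) (hca : c ≠ a) (hcb : c ≠ b) (n : ℕ) (p : ℂ[X]) :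
    T c c 0 n * Xp T a b p = Xp T a b p * T c c 0 n := by
  induction p using Polynomial.induction_on' with
  | add q r hq hr => rw [map_add, mul_add, add_mul, hq, hr]
  | monomial m r =>
    rw [← C_mul_X_pow_eq_monomial, ← smul_eq_C_mul, map_smul, mul_smul_comm, smul_mul_assoc]
    congr 1
    induction m with
    | zero => rw [pow_zero, Xp_one]; exact w_comm0 D hcb.symm hca.symm _ _ _
    | succ m ih =>
      have h := z_w D c a n
      rw [pow_succ', Xp_X]
      rw [mul_sub, sub_mul, ← mul_assoc, h, mul_assoc, ih, ← mul_assoc (T c c 0 n), ih, mul_assoc _ (T c c 0 n), h]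
      simp only [mul_assoc]

lemma ww_Xp (D : RData T Wd) {a b c : Fin ℓ} (hab : a ≠ b) (hca : c ≠ a) (hcb : c ≠ b) (p : ℂ[X]) :
    wz T c * Xp T a b p = Xp T a b p * wz T c := by
  rw [wz, smul_mul_assoc, mul_smul_comm, w_Xp D hab hca hcb]

lemma w_yy (D : RData T Wd) {a b c : Fin ℓ} (hab : a ≠ b) (hca : c ≠ a) (hcb : c ≠ b) :
    wz T a * (T c a 0 0 * T a b 0 0) = T c a 0 0 * T a b 0 0 * wz T a := by
  have h1 := ca_ab D hab hca hcb 0 0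
  have h2 := D.mul a a c b 0 0 0 0 hab.symm hab.symm
  simp only [if_neg hca, add_zero, smul_zero, Finset.sum_const_zero, sub_zero] at h2
  have e : Wd (a,0) (b,0) (c,0) (a,0) = Wd (c,0) (b,0) (a,0) (a,0) := by
    rw [D.wd23, D.wd12, D.wd23]
  rw [h1, e, ← h2, mul_sub, sub_mul, ww_Xp D hcb hca.symm hab]
  congr 1
  rw [← mul_assoc, ← z_w D, mul_assoc, mul_assoc, ← Xp_one (T := T) c b, ww_Xp D hcb hca.symm hab]

lemma c3_eqs (D : RData T Wd) {a b c : Fin ℓ} (hab : a ≠ b) (hca : c ≠ a) (hcb : c ≠ b) :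
    T c a 0 0 * Xp T a b X = Xp T c b c3 ∧ Xp T c a X * T a b 0 0 = Xp T c b c3 := by
  have h1 := ca_ab D hab hca hcb 1 0
  have h2 := ca_ab D hab hca hcb 0 1
  have e : Wd (a,0) (b,0) (c,0) (a,1) = Wd (a,1) (b,0) (c,0) (a,0) := by
    rw [D.wd34, D.wd23, D.wd12, D.wd23, D.wd34]
  rw [T_bn D hca] at h1
  rw [T_bp D hab] at h2
  have eb : bp 1 = X - 1 := by simp [bp]
  have en : bn 1 = - X - 1 := by simp [bn]; ring
  rw [en, map_sub, map_neg, sub_mul, Xp_one, e] at h1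
  rw [eb, map_sub, mul_sub, Xp_one] at h2
  have hw := w_yy D hab hca hcb
  have f1 : Xp T a b X = wz T a * T a b 0 0 - T a b 0 0 * wz T a := by
    rw [← Xp_one (T := T), ← Xp_X, mul_one]
  have f2 : Xp T c a X = T c a 0 0 * wz T a - wz T a * T c a 0 0 := by
    rw [← Xp_one (T := T), ← Xp_X' D hca, mul_one]
  have f3 : T c a 0 0 * Xp T a b X = Xp T c a X * T a b 0 0 := by
    rw [f1, f2, mul_sub, sub_mul, mul_assoc _ _ (T a b 0 0), mul_assoc _ _ (T a b 0 0), hw, mul_assoc]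
  have h3 := congrArg₂ (· - ·) h2 h1
  have ep : (2:ℂ) • c3 = (∑ t ∈ Finset.range (1+3), (((1+2).choose t : ℂ) * Pc 1 0 0 (t-1)) • bp (0+(1+2-t)))
     - (∑ t ∈ Finset.range (0+3), (((0+2).choose t : ℂ) * Pc 0 0 1 (t-1)) • bp (1+(0+2-t))) := by
    apply Polynomial.funext; intro r
    simp [c3, bp, Finset.sum_range_succ, Pc, cch]
    norm_num [Nat.choose]
    ring
  have h4 : (2:ℂ) • (T c a 0 0 * Xp T a b X) = (2:ℂ) • Xp T c b c3 := by
    rw [← map_smul, ep, map_sub]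
    have e5 : (2:ℂ) • (T c a 0 0 * Xp T a b X) = T c a 0 0 * Xp T a b X - T c a 0 0 * T a b 0 0 -
      (-Xp T c a X * T a b 0 0 - T c a 0 0 * T a b 0 0) := by
      rw [neg_mul, ← f3, two_smul]; abel
    rw [e5, h3]; abel
  have h5 := smul_right_injective R (two_ne_zero : (2:ℂ) ≠ 0) h4
  exact ⟨h5, by rw [← f3, h5]⟩

lemma sq_eq (D : RData T Wd) {a b : Fin ℓ} (hab : a ≠ b) :
    T a b 0 0 * T a b 0 0 = T a a 0 0 * T b b 0 0 + (T a a 0 2 - T a a 0 0) + (T b b 0 2 - T b b 0 0) := by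
  have h1 := D.mul a a b b 0 0 0 0 hab.symm hab.symm
  simp only [if_neg hab.symm, add_zero, smul_zero, Finset.sum_const_zero, sub_zero] at h1
  have e : Wd (a,0) (b,0) (a,0) (b,0) = Wd (b,0) (b,0) (a,0) (a,0) := by
    rw [D.wd34, D.wd23, D.wd12, D.wd23]
  rw [D.sq a b hab, z1_eq D, z1_eq D, h1, e]; module

theorem qdata (D : RData T Wd) : QData (Xp T) (fun a n => T a a 0 n) where
  xl a b hab p := Xp_X a b p
  swap a b hab p := Xp_swap D hab p
  zw a b n := by
    have := z_w D a b n
    rw [wz, mul_smul_comm, smul_mul_assoc] at this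
    exact smul_right_injective R (by norm_num : (1/2:ℂ) ≠ 0) this
  zx a b c hab hca hcb n p := w_Xp D hab hca hcb n p
  znl a b hab n := zn_X D hab n
  znr a b hab n := Xn_z D hab n
  c3l a b c hab hca hcb := by rw [Xp_one]; exact (c3_eqs D hab hca hcb).1
  c3r a b c hab hca hcb := by rw [Xp_one]; exact (c3_eqs D hab hca hcb).2
  yl a b hab := by rw [Xp_one]; exact Y_y D hab
  yr a b hab := by rw [Xp_one]; exact y_Y D hab
  m0 a b hab := X_mm D hab

/-- the opposite data -/
theorem QData.opp {Q : Fin ℓ → Fin ℓ → ℂ[X] →ₗ[ℂ] R} {z : Fin ℓ → ℕ → R} (h : QData Q z) :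
    QData (fun a b => (MulOpposite.opLinearEquiv ℂ).toLinearMap ∘ₗ Q b a) (fun a n => MulOpposite.op (z a n)) where
  xl a b hab p := by
    have := h.xl b a hab.symm p
    have e := h.xl a b hab (p.comp (-X))
    apply MulOpposite.unop_injective
    simp only [LinearMap.comp_apply, LinearEquiv.coe_coe, MulOpposite.coe_opLinearEquiv, MulOpposite.unop_op, MulOpposite.unop_sub,
      MulOpposite.unop_mul, MulOpposite.unop_smul]
    rw [h.swap a b hab, h.swap a b hab p, mul_comp, X_comp, neg_mul, map_neg, e]
    abel
  swap a b hab p := by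
    apply MulOpposite.unop_injective
    exact h.swap b a hab.symm p
  zw a b n := by
    apply MulOpposite.unop_injective
    exact (h.zw a b n).symm
  zx a b c hab hca hcb n p := by
    apply MulOpposite.unop_injective
    exact (h.zx b a c hab.symm hcb hca n p).symm
  znl a b hab n := by
    obtain ⟨k, hk⟩ := h.znr a b hab n
    exact ⟨k, MulOpposite.unop_injective hk⟩
  znr a b hab n := by
    obtain ⟨k, hk⟩ := h.znl a b hab n
    exact ⟨k, MulOpposite.unop_injective hk⟩
  c3l a b c hab hca hcb := MulOpposite.unop_injective (h.c3r a c b hca.symm hab.symm hcb.symm)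
  c3r a b c hab hca hcb := MulOpposite.unop_injective (h.c3l a c b hca.symm hab.symm hcb.symm)
  yl a b hab := MulOpposite.unop_injective (h.yr a b hab)
  yr a b hab := MulOpposite.unop_injective (h.yl a b hab)
  m0 a b hab := MulOpposite.unop_injective (h.m0 b a hab.symm)
end
end Zhu
end

section
namespace Zhu
open Filter Polynomial

/-- conditions on the pair `(τ, e)` -/
structure EP (τ : ℂ) (e : ℂ[X]) : Prop where
  dvd : mm ∣ (X - C τ) * e
  ne : τ ≠ 0
  c3n : c3.eval (-τ) = 0
  c3p : c3.eval τ * e.eval τ = τ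
  en : e.eval (-τ) = 0
  bez : ∃ A B : ℂ[X], X - C τ = A * mm + B * (k1 - C (k1.eval τ))
  lam : (k0.eval τ * k0.eval (-τ) / (-τ^2) + k1.eval τ / 2 + k1.eval (-τ) / 2) * e.eval τ ^ 2 = 1

section
variable {ℓ : ℕ} {R : Type} [Ring R] [Algebra ℂ R] {Q : Fin ℓ → Fin ℓ → ℂ[X] →ₗ[ℂ] R} {z : Fin ℓ → ℕ → R}
  {τ : ℂ} {e : ℂ[X]}

lemma QData.xr (h : QData Q z) {a b : Fin ℓ} (hab : a ≠ b) (p : ℂ[X]) :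
    Q a b (X * p) = Q a b p * ((1/2:ℂ) • z b 0) - ((1/2:ℂ) • z b 0) * Q a b p := by
  rw [h.swap b a hab.symm, mul_comp, X_comp, neg_mul, map_neg, h.xl b a hab.symm, h.swap b a hab.symm p]
  abel

lemma QData.tl (h : QData Q z) {a b c : Fin ℓ} (hab : a ≠ b) (hcb : c ≠ b) {u : R} (hu : u * z b 0 = z b 0 * u)
    {p k : ℂ[X]} (H : u * Q a b p = Q c b k) (q : ℂ[X]) : u * Q a b (q * p) = Q c b (q * k) := by
  induction q using Polynomial.induction_on' with
  | add q r hq hr => rw [add_mul, add_mul, map_add, map_add, mul_add, hq, hr]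
  | monomial n c =>
    rw [← C_mul_X_pow_eq_monomial, mul_assoc, mul_assoc, ← smul_eq_C_mul, ← smul_eq_C_mul, map_smul, map_smul, mul_smul_comm]
    congr 1
    induction n with
    | zero => simpa using H
    | succ n ih =>
      rw [pow_succ', mul_assoc, mul_assoc, h.xr hab, h.xr hcb, ← ih, mul_sub, ← mul_assoc, ← mul_assoc,
        mul_smul_comm _ u, hu, smul_mul_assoc, smul_mul_assoc, mul_assoc _ u]

lemma QData.tr (h : QData Q z) {a b c : Fin ℓ} (hca : c ≠ a) (hcb : c ≠ b) {v : R} (hv : v * z c 0 = z c 0 * v)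
    {p k : ℂ[X]} (H : Q c a p * v = Q c b k) (q : ℂ[X]) : Q c a (q * p) * v = Q c b (q * k) :=
  MulOpposite.op_injective (h.opp.tl hca.symm hcb.symm (u := MulOpposite.op v)
    (MulOpposite.unop_injective hv.symm) (MulOpposite.unop_injective H) q)

lemma QData.mz (h : QData Q z) {a b : Fin ℓ} (hab : a ≠ b) (q : ℂ[X]) : Q a b (q * mm) = 0 := by
  have := h.tl hab hab (u := 1) (by simp) (p := mm) (k := 0) (by rw [h.m0 a b hab]; simp) q
  simpa using this

lemma QData.eig (h : QData Q z) (he : EP τ e) {a b : Fin ℓ} (hab : a ≠ b) (q : ℂ[X]) :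
    Q a b (q * e) = q.eval τ • Q a b e := by
  obtain ⟨r, hr⟩ := he.dvd
  obtain ⟨s, hs⟩ := X_sub_C_dvd_sub_C_eval (a := τ) (p := q)
  have : q * e = C (q.eval τ) * e + (s * r) * mm := by
    have : q = C (q.eval τ) + (X - C τ) * s := by rw [← hs]; ring
    calc q * e = (C (q.eval τ) + (X - C τ) * s) * e := by rw [← this]
      _ = C (q.eval τ) * e + s * ((X - C τ) * e) := by ring
      _ = _ := by rw [hr]; ring
  rw [this, map_add, h.mz hab, add_zero, ← smul_eq_C_mul, map_smul]

lemma QData.eigs (h : QData Q z) (he : EP τ e) {a b : Fin ℓ} (hab : a ≠ b) (q : ℂ[X]) :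
    Q b a (q * e.comp (-X)) = q.eval (-τ) • Q a b e := by
  rw [h.swap a b hab, mul_comp, comp_assoc]
  have : (-X : ℂ[X]).comp (-X) = X := by simp
  rw [this, comp_X, h.eig he hab]; simp

lemma QData.eX (h : QData Q z) (he : EP τ e) {a b : Fin ℓ} (hab : a ≠ b) : 
    Q a b e = τ⁻¹ • Q a b (e * X) := by
  rw [mul_comm, h.eig he hab, eval_X, smul_smul, inv_mul_cancel₀ he.ne, one_smul]

lemma QData.eXs (h : QData Q z) (he : EP τ e) {a b : Fin ℓ} (hab : a ≠ b) : 
    Q a b e = (-τ)⁻¹ • Q b a (e.comp (-X) * X) := by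
  rw [mul_comm, h.eigs he hab, eval_X, smul_smul, inv_mul_cancel₀ (neg_ne_zero.2 he.ne), one_smul]

lemma QData.c3g (h : QData Q z) {a b c : Fin ℓ} (hab : a ≠ b) (hca : c ≠ a) (hcb : c ≠ b) (p q : ℂ[X]) :
    Q c a p * Q a b (q * X) = Q c b (p * (q * c3)) := by
  have h1 := h.tl hab hcb (h.zx c a b hca hcb.symm hab.symm 0 1).symm (h.c3l a b c hab hca hcb) q
  have h2 := h.tr hca hcb (h.zx a b c hab hca hcb 0 _).symm h1 p
  rwa [mul_one] at h2

lemma QData.L1 (h : QData Q z) (he : EP τ e) {a b c : Fin ℓ} (hab : a ≠ b) (hca : c ≠ a) (hcb : c ≠ b) (q : ℂ[X]) :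
    Q c a q * Q a b e = (q.eval τ * (e.eval τ)⁻¹) • Q c b e := by
  have h3 := he.c3p
  have : e.eval τ ≠ 0 := fun h0 => by rw [h0, mul_zero] at h3; exact he.ne h3.symm
  rw [h.eX he hab, mul_smul_comm, h.c3g hab hca hcb, show q * (e * c3) = (q * c3) * e by ring, h.eig he hcb, smul_smul]
  congr 1
  rw [eval_mul]
  have := he.ne
  field_simp
  linear_combination (eval τ q) * h3

lemma QData.L4 (h : QData Q z) (he : EP τ e) {a b c : Fin ℓ} (hab : a ≠ b) (hca : c ≠ a) (hcb : c ≠ b) (q : ℂ[X]) :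
    Q c b q * Q a b e = 0 := by
  rw [h.eXs he hab, mul_smul_comm, h.c3g hab.symm hcb hca, show q * (e.comp (-X) * c3) = (q * c3) * e.comp (-X) by ring,
    h.eigs he hca.symm, eval_mul, he.c3n]
  simp

lemma QData.L5 (h : QData Q z) (he : EP τ e) {a b c d : Fin ℓ} (hab : a ≠ b) (hca : c ≠ a) (hcb : c ≠ b)
    (hda : d ≠ a) (hdb : d ≠ b) (hcd : c ≠ d) (q : ℂ[X]) :
    Q c d q * Q a b e = 0 := by
  have h3 := he.c3p
  have h0 : e.eval τ ≠ 0 := fun h0 => by rw [h0, mul_zero] at h3; exact he.ne h3.symm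
  have := h.L1 he (a := d) (b := b) (c := a) hdb hda.symm hab e
  rw [mul_inv_cancel₀ h0, one_smul] at this
  rw [← this, ← mul_assoc, h.L4 he hda.symm hca hcd, zero_mul]

lemma QData.T4 (h : QData Q z) {a b : Fin ℓ} (hab : a ≠ b) (p q : ℂ[X]) :
    Q b a (q * k1) * Q a b p = Q b a q * Q a b (p * k1) := by
  have hz : ((2:ℂ) • (z a 2 - z a 0)) * z b 0 = z b 0 * ((2:ℂ) • (z a 2 - z a 0)) := by
    rw [smul_mul_assoc, mul_smul_comm, sub_mul, mul_sub, h.zw, h.zw]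
  have h1 := h.tl hab hab hz (h.yl a b hab) p
  have h2 := h.tr hab.symm hab.symm hz (h.yr a b hab) q
  rw [← h1, ← h2, mul_one, mul_one, mul_assoc]

lemma QData.L2' (h : QData Q z) (he : EP τ e) {a b : Fin ℓ} (hab : a ≠ b) (q : ℂ[X]) :
    Q b a q * Q a b e = q.eval τ • (Q b a 1 * Q a b e) := by
  obtain ⟨A, B, hAB⟩ := he.bez
  obtain ⟨s, hs⟩ := X_sub_C_dvd_sub_C_eval (a := τ) (p := q)
  have hq : q = C (q.eval τ) * 1 + ((s * A) * mm + ((s * B) * k1 - C (k1.eval τ) * (s * B))) := by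
    calc q = C (q.eval τ) + (X - C τ) * s := by rw [← hs]; ring
      _ = _ := by rw [hAB]; ring
  conv_lhs => rw [hq]
  rw [map_add, map_add, h.mz hab.symm, zero_add, map_sub, add_mul, sub_mul, h.T4 hab, mul_comm e, h.eig he hab,
    ← smul_eq_C_mul, ← smul_eq_C_mul, map_smul, map_smul, mul_smul_comm, smul_mul_assoc, smul_mul_assoc, sub_self, add_zero]

lemma QData.L2 (h : QData Q z) (he : EP τ e) {a b : Fin ℓ} (hab : a ≠ b) (q : ℂ[X]) :
    Q b a q * Q a b e = (q.eval τ * (e.eval τ)⁻¹) • (Q b a e * Q a b e) := by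
  have h3 := he.c3p
  have h0 : e.eval τ ≠ 0 := fun h0 => by rw [h0, mul_zero] at h3; exact he.ne h3.symm
  rw [h.L2' he hab, h.L2' he hab e, smul_smul, mul_assoc, inv_mul_cancel₀ h0, mul_one]

lemma EP.e0 (he : EP τ e) : e.eval τ ≠ 0 := fun h0 => by
  have h3 := he.c3p
  rw [h0, mul_zero] at h3; exact he.ne h3.symm

/-- multiplication from the left kills when indices do not match -/
lemma QData.killl (h : QData Q z) (he : EP τ e) {a b c d : Fin ℓ} (hab : a ≠ b) (hcd : c ≠ d) (hda : d ≠ a) (q : ℂ[X])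
    (hq : q.eval (-τ) = 0) : Q c d q * Q a b e = 0 := by
  by_cases hca : c = a
  · subst hca
    rw [h.swap d c hda]
    by_cases hdb : d = b
    · subst hdb
      rw [h.L2 he hab]; simp [hq]
    · rw [h.L1 he hab hda hdb]; simp [hq]
  · by_cases hdb : d = b
    · subst hdb; exact h.L4 he hab hca hcd q
    · by_cases hcb : c = b
      · subst hcb
        rw [h.swap d c (Ne.symm hcd)]
        exact h.L4 he hab hda hdb _
      · exact h.L5 he hab hca hcb hda hdb hcd q

lemma QData.kill2 (h : QData Q z) (he : EP τ e) {a b c d : Fin ℓ} (hab : a ≠ b) (hcd : c ≠ d) (q : ℂ[X])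
    (hq : q.eval (-τ) = 0) (hq' : q.eval τ = 0) : Q c d q * Q a b e = 0 := by
  by_cases hda : d = a
  · subst hda
    by_cases hcb : c = b
    · subst hcb; rw [h.L2 he hab]; simp [hq']
    · rw [h.L1 he hab hcd hcb]; simp [hq']
  · exact h.killl he hab hcd hda q hq

/-- action of `z` -/
lemma QData.zE (h : QData Q z) (he : EP τ e) {a b : Fin ℓ} (hab : a ≠ b) (c : Fin ℓ) (n : ℕ) :
    ∃ r : ℂ, z c n * Q a b e = r • Q a b e := by
  have key : ∀ {a b : Fin ℓ}, a ≠ b → ∃ r : ℂ, z b n * Q a b e = r • Q a b e := by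
    intro a b hab
    obtain ⟨k, hk⟩ := h.znl b a hab.symm n
    have h1 := h.tl hab.symm hab.symm (h.zw b a n) hk (e.comp (-X))
    rw [mul_comm _ k, h.eigs he hab] at h1
    refine ⟨(-τ)⁻¹ * k.eval (-τ), ?_⟩
    conv_lhs => rw [h.eXs he hab, mul_smul_comm, h1, smul_smul]
  by_cases hca : c = a
  · subst hca
    obtain ⟨k, hk⟩ := h.znl c b hab n
    have h1 := h.tl hab hab (h.zw c b n) hk e
    rw [mul_comm _ k, h.eig he hab] at h1
    refine ⟨(τ)⁻¹ * k.eval τ, ?_⟩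
    conv_lhs => rw [h.eX he hab, mul_smul_comm, h1, smul_smul]
  · by_cases hcb : c = b
    · subst hcb; exact key hab
    · have := h.L1 he (a := c) (b := b) (c := a) hcb (Ne.symm hca) hab e
      rw [mul_inv_cancel₀ he.e0, one_smul] at this
      obtain ⟨r, hr⟩ := key (Ne.symm hca)
      exact ⟨r, by rw [← this, ← mul_assoc, hr, smul_mul_assoc]⟩

lemma QData.EEE (h : QData Q z) (he : EP τ e) {a b : Fin ℓ} (hab : a ≠ b)
   (h0 : ∀ a b, a ≠ b → z a 0 * Q a b X = Q a b k0)
   (hsq : Q a b 1 * Q a b 1 = z a 0 * z b 0 + (z a 2 - z a 0) + (z b 2 - z b 0)) :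
    Q a b e * (Q b a e * Q a b e) = Q a b e := by
  have ha : z a 0 * Q a b e = (τ⁻¹ * k0.eval τ) • Q a b e := by
    have h1 := h.tl hab hab (h.zw a b 0) (h0 a b hab) e
    rw [mul_comm _ k0, h.eig he hab] at h1
    conv_lhs => rw [h.eX he hab, mul_smul_comm, h1, smul_smul]
  have hb : z b 0 * Q a b e = ((-τ)⁻¹ * k0.eval (-τ)) • Q a b e := by
    have h1 := h.tl hab.symm hab.symm (h.zw b a 0) (h0 b a hab.symm) (e.comp (-X))
    rw [mul_comm _ k0, h.eigs he hab] at h1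
    conv_lhs => rw [h.eXs he hab, mul_smul_comm, h1, smul_smul]
  have hY : ∀ x y, ((2:ℂ) • (z x 2 - z x 0)) * z y 0 = z y 0 * ((2:ℂ) • (z x 2 - z x 0)) := by
    intro x y; rw [smul_mul_assoc, mul_smul_comm, sub_mul, mul_sub, h.zw, h.zw]
  have ha2 : ((2:ℂ) • (z a 2 - z a 0)) * Q a b e = k1.eval τ • Q a b e := by
    have h1 := h.tl hab hab (hY a b) (h.yl a b hab) e
    rwa [mul_comm _ k1, h.eig he hab, mul_one] at h1
  have hb2 : ((2:ℂ) • (z b 2 - z b 0)) * Q a b e = k1.eval (-τ) • Q a b e := by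
    have h1 := h.tl hab.symm hab.symm (hY b a) (h.yl b a hab.symm) (e.comp (-X))
    rw [mul_comm _ k1, h.eigs he hab, mul_one] at h1
    have e2 : Q b a (e.comp (-X)) = Q a b e := by
      have := h.eigs he hab 1; simpa using this
    rwa [e2] at h1
  have hyy : Q a b 1 * (Q a b 1 * Q a b e) = 
      Q a b ((k0.eval τ * k0.eval (-τ) / (-τ^2) + k1.eval τ / 2 + k1.eval (-τ) / 2) • e) := by
    have f : z a 0 * z b 0 + (z a 2 - z a 0) + (z b 2 - z b 0) = z a 0 * z b 0 + (1/2:ℂ) • ((2:ℂ) • (z a 2 - z a 0))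
      + (1/2:ℂ) • ((2:ℂ) • (z b 2 - z b 0)) := by module
    rw [← mul_assoc, hsq, f, add_mul, add_mul, mul_assoc, hb, mul_smul_comm, ha, smul_mul_assoc (1/2:ℂ), smul_mul_assoc (1/2:ℂ), ha2, hb2, map_smul,
      smul_smul, smul_smul, smul_smul, ← add_smul, ← add_smul]
    congr 1
    have := he.ne
    field_simp
  -- `y E` commutes with `w_a`
  have hs1 : Q b a 1 = Q a b 1 := by rw [h.swap a b hab]; simp
  have hw : (Q a b 1 * Q a b e) * z a 0 = z a 0 * (Q a b 1 * Q a b e) := by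
    have e1 := h.L2' he hab X
    have e2 := h.xr hab.symm 1
    have e3 := h.xl a b hab e
    have e4 := h.eig he hab X
    rw [eval_X] at e1 e4
    rw [mul_one, hs1] at e2
    rw [e2, hs1, sub_mul] at e1
    rw [e4] at e3
    have e5 := congrArg (fun x => Q a b 1 * x) e3
    simp only [mul_smul_comm, smul_mul_assoc, mul_sub] at e5 e1
    rw [← e1] at e5
    have e6 : (1/2:ℂ) • (Q a b 1 * Q a b e * z a 0) = (1/2:ℂ) • (z a 0 * (Q a b 1 * Q a b e)) := by
      rw [mul_assoc] at e5 
      rw [mul_assoc (z a 0)] at e5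
      rw [mul_assoc]
      rw [sub_eq_sub_iff_sub_eq_sub, sub_self] at e5
      exact (sub_eq_zero.1 (by rw [← neg_sub, e5.symm, neg_zero]))
    exact smul_right_injective R (by norm_num : (1/2:ℂ) ≠ 0) e6
  have hfin := h.tr hab hab hw hyy e
  rw [mul_one, mul_smul_comm, ← smul_mul_assoc, smul_eq_C_mul, h.eig he hab] at hfin
  rw [h.L2' he hab e, hs1, mul_smul_comm, hfin, smul_smul]
  have hl := he.lam
  rw [eval_mul, eval_C]
  rw [show ∀ x y : ℂ, x * (y * x) = y * x^2 by intros; ring, hl, one_smul]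

end
end Zhu
end

section
namespace Zhu
open Filter Polynomial

/-- polynomial of `E^u` -/
noncomputable def eu : ℂ[X] := (5:ℂ) • bn 1 + (25:ℂ) • bn 2 + (36:ℂ) • bn 3 + (16:ℂ) • bn 4
/-- polynomial of `E^t` -/
noncomputable def et : ℂ[X] := (-16:ℂ) • ((3:ℂ) • bn 1 + (14:ℂ) • bn 2 + (19:ℂ) • bn 3 + (8:ℂ) • bn 4)

lemma eu_eval (x : ℂ) : eu.eval x = -(1/6)*x - (1/6)*x^2 + (2/3)*x^3 + (2/3)*x^4 := by
  simp [eu, bn]; ring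
lemma et_eval (x : ℂ) : et.eval x = (8/3)*x + (16/3)*x^2 - (8/3)*x^3 - (16/3)*x^4 := by
  simp [et, bn]; ring

lemma EPu : EP 1 eu where
  dvd := ⟨C (1/6), by apply Polynomial.funext; intro x; simp [eu_eval, mm]; ring⟩
  ne := one_ne_zero
  c3n := by simp [c3]
  c3p := by rw [eu_eval]; simp [c3]; norm_num
  en := by rw [eu_eval]; norm_num
  bez := ⟨C (328/4859) + C (-603/38872) * X + C (-153/38872) * X^2,
    C (1/2) + C (-4531/9718) * X + C (266/4859) * X^2 + C (102/4859) * X^3, by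
      apply Polynomial.funext; intro x; simp [k1, mm]; ring⟩
  lam := by rw [eu_eval]; simp [k0, k1]; norm_num

lemma EPt : EP (1/2) et where
  dvd := ⟨C (-4/3), by apply Polynomial.funext; intro x; simp [et_eval, mm]; ring⟩
  ne := by norm_num
  c3n := by simp [c3]
  c3p := by rw [et_eval]; simp [c3]; norm_num
  en := by rw [et_eval]; norm_num
  bez := ⟨C (59/226) + C (-424/1695) * X + C (-2/113) * X^2,
    C (32/15) + C (-5344/1695) * X + C (2048/1695) * X^2 + C (32/339) * X^3, by
      apply Polynomial.funext; intro x; simp [k1, mm]; ring⟩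
  lam := by rw [et_eval]; simp [k0, k1]; norm_num

section
variable {ℓ : ℕ} {R : Type} [Ring R] [Algebra ℂ R]

/-- off-diagonal matrix unit relations -/
structure MU (E : Fin ℓ → Fin ℓ → R) : Prop where
  m1 : ∀ a b c d, a ≠ b → c ≠ d → b ≠ c → E a b * E c d = 0
  m2 : ∀ a b d, a ≠ b → b ≠ d → a ≠ d → E a b * E b d = E a d
  m3 : ∀ a b, a ≠ b → E a b * (E b a * E a b) = E a b

/-- the full matrix units -/
def mu (p : Fin ℓ → Fin ℓ) (E : Fin ℓ → Fin ℓ → R) (a b : Fin ℓ) : R :=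
  if a = b then E a (p a) * E (p a) a else E a b

variable {E : Fin ℓ → Fin ℓ → R} {p : Fin ℓ → Fin ℓ}

lemma MU.diag (h : MU E) {a b c : Fin ℓ} (hb : b ≠ a) (hc : c ≠ a) : E a b * E b a = E a c * E c a := by
  by_cases hbc : b = c
  · rw [hbc]
  · rw [← h.m2 a c b hc.symm (Ne.symm hbc) hb.symm, mul_assoc, h.m2 c b a (Ne.symm hbc) hb hc]

lemma mu_ne {a b : Fin ℓ} (hab : a ≠ b) : mu p E a b = E a b := by rw [mu, if_neg hab]

lemma MU.mu_self (h : MU E) (hp : ∀ a, p a ≠ a) {a b : Fin ℓ} (hab : b ≠ a) : mu p E a a = E a b * E b a := by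
  rw [mu, if_pos rfl]; exact h.diag (hp a) hab

lemma MU.mul (h : MU E) (hp : ∀ a, p a ≠ a) (a b c d : Fin ℓ) :
    mu p E a b * mu p E c d = if b = c then mu p E a d else 0 := by
  by_cases hab : a = b
  · subst hab
    by_cases hcd : c = d
    · subst hcd
      split_ifs with hac
      · subst hac
        rw [h.mu_self hp (hp a), mul_assoc, h.m3 _ _ (hp a)]
      · rw [h.mu_self hp (hp a), h.mu_self hp (hp c), mul_assoc, ← mul_assoc (E (p a) a),
          h.m1 _ _ _ _ (hp a) (hp c).symm hac]; simp
    · rw [mu_ne hcd]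
      split_ifs with hac
      · subst hac
        rw [h.mu_self hp (Ne.symm hcd), mul_assoc, h.m3 _ _ hcd, mu_ne hcd]
      · rw [h.mu_self hp (hp a), mul_assoc, h.m1 _ _ _ _ (hp a) hcd hac, mul_zero]
  · rw [mu_ne hab]
    by_cases hcd : c = d
    · subst hcd
      split_ifs with hac
      · subst hac
        rw [h.mu_self hp hab, h.m3 _ _ hab, mu_ne hab]
      · rw [h.mu_self hp (hp c), ← mul_assoc, h.m1 _ _ _ _ hab (hp c).symm hac, zero_mul]
    · rw [mu_ne hcd]
      split_ifs with hbc
      · subst hbc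
        by_cases had : a = d
        · subst had; rw [h.mu_self hp hcd]
        · rw [h.m2 _ _ _ hab hcd had, mu_ne had]
      · exact h.m1 _ _ _ _ hab hcd hbc

/-- the span of the matrix units -/
def muS (p : Fin ℓ → Fin ℓ) (E : Fin ℓ → Fin ℓ → R) : Submodule ℂ R := Submodule.span ℂ {z | ∃ a b, z = mu p E a b}

lemma mu_mem (a b : Fin ℓ) : mu p E a b ∈ muS p E := Submodule.subset_span ⟨a, b, rfl⟩

lemma MU.mem_mul_r (h : MU E) (hp : ∀ a, p a ≠ a) {x : R} (hx : x ∈ muS p E) (c d : Fin ℓ) : x * mu p E c d ∈ muS p E := by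
  induction hx using Submodule.span_induction with
  | mem x hx => 
    obtain ⟨a, b, rfl⟩ := hx
    rw [h.mul hp]; split_ifs
    · exact mu_mem _ _
    · exact zero_mem _
  | zero => simp
  | add x y _ _ hx hy => rw [add_mul]; exact add_mem hx hy
  | smul r x _ hx => rw [smul_mul_assoc]; exact Submodule.smul_mem _ _ hx

lemma MU.mem_mul_l (h : MU E) (hp : ∀ a, p a ≠ a) {x : R} (hx : x ∈ muS p E) (c d : Fin ℓ) : mu p E c d * x ∈ muS p E := by
  induction hx using Submodule.span_induction with
  | mem x hx => 
    obtain ⟨a, b, rfl⟩ := hx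
    rw [h.mul hp]; split_ifs
    · exact mu_mem _ _
    · exact zero_mem _
  | zero => simp
  | add x y _ _ hx hy => rw [mul_add]; exact add_mem hx hy
  | smul r x _ hx => rw [mul_smul_comm]; exact Submodule.smul_mem _ _ hx

variable {T : Fin ℓ → Fin ℓ → ℕ → ℕ → R} {Wd : (Fin ℓ × ℕ) → (Fin ℓ × ℕ) → (Fin ℓ × ℕ) → (Fin ℓ × ℕ) → R}
 {τ : ℂ} {e : ℂ[X]}

lemma QData.closed {Q : Fin ℓ → Fin ℓ → ℂ[X] →ₗ[ℂ] R} {z : Fin ℓ → ℕ → R} (h : QData Q z) (he : EP τ e) (N : Submodule ℂ R)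
    (h1 : ∀ a b, a ≠ b → Q a b e ∈ N) (h2 : ∀ a b, a ≠ b → Q a b e * Q b a e ∈ N) {a b c d : Fin ℓ} (hab : a ≠ b) (hcd : c ≠ d)
    (q : ℂ[X]) : Q c d q * Q a b e ∈ N := by
  have key : ∀ {c : Fin ℓ} (q : ℂ[X]), c ≠ a → Q c a q * Q a b e ∈ N := by
    intro c q hca
    by_cases hcb : c = b
    · subst hcb
      rw [h.L2 he hab]; exact N.smul_mem _ (h2 _ _ hca)
    · rw [h.L1 he hab hca hcb]; exact N.smul_mem _ (h1 _ _ hcb)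
  by_cases hda : d = a
  · subst hda; exact key q hcd
  by_cases hca : c = a
  · subst hca; rw [h.swap d c hda]; exact key _ hda
  by_cases hdb : d = b
  · subst hdb; rw [h.L4 he hab hca hcd]; exact N.zero_mem
  by_cases hcb : c = b
  · subst hcb; rw [h.swap d c hdb, h.L4 he hab hda hdb]; exact N.zero_mem
  · rw [h.L5 he hab hca hcb hda hdb hcd]; exact N.zero_mem

theorem MU_of (D : RData T Wd) (he : EP τ e) : MU (fun a b => Xp T a b e) where
  m1 a b c d hab hcd hbc := (qdata D).killl he hcd hab hbc e he.en
  m2 a b d hab hbd had := by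
    rw [(qdata D).L1 he hbd hab had, mul_inv_cancel₀ he.e0, one_smul]
  m3 a b hab := (qdata D).EEE he hab (fun a b hab => z0_X D hab) (by
    rw [Xp_one]; exact sq_eq D hab)

theorem left_T (hp : ∀ a, p a ≠ a) (D : RData T Wd) (he : EP τ e) (c d : Fin ℓ) (i j : ℕ) (a b : Fin ℓ) :
    T c d i j * mu p (fun a b => Xp T a b e) a b ∈ muS p (fun a b => Xp T a b e) := by
  set E := (fun a b => Xp T a b e) with hE
  have hM : MU E := MU_of D he
  have h1 : ∀ a b, a ≠ b → E a b ∈ muS p E := fun a b hab => by rw [← mu_ne (p := p) (E := E) hab]; exact mu_mem _ _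
  have h2 : ∀ a b, a ≠ b → E a b * E b a ∈ muS p E := fun a b hab => by rw [← hM.mu_self hp hab.symm]; exact mu_mem _ _
  have key : ∀ {a b : Fin ℓ}, a ≠ b → T c d i j * E a b ∈ muS p E := by
    intro a b hab
    by_cases hcd : c = d
    · subst hcd
      have hT := Taa_mem D c i j
      generalize T c c i j = x at hT
      induction hT using Submodule.span_induction with
      | mem x hx => 
        obtain ⟨n, rfl⟩ := hx
        obtain ⟨r, hr⟩ := (qdata D).zE he hab c n
        rw [hr]; exact Submodule.smul_mem _ _ (h1 _ _ hab)
      | zero => simp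
      | add x y _ _ hx hy => rw [add_mul]; exact add_mem hx hy
      | smul r x _ hx => rw [smul_mul_assoc]; exact Submodule.smul_mem _ _ hx
    · obtain ⟨q, hq⟩ := T_mem D hcd i j
      rw [hq]; exact (qdata D).closed he _ h1 h2 hab hcd q
  by_cases hab : a = b
  · subst hab
    rw [hM.mu_self hp (hp a), ← mul_assoc]
    have := hM.mem_mul_r hp (key (hp a).symm) (p a) a
    rwa [mu_ne (hp a)] at this
  · rw [mu_ne hab]; exact key hab

theorem right_T (hp : ∀ a, p a ≠ a) (D : RData T Wd) (he : EP τ e) (c d : Fin ℓ) (i j : ℕ) (a b : Fin ℓ) :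
    mu p (fun a b => Xp T a b e) a b * T c d i j ∈ muS p (fun a b => Xp T a b e) := by
  set E := (fun a b => Xp T a b e) with hE
  have hM : MU E := MU_of D he
  have h1 : ∀ a b, a ≠ b → E a b ∈ muS p E := fun a b hab => by rw [← mu_ne (p := p) (E := E) hab]; exact mu_mem _ _
  have h2 : ∀ a b, a ≠ b → E a b * E b a ∈ muS p E := fun a b hab => by rw [← hM.mu_self hp hab.symm]; exact mu_mem _ _
  have key : ∀ {a b : Fin ℓ}, a ≠ b → E a b * T c d i j ∈ muS p E := by
    intro a b hab
    by_cases hcd : c = d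
    · subst hcd
      have hT := Taa_mem D c i j
      generalize T c c i j = x at hT
      induction hT using Submodule.span_induction with
      | mem x hx => 
        obtain ⟨n, rfl⟩ := hx
        obtain ⟨r, hr⟩ := (qdata D).opp.zE he hab.symm c n
        have hr' : E a b * T c c 0 n = r • E a b := MulOpposite.op_injective hr
        rw [hr']; exact Submodule.smul_mem _ _ (h1 _ _ hab)
      | zero => simp
      | add x y _ _ hx hy => rw [mul_add]; exact add_mem hx hy
      | smul r x _ hx => rw [mul_smul_comm]; exact Submodule.smul_mem _ _ hx
    · obtain ⟨q, hq⟩ := T_mem D hcd i j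
      rw [hq]
      have := (qdata D).opp.closed he ((muS p E).comap (MulOpposite.opLinearEquiv ℂ).symm.toLinearMap)
        (fun a b hab => h1 b a hab.symm) (fun a b hab => h2 a b hab) hab.symm (Ne.symm hcd) q
      exact this
  by_cases hab : a = b
  · subst hab
    rw [hM.mu_self hp (hp a), mul_assoc]
    have := hM.mem_mul_l hp (key (hp a)) a (p a)
    rwa [mu_ne (hp a).symm] at this
  · rw [mu_ne hab]; exact key hab

theorem left_ideal (hp : ∀ a, p a ≠ a) (D : RData T Wd) (he : EP τ e) (x : R) {y : R} (hy : y ∈ muS p (fun a b => Xp T a b e)) :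
    x * y ∈ muS p (fun a b => Xp T a b e) := by
  set N := muS p (fun a b => Xp T a b e)
  let P : Submodule ℂ R := 
    { carrier := {x | ∀ y ∈ N, x * y ∈ N}
      add_mem' := fun {u v} hu hv y hy => by rw [add_mul]; exact add_mem (hu y hy) (hv y hy)
      zero_mem' := fun y hy => by rw [zero_mul]; exact N.zero_mem
      smul_mem' := fun r u hu y hy => by rw [smul_mul_assoc]; exact N.smul_mem _ (hu y hy) }
  have hP : P = ⊤ := by
    apply D.gen
    · intro y hy; rwa [one_mul]
    · intro c d i j x hx y hy
      rw [mul_assoc]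
      have h2 := hx y hy
      generalize x * y = w at h2
      induction h2 using Submodule.span_induction with
      | mem x hx => 
        obtain ⟨a, b, rfl⟩ := hx
        exact left_T hp D he c d i j a b
      | zero => simp
      | add x y _ _ hx hy => rw [mul_add]; exact add_mem hx hy
      | smul r x _ hx => rw [mul_smul_comm]; exact Submodule.smul_mem _ _ hx
  have : x ∈ P := by rw [hP]; trivial
  exact this y hy

theorem right_ideal (hp : ∀ a, p a ≠ a) (D : RData T Wd) (he : EP τ e) (x : R) {y : R} (hy : y ∈ muS p (fun a b => Xp T a b e)) :
    y * x ∈ muS p (fun a b => Xp T a b e) := by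
  set N := muS p (fun a b => Xp T a b e)
  let P : Submodule ℂ R := 
    { carrier := {x | ∀ y ∈ N, y * x ∈ N}
      add_mem' := fun {u v} hu hv y hy => by rw [mul_add]; exact add_mem (hu y hy) (hv y hy)
      zero_mem' := fun y hy => by rw [mul_zero]; exact N.zero_mem
      smul_mem' := fun r u hu y hy => by rw [mul_smul_comm]; exact N.smul_mem _ (hu y hy) }
  have hP : P = ⊤ := by
    apply D.gen
    · intro y hy; rwa [mul_one]
    · intro c d i j x hx y hy
      rw [← mul_assoc]
      refine hx _ ?_
      induction hy using Submodule.span_induction with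
      | mem x hx => 
        obtain ⟨a, b, rfl⟩ := hx
        exact right_T hp D he c d i j a b
      | zero => simp
      | add x y _ _ hx hy => rw [add_mul]; exact add_mem hx hy
      | smul r x _ hx => rw [smul_mul_assoc]; exact Submodule.smul_mem _ _ hx
  have : x ∈ P := by rw [hP]; trivial
  exact this y hy

lemma mu_orth {F : Fin ℓ → Fin ℓ → R} (hp : ∀ a, p a ≠ a) (h : ∀ a b c d, a ≠ b → c ≠ d → E a b * F c d = 0) (a b c d : Fin ℓ) :
    mu p E a b * mu p F c d = 0 := by
  have h1 : ∀ a b c d, c ≠ d → mu p E a b * F c d = 0 := by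
    intro a b c d hcd
    by_cases hab : a = b
    · subst hab; rw [mu, if_pos rfl, mul_assoc, h _ _ _ _ (hp a) hcd, mul_zero]
    · rw [mu_ne hab]; exact h _ _ _ _ hab hcd
  by_cases hcd : c = d
  · subst hcd
    conv_lhs => rw [mu.eq_def p F, if_pos rfl, ← mul_assoc, h1 _ _ _ _ (hp c).symm, zero_mul]
  · rw [mu_ne hcd]; exact h1 _ _ _ _ hcd

theorem ut_orth (D : RData T Wd) (hp : ∀ a, p a ≠ a) (a b c d : Fin ℓ) :
    mu p (fun a b => Xp T a b eu) a b * mu p (fun a b => Xp T a b et) c d = 0 ∧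
    mu p (fun a b => Xp T a b et) c d * mu p (fun a b => Xp T a b eu) a b = 0 := by
  constructor
  · apply mu_orth hp
    intro a b c d hab hcd
    apply (qdata D).kill2 EPt hcd hab <;> rw [eu_eval] <;> norm_num
  · apply mu_orth hp
    intro a b c d hab hcd
    apply (qdata D).kill2 EPu hcd hab <;> rw [et_eval] <;> norm_num

/-- joint independence of two orthogonal families of matrix units -/
theorem mu_indep {F : Fin ℓ → Fin ℓ → R} (hp : ∀ a, p a ≠ a) (hE : MU E)
    (hEF : ∀ a b c d, mu p F a b * mu p E c d = 0) (hne : ∀ a b, a ≠ b → E a b ≠ 0) (cu ct : Fin ℓ → Fin ℓ → ℂ)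
    (h0 : (∑ a, ∑ b, cu a b • mu p E a b) + (∑ a, ∑ b, ct a b • mu p F a b) = 0) : cu = 0 := by
  funext a b
  have h1 := congrArg (fun x => mu p E (p b) a * (x * mu p E b b)) h0
  simp only [add_mul, Finset.sum_mul, smul_mul_assoc, hEF, hE.mul hp, smul_zero, Finset.sum_const_zero, add_zero,
    Finset.mul_sum, mul_smul_comm, zero_mul, mul_zero] at h1
  have h2 : cu a b • mu p E (p b) b = 0 := by
    rw [Finset.sum_eq_single a, Finset.sum_eq_single b] at h1
    · simpa [hE.mul hp] using h1
    · intro c _ hc; simp [hc]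
    · simp
    · intro c _ hc
      apply Finset.sum_eq_zero; intro d _
      by_cases hd : d = b
      · subst hd; simp [hE.mul hp, Ne.symm hc]
      · simp [hd]
    · simp
  rw [mu_ne (hp b)] at h2
  exact (smul_eq_zero.1 h2).resolve_right (hne _ _ (hp b))

end
end Zhu
end

section
namespace Zhu
open Filter

lemma cch_vm (x y : ℂ) (n : ℕ) : ∑ r ∈ Finset.range (n+1), cch x r * cch y (n-r) = cch (x+y) n := by
  rw [← Finset.Nat.sum_antidiagonal_eq_sum_range_succ (fun i j => cch x i * cch y j)]
  induction n with
  | zero => simp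
  | succ n ih =>
    have h0 : ((n:ℂ)+1) ≠ 0 := Nat.cast_add_one_ne_zero n
    apply mul_left_cancel₀ h0
    rw [cch_succ_mul, ← ih, Finset.mul_sum, Finset.sum_mul]
    have h1 : ∀ ij ∈ Finset.HasAntidiagonal.antidiagonal (n+1), ((n:ℂ)+1) * (cch x ij.1 * cch y ij.2) =
        ((ij.1:ℂ) * cch x ij.1) * cch y ij.2 + cch x ij.1 * ((ij.2:ℂ) * cch y ij.2) := by
      intro ij h
      have := Finset.HasAntidiagonal.mem_antidiagonal.1 h
      have h2 : ((n:ℂ)+1) = (ij.1:ℂ) + ij.2 := by exact_mod_cast this.symm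
      rw [h2]; ring
    rw [Finset.sum_congr rfl h1, Finset.sum_add_distrib]
    rw [Finset.Nat.sum_antidiagonal_succ, Finset.Nat.sum_antidiagonal_succ']
    simp only [Nat.cast_zero, zero_mul, mul_zero, add_zero, zero_add]
    rw [← Finset.sum_add_distrib]
    refine Finset.sum_congr rfl fun ij h => ?_
    have h2 : (n:ℂ) = (ij.1:ℂ) + ij.2 := by exact_mod_cast (Finset.HasAntidiagonal.mem_antidiagonal.1 h).symm
    push_cast
    rw [cch_succ_mul, cch_succ_mul, h2]; ring

/-- coefficients of `(1+y)^κ y^m` -/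
noncomputable def bb (κ : ℂ) (m p : ℤ) : ℂ := if m ≤ p then cch κ (p - m).toNat else 0

lemma bb_of (κ : ℂ) (m : ℤ) (r : ℕ) : bb κ m (m + r) = cch κ r := by
  rw [bb, if_pos (by omega)]; congr 1; omega

lemma bb_lt (κ : ℂ) {m p : ℤ} (h : p < m) : bb κ m p = 0 := by
  rw [bb, if_neg (by omega)]

lemma bb_pascal (κ : ℂ) (m p : ℤ) : bb (κ+1) m p = bb κ m p + bb κ m (p-1) := by
  by_cases h : p < m
  · rw [bb_lt _ h, bb_lt _ h, bb_lt _ (by omega), add_zero]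
  · obtain ⟨r, rfl⟩ : ∃ r : ℕ, p = m + r := ⟨(p-m).toNat, by omega⟩
    cases r with
    | zero => rw [bb_of, bb_of, bb_lt _ (by simp)]; simp
    | succ r =>
      rw [bb_of, bb_of, show m + ((r+1:ℕ):ℤ) - 1 = m + r by push_cast; ring, bb_of, cch_pascal]; ring

lemma bb_shift (κ : ℂ) (m p : ℤ) : bb κ m (p-1) = bb κ (m+1) p := by
  simp only [bb, show p - 1 - m = p - (m+1) by ring, show m ≤ p - 1 ↔ m + 1 ≤ p by omega]

lemma bb_euler (κ : ℂ) (m p : ℤ) : (p:ℂ) * bb κ m p = m * bb κ m p + κ * bb (κ-1) (m+1) p := by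
  by_cases h : p < m
  · rw [bb_lt _ h, bb_lt _ (by omega)]; ring
  · obtain ⟨r, rfl⟩ : ∃ r : ℕ, p = m + r := ⟨(p-m).toNat, by omega⟩
    cases r with
    | zero => rw [bb_of, bb_lt _ (by simp)]; simp
    | succ r =>
      rw [bb_of, show m + ((r+1:ℕ):ℤ) = (m+1) + r by push_cast; ring, bb_of, ← cch_succ']
      push_cast; ring

lemma bb_nat (n : ℕ) {m p : ℤ} (h : n + m < p) : bb n m p = 0 := by
  rw [bb]; split_ifs
  · rw [cch_natCast, Nat.choose_eq_zero_of_lt (by omega)]; simp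
  · rfl

lemma bs_bb (w : ℕ) (κ : ℂ) (m c N : ℤ) : bs w (fun n => bb κ m (c-n)) N = bb (κ+w) m (c-N) := by
  induction w generalizing N with
  | zero => simp
  | succ w ih =>
    rw [bs_succ, ih, ih]; push_cast
    rw [← add_assoc, bb_pascal, show c - (N+1) = c - N - 1 by ring]

/-- `(1+y)^κ` times Laurent polynomials of degree at most `d` -/
def Cl (κ : ℂ) (d : ℤ) : Submodule ℂ (ℤ → ℂ) := Submodule.span ℂ {f | ∃ m ≤ d, f = bb κ m}

lemma bb_mem {κ : ℂ} {d m : ℤ} (h : m ≤ d) : bb κ m ∈ Cl κ d := Submodule.subset_span ⟨m, h, rfl⟩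

lemma Cl_mono {κ : ℂ} {d d' : ℤ} (h : d ≤ d') : Cl κ d ≤ Cl κ d' := by
  refine Submodule.span_mono ?_
  rintro f ⟨m, hm, rfl⟩; exact ⟨m, by omega, rfl⟩

lemma Cl_sub (κ : ℂ) (d : ℤ) : Cl κ d ≤ Cl (κ-1) (d+1) := by
  refine Submodule.span_le.2 ?_
  rintro f ⟨m, hm, rfl⟩
  have : bb κ m = bb (κ-1) m + bb (κ-1) (m+1) := by
    funext p
    have := bb_pascal (κ-1) m p
    rw [sub_add_cancel] at this
    rw [this, bb_shift]; rfl
  rw [this]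
  exact add_mem (bb_mem (by omega)) (bb_mem (by omega))

lemma Cl_euler {κ : ℂ} {d : ℤ} (c : ℂ) {f : ℤ → ℂ} (hf : f ∈ Cl κ d) : (fun p : ℤ => ((p:ℂ) - c) * f p) ∈ Cl (κ-1) (d+1) := by
  induction hf using Submodule.span_induction with
  | mem x hx =>
    obtain ⟨m, hm, rfl⟩ := hx
    have : (fun p : ℤ => ((p:ℂ) - c) * bb κ m p) = ((m:ℂ) - c) • bb κ m + κ • bb (κ-1) (m+1) := by
      funext p
      simp only [sub_mul, bb_euler, Pi.add_apply, Pi.smul_apply, smul_eq_mul]; ring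
    rw [this]
    exact add_mem (Submodule.smul_mem _ _ (Cl_sub _ _ (bb_mem hm))) (Submodule.smul_mem _ _ (bb_mem (by omega)))
  | zero => simp only [Pi.zero_apply, mul_zero]; exact Submodule.zero_mem _
  | add x y _ _ hx hy =>
    convert add_mem hx hy using 1
    funext p; simp [mul_add]
  | smul r x _ hx =>
    convert Submodule.smul_mem _ r hx using 1
    funext p; simp; ring

lemma Cl_theta {κ : ℂ} {d : ℤ} {f : ℤ → ℂ} (hf : f ∈ Cl κ d) (i : ℕ) : (fun p : ℤ => cch p i * f p) ∈ Cl (κ-i) (d+i) := by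
  induction i with
  | zero => simpa using hf
  | succ i ih =>
    have h0 : ((i:ℂ)+1) ≠ 0 := Nat.cast_add_one_ne_zero i
    have := Submodule.smul_mem _ (((i:ℂ)+1)⁻¹) (Cl_euler (i:ℂ) ih)
    convert this using 1
    · congr 1
      · push_cast; ring
      · push_cast; ring
    · funext p
      rw [cch_succ]
      simp; field_simp

/-- `h` is the convolution of `f` and `g` -/
def CV (f g h : ℤ → ℂ) : Prop := ∀ M : ℤ, ∀ᶠ K : ℕ in atTop, ∑ p ∈ Finset.Ico (-(K:ℤ)) K, f p * g (M-p) = h M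

lemma CV_bb (κ κ' : ℂ) (m m' : ℤ) : CV (bb κ m) (bb κ' m') (bb (κ+κ') (m+m')) := by
  intro M
  filter_upwards [eventually_ge_atTop (m.natAbs + m'.natAbs + M.natAbs + 1)] with K hK
  by_cases h : M < m + m'
  · rw [bb_lt _ h]
    refine Finset.sum_eq_zero fun p _ => ?_
    by_cases hp : p < m
    · rw [bb_lt _ hp, zero_mul]
    · rw [bb_lt _ (show M - p < m' by omega), mul_zero]
  · obtain ⟨n, rfl⟩ : ∃ n : ℕ, M = (m+m') + n := ⟨(M-m-m').toNat, by omega⟩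
    rw [bb_of, ← cch_vm]
    symm
    refine Finset.sum_of_injOn (fun r : ℕ => m + (r:ℤ)) (fun a _ b _ h => by simpa using h) ?_ ?_ ?_
    · intro r hr
      simp only [Finset.coe_range, Set.mem_Iio] at hr
      simp only [Finset.coe_Ico, Set.mem_Ico]; omega
    · intro p _ hp
      by_cases hp1 : p < m
      · rw [bb_lt _ hp1, zero_mul]
      · rw [bb_lt _ (m := m'), mul_zero]
        by_contra h2
        apply hp
        refine ⟨(p-m).toNat, ?_, ?_⟩
        · simp; omega
        · simp; omega
    · intro r hr
      simp only [Finset.mem_range] at hr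
      rw [bb_of, show m + m' + (n:ℤ) - (m + r) = m' + ((n - r : ℕ):ℤ) by omega, bb_of]

lemma CV_add_l {f f' g h h' : ℤ → ℂ} (H : CV f g h) (H' : CV f' g h') : CV (f + f') g (h+h') := by
  intro M
  filter_upwards [H M, H' M] with K h1 h2
  simp only [Pi.add_apply, add_mul, Finset.sum_add_distrib, h1, h2]

lemma CV_add_r {f g g' h h' : ℤ → ℂ} (H : CV f g h) (H' : CV f g' h') : CV f (g+g') (h+h') := by
  intro M
  filter_upwards [H M, H' M] with K h1 h2
  simp only [Pi.add_apply, mul_add, Finset.sum_add_distrib, h1, h2]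

lemma CV_smul_l {f g h : ℤ → ℂ} (r : ℂ) (H : CV f g h) : CV (r • f) g (r • h) := by
  intro M
  filter_upwards [H M] with K h1
  simp only [Pi.smul_apply, smul_eq_mul, mul_assoc, ← Finset.mul_sum, h1]

lemma CV_smul_r {f g h : ℤ → ℂ} (r : ℂ) (H : CV f g h) : CV f (r • g) (r • h) := by
  intro M
  filter_upwards [H M] with K h1
  simp only [Pi.smul_apply, smul_eq_mul, mul_left_comm _ r, ← Finset.mul_sum, h1]

lemma CV_Cl {κ κ' : ℂ} {d d' : ℤ} {f g : ℤ → ℂ} (hf : f ∈ Cl κ d) (hg : g ∈ Cl κ' d') :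
    ∃ h ∈ Cl (κ+κ') (d+d'), CV f g h := by
  induction hf using Submodule.span_induction with
  | mem f hf =>
    obtain ⟨m, hm, rfl⟩ := hf
    induction hg using Submodule.span_induction with
    | mem g hg =>
      obtain ⟨m', hm', rfl⟩ := hg
      exact ⟨_, bb_mem (by omega), CV_bb κ κ' m m'⟩
    | zero => exact ⟨0, Submodule.zero_mem _, fun M => by simp⟩
    | add x y _ _ hx hy =>
      obtain ⟨h, h1, h2⟩ := hx
      obtain ⟨h', h1', h2'⟩ := hy
      exact ⟨_, add_mem h1 h1', CV_add_r h2 h2'⟩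
    | smul r x _ hx =>
      obtain ⟨h, h1, h2⟩ := hx
      exact ⟨_, Submodule.smul_mem _ r h1, CV_smul_r r h2⟩
  | zero => exact ⟨0, Submodule.zero_mem _, fun M => by simp⟩
  | add x y _ _ hx hy =>
    obtain ⟨h, h1, h2⟩ := hx
    obtain ⟨h', h1', h2'⟩ := hy
    exact ⟨_, add_mem h1 h1', CV_add_l h2 h2'⟩
  | smul r x _ hx =>
    obtain ⟨h, h1, h2⟩ := hx
    exact ⟨_, Submodule.smul_mem _ r h1, CV_smul_l r h2⟩

lemma bs_add_fun (w : ℕ) (f g : ℤ → ℂ) (N : ℤ) : bs w (fun n => f n + g n) N = bs w f N + bs w g N := by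
  simp [bs_eq, mul_add, Finset.sum_add_distrib]

lemma bs_smul_fun (w : ℕ) (r : ℂ) (f : ℤ → ℂ) (N : ℤ) : bs w (fun n => r * f n) N = r * bs w f N := by
  simp only [bs_eq, Finset.mul_sum, smul_eq_mul]
  exact Finset.sum_congr rfl fun i _ => by ring

lemma Cl_vanish {κ : ℂ} {d : ℤ} {h : ℤ → ℂ} (hh : h ∈ Cl κ d) (w n : ℕ) (hw : κ + w = n) (c N : ℤ) (hc : n + d < c - N) :
    bs w (fun k => h (c-k)) N = 0 := by
  induction hh using Submodule.span_induction with
  | mem f hf =>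
    obtain ⟨m, hm, rfl⟩ := hf
    rw [bs_bb, hw, bb_nat _ (by omega)]
  | zero => simp [bs_eq]
  | add x y _ _ hx hy =>
    simp only [Pi.add_apply]; rw [bs_add_fun, hx, hy, add_zero]
  | smul r x _ hx =>
    simp only [Pi.smul_apply, smul_eq_mul]; rw [bs_smul_fun, hx, mul_zero]

/-- two-variable sequences whose derivatives on the diagonal have the vanishing property -/
def HG : Submodule ℂ (ℤ → ℤ → ℂ) where
  carrier := {B | ∀ i j : ℕ, ∃ h : ℤ → ℂ, (∀ M : ℤ, ∀ᶠ K : ℕ in atTop, 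
      ∑ p ∈ Finset.Ico (-(K:ℤ)) K, cch (p:ℂ) i * cch ((M-p:ℤ):ℂ) j * B p (M-p) = h M) ∧
      ∀ N : ℤ, N ≤ -2 → bs (i+j+2) (fun n => h ((i:ℤ)+j-1-n)) N = 0}
  zero_mem' := fun i j => ⟨0, fun M => by simp, fun N _ => by simp [bs_eq]⟩
  add_mem' := by
    intro B B' hB hB' i j
    obtain ⟨h, h1, h2⟩ := hB i j
    obtain ⟨h', h1', h2'⟩ := hB' i j
    refine ⟨fun M => h M + h' M, fun M => ?_, fun N hN => ?_⟩
    · filter_upwards [h1 M, h1' M] with K e e'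
      simp only [Pi.add_apply, mul_add, Finset.sum_add_distrib, e, e']
    · rw [bs_add_fun, h2 N hN, h2' N hN, add_zero]
  smul_mem' := by
    intro r B hB i j
    obtain ⟨h, h1, h2⟩ := hB i j
    refine ⟨fun M => r * h M, fun M => ?_, fun N hN => ?_⟩
    · filter_upwards [h1 M] with K e
      simp only [Pi.smul_apply, smul_eq_mul, mul_left_comm _ r, ← Finset.mul_sum, e]
    · rw [bs_smul_fun, h2 N hN, mul_zero]

lemma HG_mul {κ κ' : ℂ} {d d' : ℤ} {f g : ℤ → ℂ} (hf : f ∈ Cl κ d) (hg : g ∈ Cl κ' d') (n : ℕ) (hn : κ + κ' + 2 = n)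
    (hd : n + d + d' ≤ 0) : (fun p q => f p * g q) ∈ HG := by
  intro i j
  obtain ⟨h, h1, h2⟩ := CV_Cl (Cl_theta hf i) (Cl_theta hg j)
  refine ⟨h, fun M => ?_, fun N hN => ?_⟩
  · filter_upwards [h2 M] with K e
    rw [← e]; exact Finset.sum_congr rfl fun p _ => by ring
  · refine Cl_vanish h1 _ n ?_ _ _ (by omega)
    rw [← hn]; push_cast; ring

/-- homogeneity of the covariance -/
def Hom (C : ℕ → ℕ → ℂ) : Prop := ∀ i k : ℕ, ((i:ℂ)+1) * C (i+1) k + ((k:ℂ)+1) * C i (k+1) + ((i:ℂ)+k+2) * C i k = 0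

lemma diag_rec {C : ℕ → ℕ → ℂ} (hC : Hom C) (i j n : ℕ) :
    ((n:ℂ)+1-i-j) * (∑ x ∈ Finset.HasAntidiagonal.antidiagonal (n+1), cch (x.1:ℂ) i * cch (x.2:ℂ) j * C x.1 x.2) +
    ((n:ℂ)+2) * (∑ x ∈ Finset.HasAntidiagonal.antidiagonal n, cch (x.1:ℂ) i * cch (x.2:ℂ) j * C x.1 x.2) = 0 := by
  have hs : ∀ (p i : ℕ), ((p:ℂ)+1-i) * cch ((p:ℂ)+1) i = (p+1) * cch p i := by
    intro p i
    have h1 := cch_succ_mul ((p:ℂ)+1) i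
    have h2 := cch_succ' ((p:ℂ)+1) i
    rw [add_sub_cancel_right] at h2
    rw [← h2, h1]; ring
  have h1 : ∀ x ∈ Finset.HasAntidiagonal.antidiagonal (n+1), ((n:ℂ)+1-i-j) * (cch (x.1:ℂ) i * cch (x.2:ℂ) j * C x.1 x.2) =
      (((x.1:ℂ)-i) * cch (x.1:ℂ) i) * cch (x.2:ℂ) j * C x.1 x.2 + cch (x.1:ℂ) i * (((x.2:ℂ) - j) * cch (x.2:ℂ) j) * C x.1 x.2 := by
    intro x hx
    have h2 : ((n:ℂ)+1) = (x.1:ℂ) + x.2 := by exact_mod_cast (Finset.HasAntidiagonal.mem_antidiagonal.1 hx).symm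
    rw [h2]; ring
  have h0 : ∀ i : ℕ, ((0:ℂ) - i) * cch 0 i = 0 := by
    intro i; cases i with
    | zero => simp
    | succ i => have := cch_natCast 0 (i+1); simp at this; simp [this]
  rw [Finset.mul_sum, Finset.sum_congr rfl h1, Finset.sum_add_distrib, Finset.Nat.sum_antidiagonal_succ,
    Finset.Nat.sum_antidiagonal_succ']
  simp only [Nat.cast_zero, h0, zero_mul, mul_zero, add_zero, zero_add]
  rw [← Finset.sum_add_distrib, Finset.mul_sum, ← Finset.sum_add_distrib]
  refine Finset.sum_eq_zero fun x hx => ?_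
  have h2 : (n:ℂ) = (x.1:ℂ) + x.2 := by exact_mod_cast (Finset.HasAntidiagonal.mem_antidiagonal.1 hx).symm
  push_cast
  rw [hs, hs, h2]
  linear_combination (cch (x.1:ℂ) i * cch (x.2:ℂ) j) * hC x.1 x.2

lemma HG_diag {C : ℕ → ℕ → ℂ} (hC : Hom C) :
    (fun p q : ℤ => if 0 ≤ p ∧ 0 ≤ q then C p.toNat q.toNat else 0) ∈ HG := by
  intro i j
  set Dn : ℕ → ℂ := fun n => ∑ x ∈ Finset.HasAntidiagonal.antidiagonal n, cch (x.1:ℂ) i * cch (x.2:ℂ) j * C x.1 x.2 with hDn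
  have hz : ∀ n < i + j, Dn n = 0 := by
    intro n hn
    refine Finset.sum_eq_zero fun x hx => ?_
    have := Finset.HasAntidiagonal.mem_antidiagonal.1 hx
    rw [cch_natCast, cch_natCast]
    by_cases h : x.1 < i
    · rw [Nat.choose_eq_zero_of_lt h]; simp
    · rw [Nat.choose_eq_zero_of_lt (show x.2 < j by omega)]; simp
  have hr : ∀ r : ℕ, Dn (i+j+r) = Dn (i+j) * cch (-((i:ℂ)+j+2)) r := by
    intro r
    induction r with
    | zero => simp
    | succ r ih =>
      have h0 : ((r:ℂ)+1) ≠ 0 := Nat.cast_add_one_ne_zero r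
      have := diag_rec hC i j (i+j+r)
      apply mul_left_cancel₀ h0
      rw [mul_left_comm, cch_succ_mul]
      change _ * Dn (i+j+r+1) + _ * Dn (i+j+r) = 0 at this
      rw [ih] at this
      rw [← add_assoc]
      push_cast at this
      linear_combination this
  refine ⟨Dn (i+j) • bb (-((i:ℂ)+j+2)) ((i:ℤ)+j), fun M => ?_, fun N hN => ?_⟩
  · filter_upwards [eventually_ge_atTop (M.natAbs + 1)] with K hK
    have hM : ∑ p ∈ Finset.Ico (-(K:ℤ)) K, cch (p:ℂ) i * cch ((M-p:ℤ):ℂ) j * (if 0 ≤ p ∧ 0 ≤ M - p then C p.toNat (M-p).toNat else 0)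
        = if 0 ≤ M then Dn M.toNat else 0 := by
      split_ifs with h
      · lift M to ℕ using h
        rw [hDn]
        simp only [Int.toNat_natCast]
        symm
        refine Finset.sum_of_injOn (fun x : ℕ × ℕ => (x.1:ℤ)) ?_ ?_ ?_ ?_
        · rintro ⟨a, b⟩ ha ⟨a', b'⟩ ha' h
          simp at ha ha' h
          simp; omega
        · intro x hx
          simp at hx
          simp; omega
        · intro p _ hp
          rw [if_neg, mul_zero]
          rintro ⟨h1, h2⟩
          apply hp
          refine ⟨(p.toNat, (M - p).toNat), ?_, ?_⟩
          · simp; omega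
          · simp; omega
        · intro x hx
          have hx := Finset.HasAntidiagonal.mem_antidiagonal.1 hx
          have e : (M:ℤ) - x.1 = (x.2:ℕ) := by omega
          rw [if_pos (by omega), e]
          simp
      · refine Finset.sum_eq_zero fun p _ => ?_
        rw [if_neg (by omega), mul_zero]
    rw [hM]
    simp only [Pi.smul_apply, smul_eq_mul]
    split_ifs with h
    · lift M to ℕ using h
      by_cases h2 : M < i + j
      · rw [Int.toNat_natCast, hz _ h2, bb_lt _ (by omega), mul_zero]
      · obtain ⟨r, rfl⟩ : ∃ r, M = i + j + r := ⟨M - (i+j), by omega⟩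
        rw [Int.toNat_natCast, hr, show (((i+j+r:ℕ)):ℤ) = ((i:ℤ)+j) + r by push_cast; ring, bb_of]
    · rw [bb_lt _ (by omega), mul_zero]
  · refine Cl_vanish (Submodule.smul_mem _ _ (bb_mem le_rfl)) _ 0 ?_ _ _ ?_
    · push_cast; ring
    · push_cast; omega

end Zhu
end

section
namespace Zhu
open Filter

section lsum
variable {U : Type} [AddCommGroup U] [Module ℂ U]

/-- locally finite families of operators -/
def LF (D : ℕ → Module.End ℂ U) : Prop := ∀ v, ∃ K, ∀ k ≥ K, D k v = 0

/-- sum of a locally finite family -/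
noncomputable def lsum (D : ℕ → Module.End ℂ U) (hD : LF D) : Module.End ℂ U where
  toFun v := ∑ᶠ k, D k v
  map_add' u v := by
    obtain ⟨K1, h1⟩ := hD u
    obtain ⟨K2, h2⟩ := hD v
    have e1 := finsum_eventually (fun k => D k u) K1 h1
    have e2 := finsum_eventually (fun k => D k v) K2 h2
    have e3 := finsum_eventually (fun k => D k (u+v)) (max K1 K2) (fun k hk => by
      rw [map_add, h1 k (le_trans (le_max_left _ _) hk), h2 k (le_trans (le_max_right _ _) hk), add_zero])
    obtain ⟨K, a, b, c⟩ := (e1.and (e2.and e3)).exists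
    rw [a, b, c, ← Finset.sum_add_distrib]
    simp
  map_smul' r v := by
    obtain ⟨K2, h2⟩ := hD v
    have e2 := finsum_eventually (fun k => D k v) K2 h2
    have e3 := finsum_eventually (fun k => D k (r • v)) K2 (fun k hk => by
      rw [map_smul, h2 k hk, smul_zero])
    obtain ⟨K, b, c⟩ := (e2.and e3).exists
    simp only [RingHom.id_apply]
    rw [b, c, Finset.smul_sum]
    simp

lemma lsum_ev (D : ℕ → Module.End ℂ U) (hD : LF D) (v : U) :
    ∀ᶠ K in atTop, lsum D hD v = ∑ k ∈ Finset.range K, D k v := by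
  obtain ⟨K, h⟩ := hD v
  exact finsum_eventually (fun k => D k v) K h

lemma lsum_eq (D : ℕ → Module.End ℂ U) (hD : LF D) (v : U) (K : ℕ) (h : ∀ k ≥ K, D k v = 0) :
    lsum D hD v = ∑ k ∈ Finset.range K, D k v := by
  obtain ⟨K', h1, h2⟩ := ((lsum_ev D hD v).and (eventually_ge_atTop K)).exists
  rw [h1]
  symm
  refine Finset.sum_subset (by simpa using h2) fun k _ hk => h k (by simpa using hk)

lemma lsum_comm (D : ℕ → Module.End ℂ U) (hD : LF D) (B : Module.End ℂ U) (v : U) (h : ∀ k, B (D k v) = D k (B v)) :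
    B (lsum D hD v) = lsum D hD (B v) := by
  obtain ⟨K, h1, h2⟩ := ((lsum_ev D hD v).and (lsum_ev D hD (B v))).exists
  rw [h1, h2, map_sum]
  exact Finset.sum_congr rfl fun k _ => h k

lemma lsum_mem (D : ℕ → Module.End ℂ U) (hD : LF D) (P : Submodule ℂ U) (v : U) (h : ∀ k, D k v ∈ P) :
    lsum D hD v ∈ P := by
  obtain ⟨K, h1⟩ := (lsum_ev D hD v).exists
  rw [h1]; exact Submodule.sum_mem _ fun k _ => h k

end lsum

/-- abstract Fock space -/
structure Fock {U : Type} [AddCommGroup U] [Module ℂ U] {ℓ : ℕ} (x d : Fin ℓ → ℕ → Module.End ℂ U) (one : U) : Prop where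
  dx : ∀ a b i j v, d a i (x b j v) = x b j (d a i v) + (if a = b ∧ i = j then (1:ℂ) else 0) • v
  dd : ∀ a b i j v, d a i (d b j v) = d b j (d a i v)
  d1 : ∀ a i, d a i one = 0
  lf : ∀ a, LF (d a)
  ind : ∀ P : Submodule ℂ U, one ∈ P → (∀ a i v, v ∈ P → x a i v ∈ P) → P = ⊤

section fock
variable {U : Type} [AddCommGroup U] [Module ℂ U] {ℓ : ℕ} {x d : Fin ℓ → ℕ → Module.End ℂ U} {one : U}

lemma Fock.lfs (H : Fock x d one) (a : Fin ℓ) (γ : ℕ → ℂ) : LF (fun k => γ k • d a k) := fun v => by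
  obtain ⟨K, h⟩ := H.lf a v
  exact ⟨K, fun k hk => by simp [h k hk]⟩

/-- `∑ γ_k d_{a,k}` -/
noncomputable def Fock.ann (H : Fock x d one) (a : Fin ℓ) (γ : ℕ → ℂ) : Module.End ℂ U :=
  lsum (fun k => γ k • d a k) (H.lfs a γ)

lemma Fock.ann_eq (H : Fock x d one) (a : Fin ℓ) (γ : ℕ → ℂ) (v : U) (K : ℕ) (h : ∀ k ≥ K, d a k v = 0) :
    H.ann a γ v = ∑ k ∈ Finset.range K, γ k • d a k v := by
  rw [Fock.ann, lsum_eq _ _ _ K]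
  · simp
  · intro k hk; simp [h k hk]

lemma Fock.d_ann (H : Fock x d one) (a b : Fin ℓ) (γ : ℕ → ℂ) (k : ℕ) (v : U) :
    d b k (H.ann a γ v) = H.ann a γ (d b k v) := 
  lsum_comm _ _ _ _ fun l => by simp [H.dd b a k l]

lemma Fock.ann_ann (H : Fock x d one) (a b : Fin ℓ) (γ δ : ℕ → ℂ) (v : U) :
    H.ann b δ (H.ann a γ v) = H.ann a γ (H.ann b δ v) := 
  lsum_comm _ _ _ _ fun l => by simp [H.d_ann]

lemma Fock.ann_x (H : Fock x d one) (a b : Fin ℓ) (γ : ℕ → ℂ) (j : ℕ) (v : U) :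
    H.ann a γ (x b j v) = x b j (H.ann a γ v) + (if a = b then γ j else 0) • v := by
  obtain ⟨K, h1, h2, h3⟩ := ((lsum_ev _ (H.lfs a γ) (x b j v)).and ((lsum_ev _ (H.lfs a γ) v).and
    (eventually_gt_atTop j))).exists
  rw [Fock.ann, h1, h2, map_sum]
  simp only [LinearMap.smul_apply, H.dx, smul_add, Finset.sum_add_distrib, map_smul]
  congr 1
  rw [Finset.sum_eq_single_of_mem j (by simpa using h3) (fun i _ hi => by simp [hi])]
  by_cases h : a = b <;> simp [h]

lemma Fock.ann_one (H : Fock x d one) (a : Fin ℓ) (γ : ℕ → ℂ) : H.ann a γ one = 0 := by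
  rw [H.ann_eq a γ one 0 (fun k _ => H.d1 a k)]; simp

lemma Fock.lfΔ (H : Fock x d one) (C : ℕ → ℕ → ℂ) (a : Fin ℓ) : LF (fun k => H.ann a (C k) * d a k) := fun v => by
  obtain ⟨K, h⟩ := H.lf a v
  exact ⟨K, fun k hk => by simp [h k hk]⟩

/-- the Laplacian of the covariance `C` -/
noncomputable def Fock.Δ (H : Fock x d one) (C : ℕ → ℕ → ℂ) : Module.End ℂ U :=
  (1/2:ℂ) • ∑ a, lsum _ (H.lfΔ C a)

lemma Fock.Δ_ann (H : Fock x d one) (C : ℕ → ℕ → ℂ) (a : Fin ℓ) (γ : ℕ → ℂ) (v : U) :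
    H.ann a γ (H.Δ C v) = H.Δ C (H.ann a γ v) := by
  simp only [Fock.Δ, LinearMap.smul_apply, LinearMap.sum_apply, map_smul, map_sum]
  congr 1
  refine Finset.sum_congr rfl fun b _ => lsum_comm _ _ _ _ fun k => ?_
  simp [H.ann_ann a b, H.d_ann]

lemma Fock.Δ_x (H : Fock x d one) (C : ℕ → ℕ → ℂ) (hC : ∀ i j, C i j = C j i) (b : Fin ℓ) (j : ℕ) (v : U) :
    H.Δ C (x b j v) = x b j (H.Δ C v) + H.ann b (C j) v := by
  have key : ∀ a, lsum _ (H.lfΔ C a) (x b j v) = x b j (lsum _ (H.lfΔ C a) v) + (if a = b then (2:ℂ) else 0) • H.ann b (C j) v := by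
    intro a
    obtain ⟨K, h1, h2, h3, h4⟩ := ((lsum_ev _ (H.lfΔ C a) (x b j v)).and ((lsum_ev _ (H.lfΔ C a) v).and
      ((eventually_gt_atTop j).and (lsum_ev _ (H.lfs b (C j)) v)))).exists
    rw [h1, h2, map_sum]
    simp only [Module.End.mul_apply, H.dx, map_add, map_smul, H.ann_x, Finset.sum_add_distrib, add_assoc]
    congr 1
    rw [Finset.sum_eq_single_of_mem (f := fun i => (if a = b ∧ i = j then (1:ℂ) else 0) • H.ann a (C i) v)
      j (by simpa using h3) (fun i _ hi => by simp [hi])]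
    by_cases h : a = b
    · subst h
      simp only [if_true, and_self, one_smul, two_smul]
      congr 1
      rw [Fock.ann, h4]
      exact Finset.sum_congr rfl fun i _ => by simp [hC i j]
    · simp [h]
  simp only [Fock.Δ, LinearMap.smul_apply, LinearMap.sum_apply, map_smul, map_sum, key, Finset.sum_add_distrib,
    smul_add]
  congr 1
  rw [← Finset.sum_smul, smul_smul]
  simp

/-- word length filtration -/
def wl (x : Fin ℓ → ℕ → Module.End ℂ U) (one : U) : ℕ → Submodule ℂ U
  | 0 => ⊥
  | n+1 => Submodule.span ℂ ({one} ∪ {w | ∃ a i, ∃ v ∈ wl x one n, w = x a i v})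

lemma wl_one (n : ℕ) : one ∈ wl x one (n+1) := Submodule.subset_span (Or.inl rfl)

lemma wl_x (n : ℕ) (a : Fin ℓ) (i : ℕ) {v : U} (hv : v ∈ wl x one n) : x a i v ∈ wl x one (n+1) :=
  Submodule.subset_span (Or.inr ⟨a, i, v, hv, rfl⟩)

lemma wl_mono (n : ℕ) : wl x one n ≤ wl x one (n+1) := by
  induction n with
  | zero => exact bot_le
  | succ n ih =>
    rw [wl]
    refine Submodule.span_le.2 ?_
    rintro w (rfl | ⟨a, i, v, hv, rfl⟩)
    · exact wl_one _
    · exact wl_x _ _ _ (ih hv)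

lemma Fock.wl_d (H : Fock x d one) (a : Fin ℓ) (i n : ℕ) {v : U} (hv : v ∈ wl x one (n+1)) : d a i v ∈ wl x one n := by
  induction n generalizing v with
  | zero =>
    have : wl x one 1 ≤ (wl x one 0).comap (d a i) := by
      refine Submodule.span_le.2 ?_
      rintro w (rfl | ⟨b, j, v, hv, rfl⟩)
      · simp [H.d1]
      · have : v = 0 := by simpa [wl] using hv
        simp [this]
    exact this hv
  | succ n ih =>
    have : wl x one (n+2) ≤ (wl x one (n+1)).comap (d a i) := by
      refine Submodule.span_le.2 ?_
      rintro w (rfl | ⟨b, j, v, hv, rfl⟩)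
      · simp [H.d1]
      · simp only [SetLike.mem_coe, Submodule.mem_comap, H.dx]
        exact add_mem (wl_x _ _ _ (ih hv)) (Submodule.smul_mem _ _ hv)
    exact this hv

lemma Fock.wl_Δ (H : Fock x d one) (C : ℕ → ℕ → ℂ) (n : ℕ) {v : U} (hv : v ∈ wl x one (n+1)) : H.Δ C v ∈ wl x one n := by
  simp only [Fock.Δ, LinearMap.smul_apply, LinearMap.sum_apply]
  refine Submodule.smul_mem _ _ (Submodule.sum_mem _ fun a _ => lsum_mem _ _ _ _ fun k => ?_)
  refine lsum_mem (fun l => C k l • d a l) (H.lfs a (C k)) _ _ fun l => ?_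
  refine Submodule.smul_mem _ _ (H.wl_d a l n (wl_mono _ (H.wl_d a k n hv)))

lemma Fock.wl_top (H : Fock x d one) (v : U) : ∃ n, v ∈ wl x one n := by
  have hm : Monotone (wl x one) := monotone_nat_of_le_succ wl_mono
  let P : Submodule ℂ U := 
    { carrier := {v | ∃ n, v ∈ wl x one n}
      zero_mem' := ⟨0, Submodule.zero_mem _⟩
      add_mem' := by
        rintro a b ⟨n, hn⟩ ⟨m, hm'⟩
        exact ⟨max n m, add_mem (hm (le_max_left _ _) hn) (hm (le_max_right _ _) hm')⟩
      smul_mem' := by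
        rintro r a ⟨n, hn⟩
        exact ⟨n, Submodule.smul_mem _ _ hn⟩ }
  have : P = ⊤ := H.ind P ⟨1, wl_one _⟩ (by rintro a i v ⟨n, hn⟩; exact ⟨n+1, wl_x _ _ _ hn⟩)
  have h2 : v ∈ P := by rw [this]; trivial
  exact h2

lemma Fock.Δ_nil (H : Fock x d one) (C : ℕ → ℕ → ℂ) (n : ℕ) {v : U} (hv : v ∈ wl x one n) : ((H.Δ C)^n) v = 0 := by
  induction n generalizing v with
  | zero => simpa [wl] using hv
  | succ n ih => rw [pow_succ, Module.End.mul_apply]; exact ih (H.wl_Δ C n hv)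

lemma Fock.lfE (H : Fock x d one) (C : ℕ → ℕ → ℂ) : LF (fun m => ((m.factorial:ℂ)⁻¹) • (H.Δ C)^m) := fun v => by
  obtain ⟨n, hn⟩ := H.wl_top v
  refine ⟨n, fun k hk => ?_⟩
  have hm : Monotone (wl x one) := monotone_nat_of_le_succ wl_mono
  simp [H.Δ_nil C k (hm hk hn)]

/-- `exp Δ` -/
noncomputable def Fock.E (H : Fock x d one) (C : ℕ → ℕ → ℂ) : Module.End ℂ U := lsum _ (H.lfE C)

lemma Fock.Δ_pow_ann (H : Fock x d one) (C : ℕ → ℕ → ℂ) (a : Fin ℓ) (γ : ℕ → ℂ) (m : ℕ) (v : U) :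
    H.ann a γ (((H.Δ C)^m) v) = ((H.Δ C)^m) (H.ann a γ v) := by
  induction m generalizing v with
  | zero => simp
  | succ m ih => rw [pow_succ, Module.End.mul_apply, Module.End.mul_apply, ih, H.Δ_ann]

lemma Fock.E_ann (H : Fock x d one) (C : ℕ → ℕ → ℂ) (a : Fin ℓ) (γ : ℕ → ℂ) (v : U) :
    H.ann a γ (H.E C v) = H.E C (H.ann a γ v) := 
  lsum_comm _ _ _ _ fun l => by simp [H.Δ_pow_ann]

lemma Fock.Δ_pow_x (H : Fock x d one) (C : ℕ → ℕ → ℂ) (hC : ∀ i j, C i j = C j i) (b : Fin ℓ) (j : ℕ) (m : ℕ) (v : U) :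
    ((H.Δ C)^(m+1)) (x b j v) = x b j (((H.Δ C)^(m+1)) v) + ((m:ℂ)+1) • ((H.Δ C)^m) (H.ann b (C j) v) := by
  induction m generalizing v with
  | zero => simp [H.Δ_x C hC]
  | succ m ih =>
    rw [pow_succ' _ (m+1), Module.End.mul_apply, ih, map_add, map_smul, H.Δ_x C hC, Module.End.mul_apply,
      H.Δ_pow_ann, ← Module.End.mul_apply (H.Δ C) ((H.Δ C)^m), ← pow_succ', add_assoc]
    congr 1
    push_cast
    simp only [add_smul, one_smul]; abel

lemma Fock.E_x (H : Fock x d one) (C : ℕ → ℕ → ℂ) (hC : ∀ i j, C i j = C j i) (b : Fin ℓ) (j : ℕ) (v : U) :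
    H.E C (x b j v) = x b j (H.E C v) + H.E C (H.ann b (C j) v) := by
  obtain ⟨K1, h1⟩ := eventually_atTop.1 (lsum_ev _ (H.lfE C) (x b j v))
  obtain ⟨K2, h2⟩ := eventually_atTop.1 (lsum_ev _ (H.lfE C) v)
  obtain ⟨K3, h3⟩ := eventually_atTop.1 (lsum_ev _ (H.lfE C) (H.ann b (C j) v))
  have e1 := h1 (K1+K2+K3+1) (by omega)
  have e2 := h2 (K1+K2+K3+1) (by omega)
  have e3 := h3 (K1+K2+K3) (by omega)
  rw [Fock.E, e1, e2, e3, Finset.sum_range_succ', Finset.sum_range_succ']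
  simp only [LinearMap.smul_apply, H.Δ_pow_x C hC, smul_add, Finset.sum_add_distrib, map_add, map_sum, map_smul]
  have : ∀ i : ℕ, (((i+1).factorial:ℂ)⁻¹) • (((i:ℂ)+1) • ((H.Δ C)^i) (H.ann b (C j) v)) =
      ((i.factorial:ℂ)⁻¹) • ((H.Δ C)^i) (H.ann b (C j) v) := by
    intro i
    rw [smul_smul]
    congr 1
    have h0 : ((i:ℂ)+1) ≠ 0 := Nat.cast_add_one_ne_zero i
    have h1 : (i.factorial:ℂ) ≠ 0 := by exact_mod_cast i.factorial_ne_zero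
    rw [Nat.factorial_succ]; push_cast; field_simp
  simp only [this]
  simp only [pow_zero, Module.End.one_apply]
  abel

/-- existence of the Gaussian functional -/
lemma Fock.exists_f0 (H : Fock x d one) (C : ℕ → ℕ → ℂ) (hC : ∀ i j, C i j = C j i) 
    (h1 : one ∉ Submodule.span ℂ {w | ∃ a i v, w = x a i v}) :
    ∃ f0 : U →ₗ[ℂ] ℂ, f0 one = 1 ∧ ∀ a k v, f0 (x a k v) = f0 (H.ann a (C k) v) := by
  obtain ⟨f, hf1, hf2⟩ := Submodule.exists_le_ker_of_notMem h1
  refine ⟨(f one)⁻¹ • (f ∘ₗ H.E C), ?_, fun a k v => ?_⟩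
  · have : H.E C one = one := by
      rw [Fock.E, lsum_eq _ _ _ 1]
      · simp
      · intro k hk
        have hm : Monotone (wl x one) := monotone_nat_of_le_succ wl_mono
        rw [LinearMap.smul_apply, H.Δ_nil C k (hm hk (wl_one 0)), smul_zero]
    simp [this, hf1]
  · have : f (x a k (H.E C v)) = 0 := hf2 (Submodule.subset_span ⟨a, k, _, rfl⟩)
    simp [H.E_x C hC, this]
end fock

end Zhu
end

section
namespace Zhu
open Filter

/-- the modes `h_a(-p-1)` -/
noncomputable def um {U : Type} [AddCommGroup U] [Module ℂ U] {ℓ : ℕ} (x d : Fin ℓ → ℕ → Module.End ℂ U) (a : Fin ℓ) (p : ℤ) :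
    Module.End ℂ U :=
  if 0 ≤ p then x a p.toNat else if p = -1 then 0 else ((-p-1:ℤ):ℂ) • d a (-p-2).toNat

/-- generating coefficients -/
noncomputable def gk (C : ℕ → ℕ → ℂ) (k : ℕ) (p : ℤ) : ℂ :=
  if 0 ≤ p then C p.toNat k else if p = -k-2 then (k:ℂ)+1 else 0

section fock
variable {U : Type} [AddCommGroup U] [Module ℂ U] {ℓ : ℕ} {x d : Fin ℓ → ℕ → Module.End ℂ U} {one : U}

lemma um_nn {p : ℤ} (hp : 0 ≤ p) (a : Fin ℓ) : um x d a p = x a p.toNat := by rw [um, if_pos hp]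

lemma um_neg {p : ℤ} (hp : p < 0) (C : ℕ → ℕ → ℂ) (a : Fin ℓ) (w : U) (K : ℕ) (hK : ∀ k ≥ K, d a k w = 0) :
    um x d a p w = ∑ k ∈ Finset.range K, gk C k p • d a k w := by
  rw [um, if_neg (by omega)]
  simp only [gk, if_neg (show ¬ 0 ≤ p by omega)]
  by_cases h1 : p = -1
  · rw [if_pos h1]
    symm
    refine Finset.sum_eq_zero fun k _ => ?_
    rw [if_neg (by omega), zero_smul]
  · rw [if_neg h1]
    obtain ⟨k, rfl⟩ : ∃ k : ℕ, p = -k-2 := ⟨(-p-2).toNat, by omega⟩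
    have e : (-(-(k:ℤ)-2)-2).toNat = k := by omega
    have e2 : ((-(-(k:ℤ)-2)-1 : ℤ):ℂ) = (k:ℂ)+1 := by push_cast; ring
    rw [e, e2, LinearMap.smul_apply]
    by_cases hk : k < K
    · rw [Finset.sum_eq_single_of_mem k (by simpa using hk) (fun i _ hi => by rw [if_neg (by omega), zero_smul])]
      simp
    · rw [hK k (by omega), smul_zero]
      symm
      refine Finset.sum_eq_zero fun i hi => ?_
      rw [if_neg (by simp at hi; omega), zero_smul]

lemma Fock.ann_um (H : Fock x d one) (a b : Fin ℓ) (γ : ℕ → ℂ) (q : ℤ) (v : U) :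
    H.ann a γ (um x d b q v) = um x d b q (H.ann a γ v) + (if a = b ∧ 0 ≤ q then γ q.toNat else 0) • v := by
  rw [um]
  by_cases h : 0 ≤ q
  · simp [h, H.ann_x]
  · rw [if_neg h]
    have h' : ¬ (a = b ∧ 0 ≤ q) := fun t => h t.2
    rw [if_neg h']
    split_ifs with h1 <;> simp [H.d_ann]

lemma Fock.um_f (H : Fock x d one) {C : ℕ → ℕ → ℂ} {f : U →ₗ[ℂ] ℂ} {Q : Fin ℓ → ℕ → U → ℂ}
    (hf : ∀ a k w, f (x a k w) = f (H.ann a (C k) w) + Q a k w) (a : Fin ℓ) (p : ℤ) (w : U)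
    (K : ℕ) (hK : ∀ k ≥ K, d a k w = 0) : 
    f (um x d a p w) = ∑ k ∈ Finset.range K, gk C k p * f (d a k w) + (if 0 ≤ p then Q a p.toNat w else 0) := by
  by_cases h : 0 ≤ p
  · rw [um_nn h, if_pos h, hf, H.ann_eq _ _ _ K hK, map_sum]
    simp [gk, h]
  · rw [um_neg (by omega) C a w K hK, if_neg h, map_sum]
    simp

/-- the normally ordered product of `um a p` and `um b q` -/
noncomputable def NO (x d : Fin ℓ → ℕ → Module.End ℂ U) (a b : Fin ℓ) (p q : ℤ) (w : U) : U :=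
  if 0 ≤ p then um x d a p (um x d b q w) else um x d b q (um x d a p w)

lemma Fock.NO_f (H : Fock x d one) {C : ℕ → ℕ → ℂ} {f : U →ₗ[ℂ] ℂ} {Q : Fin ℓ → ℕ → U → ℂ}
    (hf : ∀ a k w, f (x a k w) = f (H.ann a (C k) w) + Q a k w) (a b : Fin ℓ) (p q : ℤ) (w : U)
    (K : ℕ) (hK : ∀ k ≥ K, d a k w = 0) : 
    f (NO x d a b p q w) = ∑ k ∈ Finset.range K, gk C k p * f (um x d b q (d a k w)) +
      (if a = b then f w else 0) * (if 0 ≤ p ∧ 0 ≤ q then C p.toNat q.toNat else 0)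
      + (if 0 ≤ p then Q a p.toNat (um x d b q w) else 0) := by
  by_cases h : 0 ≤ p
  · rw [NO, if_pos h, if_pos h, um_nn h, hf, H.ann_um, H.ann_eq _ _ _ K hK, map_sum, map_add, map_sum]
    congr 1
    congr 1
    · simp [gk, h]
    · by_cases h1 : a = b <;> by_cases h2 : 0 ≤ q <;> simp [h, h1, h2, mul_comm]
  · rw [NO, if_neg h, if_neg h, um_neg (by omega) C a w K hK, map_sum, map_sum]
    simp [h]

/-- conditions on covariance and legs -/
structure Par (C : ℕ → ℕ → ℂ) (α β : ℤ → ℂ) : Prop where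
  sym : ∀ i j, C i j = C j i
  hom : Hom C
  αn : ∀ p < 0, α p = 0
  βn : ∀ p < 0, β p = 0
  gg : ∀ k l, (fun p q => gk C k p * gk C l q) ∈ HG
  gα : ∀ k, (fun p q => gk C k p * α q) ∈ HG
  αg : ∀ k, (fun p q => α p * gk C k q) ∈ HG
  gβ : ∀ k, (fun p q => gk C k p * β q) ∈ HG
  βg : ∀ k, (fun p q => β p * gk C k q) ∈ HG
  αβ : (fun p q => α p * β q) ∈ HG
  βα : (fun p q => β p * α q) ∈ HG

lemma Fock.exists_F (H : Fock x d one) {C : ℕ → ℕ → ℂ} {α β : ℤ → ℂ} (hP : Par C α β)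
    (h1 : one ∉ Submodule.span ℂ {w | ∃ a i v, w = x a i v}) (a0 b0 : Fin ℓ) (hab : a0 ≠ b0) :
    ∃ F : U →ₗ[ℂ] ℂ, (∀ a b w, (fun p q => F (NO x d a b p q w)) ∈ HG) ∧ 
      ∀ i j : ℕ, F (x a0 i (x b0 j one)) = β i * α j := by
  obtain ⟨f0, hf1, hf0⟩ := H.exists_f0 C hP.sym h1
  set Aα := H.ann b0 (fun k => α k) with hAα
  set Aβ := H.ann a0 (fun k => β k) with hAβ
  set G1 : U →ₗ[ℂ] ℂ := f0 ∘ₗ Aα with hG1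
  set G2 : U →ₗ[ℂ] ℂ := f0 ∘ₗ Aβ with hG2
  set F : U →ₗ[ℂ] ℂ := f0 ∘ₗ Aβ ∘ₗ Aα with hF
  have r0 : ∀ a k w, f0 (x a k w) = f0 (H.ann a (C k) w) + (fun _ _ _ => (0:ℂ)) a k w := by
    intro a k w; simp [hf0]
  have r1 : ∀ a k w, G1 (x a k w) = G1 (H.ann a (C k) w) + 
      (fun (a : Fin ℓ) (k : ℕ) w => (if a = b0 then (1:ℂ) else 0) * (α k * f0 w)) a k w := by
    intro a k w
    simp only [hG1, LinearMap.comp_apply, hAα, H.ann_x, map_add, hf0, map_smul, H.ann_ann a b0]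
    by_cases h : a = b0
    · simp [h]
    · simp [h, Ne.symm h]
  have r2 : ∀ a k w, G2 (x a k w) = G2 (H.ann a (C k) w) + 
      (fun (a : Fin ℓ) (k : ℕ) w => (if a = a0 then (1:ℂ) else 0) * (β k * f0 w)) a k w := by
    intro a k w
    simp only [hG2, LinearMap.comp_apply, hAβ, H.ann_x, map_add, hf0, map_smul, H.ann_ann a a0]
    by_cases h : a = a0
    · simp [h]
    · simp [h, Ne.symm h]
  have rF : ∀ a k w, F (x a k w) = F (H.ann a (C k) w) + 
      (fun (a : Fin ℓ) (k : ℕ) w => (if a = a0 then (1:ℂ) else 0) * (β k * G1 w) + 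
        (if a = b0 then (1:ℂ) else 0) * (α k * G2 w)) a k w := by
    intro a k w
    have e1 : (if b0 = a then α k else 0) = (if a = b0 then (1:ℂ) else 0) * α k := by
      simp [eq_comm]
    have e2 : (if a0 = a then β k else 0) = (if a = a0 then (1:ℂ) else 0) * β k := by
      simp [eq_comm]
    simp only [hF, hG1, hG2, LinearMap.comp_apply, hAα, hAβ, H.ann_x, map_add, hf0, map_smul, H.ann_ann a a0,
      H.ann_ann a b0, e1, e2, smul_eq_mul]
    ring
  refine ⟨F, fun a b w => ?_, fun i j => ?_⟩
  · obtain ⟨Ka, hKa⟩ := H.lf a w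
    obtain ⟨Kb, hKb⟩ := H.lf b w
    have hKb' : ∀ k, ∀ l ≥ Kb, d b l (d a k w) = 0 := fun k l hl => by rw [H.dd, hKb l hl, map_zero]
    have leg : ∀ (γ : ℤ → ℂ), (∀ p < 0, γ p = 0) → ∀ (c z : ℂ) (q : ℤ), (if 0 ≤ q then c * (γ (q.toNat:ℤ) * z) else 0) = c * (γ q * z) := by
      intro γ hγ c z q
      split_ifs with h
      · rw [Int.toNat_of_nonneg h]
      · rw [hγ q (by omega)]; simp
    have leg2 : ∀ (c z c' z' : ℂ) (q : ℤ), (if 0 ≤ q then c * (β (q.toNat:ℤ) * z) + c' * (α (q.toNat:ℤ) * z') else 0) = 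
        c * (β q * z) + c' * (α q * z') := by
      intro c z c' z' q
      have t1 := leg β hP.βn c z q
      have t2 := leg α hP.αn c' z' q
      split_ifs at t1 t2 ⊢ with h
      · rw [t1, t2]
      · rw [← t1, ← t2, add_zero]
    have key : (fun p q => F (NO x d a b p q w)) = 
       (∑ k ∈ Finset.range Ka, ((∑ l ∈ Finset.range Kb, F (d b l (d a k w)) • (fun p q => gk C k p * gk C l q)) + 
          ((if b = a0 then (1:ℂ) else 0) * G1 (d a k w)) • (fun p q => gk C k p * β q) + 
          ((if b = b0 then (1:ℂ) else 0) * G2 (d a k w)) • (fun p q => gk C k p * α q)) )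
       + (if a = b then F w else 0) • (fun p q : ℤ => if 0 ≤ p ∧ 0 ≤ q then C p.toNat q.toNat else 0)
       + (((∑ l ∈ Finset.range Kb, ((if a = a0 then (1:ℂ) else 0) * G1 (d b l w)) • (fun p q => β p * gk C l q)) + 
          ((if a = a0 then (1:ℂ) else 0) * ((if b = b0 then (1:ℂ) else 0) * f0 w)) • (fun p q => β p * α q))
         + ((∑ l ∈ Finset.range Kb, ((if a = b0 then (1:ℂ) else 0) * G2 (d b l w)) • (fun p q => α p * gk C l q)) + 
          ((if a = b0 then (1:ℂ) else 0) * ((if b = a0 then (1:ℂ) else 0) * f0 w)) • (fun p q => α p * β q))) := by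
      funext p q
      rw [H.NO_f rF a b p q w Ka hKa]
      simp only [leg2, Pi.add_apply, Finset.sum_apply, Pi.smul_apply, smul_eq_mul]
      congr 1
      · congr 1
        refine Finset.sum_congr rfl fun k _ => ?_
        rw [H.um_f rF b q _ Kb (hKb' k), leg2, mul_add, Finset.mul_sum, add_assoc]
        congr 1
        · exact Finset.sum_congr rfl fun l _ => by ring
        · ring
      · rw [H.um_f r1 b q _ Kb hKb, H.um_f r2 b q _ Kb hKb, leg α hP.αn, leg β hP.βn]
        congr 1
        · rw [mul_add, mul_add, Finset.mul_sum, Finset.mul_sum]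
          congr 1
          · exact Finset.sum_congr rfl fun l _ => by ring
          · ring
        · rw [mul_add, mul_add, Finset.mul_sum, Finset.mul_sum]
          congr 1
          · exact Finset.sum_congr rfl fun l _ => by ring
          · ring
    rw [key]
    refine add_mem (add_mem (Submodule.sum_mem _ fun k _ => add_mem (add_mem (Submodule.sum_mem _ fun l _ => ?_) ?_) ?_) ?_) 
      (add_mem (add_mem (Submodule.sum_mem _ fun k _ => ?_) ?_) (add_mem (Submodule.sum_mem _ fun k _ => ?_) ?_))
    · exact Submodule.smul_mem _ _ (hP.gg _ _)
    · exact Submodule.smul_mem _ _ (hP.gβ _)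
    · exact Submodule.smul_mem _ _ (hP.gα _)
    · exact Submodule.smul_mem _ _ (HG_diag hP.hom)
    · exact Submodule.smul_mem _ _ (hP.βg _)
    · exact Submodule.smul_mem _ _ (hP.βα)
    · exact Submodule.smul_mem _ _ (hP.αg _)
    · exact Submodule.smul_mem _ _ (hP.αβ)
  · have z1 : Aα (x b0 j one) = α j • one := by simp [hAα, H.ann_x, H.ann_one]
    have z2 : Aα (x a0 i (x b0 j one)) = α j • x a0 i one := by
      rw [hAα, H.ann_x, ← hAα, z1, if_neg (Ne.symm hab)]; simp
    have z3 : Aβ (x a0 i one) = β i • one := by simp [hAβ, H.ann_x, H.ann_one]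
    simp [hF, z2, z3, hf1, mul_comm]

end fock

end Zhu
end

section
namespace Zhu
open Filter

lemma bb_zero_zero (m p : ℤ) : bb 0 m p = if p = m then 1 else 0 := by
  by_cases h : p < m
  · rw [bb_lt _ h, if_neg (by omega)]
  · obtain ⟨r, rfl⟩ : ∃ r : ℕ, p = m + r := ⟨(p-m).toNat, by omega⟩
    rw [bb_of]
    have := cch_natCast 0 r
    rw [Nat.cast_zero] at this
    rw [this]
    cases r with
    | zero => simp
    | succ r => rw [if_neg (by push_cast; omega)]; simp

lemma par_one : Par (fun _ _ => 0) (bb (-2) 0) (bb 0 0) := by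
  have hg : ∀ k, gk (fun _ _ => 0) k ∈ Cl 0 (-2) := by
    intro k
    have : gk (fun _ _ => 0) k = ((k:ℂ)+1) • bb 0 (-k-2) := by
      funext p
      simp only [gk, Pi.smul_apply, bb_zero_zero, smul_eq_mul]
      by_cases h : 0 ≤ p
      · rw [if_pos h, if_neg (by omega), mul_zero]
      · rw [if_neg h]; split_ifs <;> simp
    rw [this]
    exact Submodule.smul_mem _ _ (bb_mem (by omega))
  have hα : bb (-2) 0 ∈ Cl (-2) 0 := bb_mem le_rfl
  have hβ : bb 0 0 ∈ Cl 0 0 := bb_mem le_rfl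
  refine ⟨fun _ _ => rfl, fun i k => by simp, fun p hp => bb_lt _ hp, fun p hp => bb_lt _ hp, fun k l => ?_, 
    fun k => ?_, fun k => ?_, fun k => ?_, fun k => ?_, ?_, ?_⟩
  · exact HG_mul (hg k) (hg l) 2 (by norm_num) (by norm_num)
  · exact HG_mul (hg k) hα 0 (by norm_num) (by norm_num)
  · exact HG_mul hα (hg k) 0 (by norm_num) (by norm_num)
  · exact HG_mul (hg k) hβ 2 (by norm_num) (by norm_num)
  · exact HG_mul hβ (hg k) 2 (by norm_num) (by norm_num)
  · exact HG_mul hα hβ 0 (by norm_num) (by norm_num)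
  · exact HG_mul hβ hα 0 (by norm_num) (by norm_num)

lemma gosper (m q : ℕ) : ((m:ℂ)+q) * ∑ r ∈ Finset.range (m+1), cch (1/2) r * cch (-1/2) (m+q-r) =
    (1 - 2*m) * q * (cch (1/2) m * cch (-1/2) q) := by
  induction m generalizing q with
  | zero => simp
  | succ m ih =>
    have h1 := ih (q+1)
    have e : ∀ r, m + 1 + q - r = m + (q+1) - r := fun r => by omega
    rw [Finset.sum_range_succ, e (m+1), show m + (q+1) - (m+1) = q by omega]
    simp only [e]
    have h2 := cch_succ_mul (1/2) m
    have h3 := cch_succ_mul (-1/2) q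
    push_cast at h1 ⊢
    rw [mul_add, show ((m:ℂ)+1+q) = m + (q+1) by ring, h1]
    linear_combination (1 - 2*(m:ℂ)) * cch (1/2) m * h3 + (1+2*(q:ℂ)) * cch (-1/2) q * h2

/-- the twisted covariance -/
noncomputable def Ch (p k : ℕ) : ℂ := 1/4 * cch (-3/2) p * cch (-3/2) k / ((p:ℂ)+k+2)

lemma nz2 (p k : ℕ) : ((p:ℂ)+k+2) ≠ 0 := by
  have : ((p+k+2:ℕ):ℂ) ≠ 0 := Nat.cast_ne_zero.2 (by omega)
  push_cast at this; exact this

lemma Ch_hom : Hom Ch := by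
  intro i k
  have h1 := cch_succ_mul (-3/2) i
  have h2 := cch_succ_mul (-3/2) k
  have n1 := nz2 i k
  have n2 : ((i:ℂ)+k+3) ≠ 0 := by
    have := nz2 (i+1) k
    push_cast at this; convert this using 1; ring
  have e1 : (((i+1:ℕ):ℂ)+k+2) = i+k+3 := by push_cast; ring
  have e2 : ((i:ℂ)+((k+1:ℕ):ℂ)+2) = i+k+3 := by push_cast; ring
  rw [Ch, Ch, Ch, e1, e2]
  have : ((i:ℂ)+1) * (1/4 * cch (-3/2) (i+1) * cch (-3/2) k / (i+k+3)) + ((k:ℂ)+1) * (1/4 * cch (-3/2) i * cch (-3/2) (k+1) / (i+k+3))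
     + (i+k+2) * (1/4 * cch (-3/2) i * cch (-3/2) k / (i+k+2)) = 
     (1/4 * ((i+1) * cch (-3/2) (i+1)) * cch (-3/2) k + 1/4 * cch (-3/2) i * ((k+1) * cch (-3/2) (k+1))) / (i+k+3) + 
      1/4 * cch (-3/2) i * cch (-3/2) k := by field_simp
  rw [this, h1, h2]
  field_simp; ring

lemma gk_Ch (k : ℕ) : gk Ch k = ((k:ℂ)+1) • ∑ r ∈ Finset.range (k+2), cch (1/2) r • bb (-1/2) ((r:ℤ)-k-2) := by
  funext p
  simp only [Pi.smul_apply, Finset.sum_apply, smul_eq_mul]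
  by_cases hp : p < -1
  · rw [gk, if_neg (by omega)]
    by_cases hs : p < -k-2
    · rw [if_neg (by omega), Finset.sum_eq_zero, mul_zero]
      intro r _
      rw [bb_lt _ (by omega), mul_zero]
    · obtain ⟨s, rfl⟩ : ∃ s : ℕ, p = -k-2+s := ⟨(p+k+2).toNat, by omega⟩
      have : ∑ r ∈ Finset.range (k+2), cch (1/2) r * bb (-1/2) ((r:ℤ)-k-2) (-k-2+s) = cch 0 s := by
        rw [show (0:ℂ) = 1/2 + (-1/2) by norm_num, ← cch_vm]
        symm
        apply Finset.sum_subset_zero_on_sdiff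
        · intro r; simp; omega
        · intro r hr
          simp at hr
          rw [bb_lt _ (by omega), mul_zero]
        · intro r hr
          simp at hr
          rw [show (-(k:ℤ)-2+s) = ((r:ℤ)-k-2) + ((s-r:ℕ):ℤ) by omega, bb_of]
      rw [this]
      have h0 := cch_natCast 0 s
      rw [Nat.cast_zero] at h0
      rw [h0]
      cases s with
      | zero => simp
      | succ s => rw [if_neg (by push_cast; omega)]; simp
  · obtain ⟨q, rfl⟩ : ∃ q : ℕ, p = q - 1 := ⟨(p+1).toNat, by omega⟩
    have e : ∑ r ∈ Finset.range (k+2), cch (1/2) r * bb (-1/2) ((r:ℤ)-k-2) (q-1) = 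
        ∑ r ∈ Finset.range (k+1+1), cch (1/2) r * cch (-1/2) (k+1+q-r) := by
      refine Finset.sum_congr rfl fun r hr => ?_
      simp at hr
      rw [show ((q:ℤ)-1) = ((r:ℤ)-k-2) + ((k+1+q-r:ℕ):ℤ) by omega, bb_of]
    rw [e]
    have hG := gosper (k+1) q
    cases q with
    | zero =>
      rw [gk, if_neg (by simp), if_neg (by simp; omega)]
      simp only [Nat.cast_zero, add_zero, mul_zero, zero_mul, mul_eq_zero] at hG
      rcases hG with h | h
      · exact absurd h (by exact_mod_cast (by omega : k+1 ≠ 0))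
      · rw [add_zero, h, mul_zero]
    | succ q =>
      rw [gk, if_pos (by push_cast; omega), show (((q+1:ℕ):ℤ) - 1).toNat = q by omega]
      have n1 := nz2 q k
      have t1 : (((k+1:ℕ):ℂ) + ((q+1:ℕ):ℂ)) = q+k+2 := by push_cast; ring
      rw [t1] at hG
      rw [Ch, div_eq_iff n1, mul_assoc _ _ ((q:ℂ)+k+2), mul_comm _ ((q:ℂ)+k+2), hG]
      have a1 := cch_succ' (-1/2) q
      have a2 := cch_succ' (1/2) k
      have a3 := cch_succ' (-1/2) k
      have a4 := cch_succ_mul (-1/2) k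
      rw [show (-1/2:ℂ) - 1 = -3/2 by norm_num] at a1 a3
      rw [show (1/2:ℂ) - 1 = -1/2 by norm_num] at a2
      push_cast
      have a5 : cch (-3/2) k = (1+2*k) * cch (-1/2) k := by linear_combination 2 * a3 - 2 * a4
      have : ((k:ℂ)+1) * ((1 - 2*((k:ℂ)+1)) * (q+1) * (cch (1/2) (k+1) * cch (-1/2) (q+1))) = 
        (-(1+2*k)) * (((k:ℂ)+1) * cch (1/2) (k+1)) * (((q:ℂ)+1) * cch (-1/2) (q+1)) := by ring
      rw [this, a1, a2, a5]
      ring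

lemma par_half : Par Ch (bb (-3/2) 0) (bb (-1/2) 0) := by
  have hg : ∀ k, gk Ch k ∈ Cl (-1/2) (-1) := by
    intro k
    rw [gk_Ch]
    refine Submodule.smul_mem _ _ (Submodule.sum_mem _ fun r hr => Submodule.smul_mem _ _ (bb_mem ?_))
    simp at hr; omega
  have hα : bb (-3/2) 0 ∈ Cl (-3/2) 0 := bb_mem le_rfl
  have hβ : bb (-1/2) 0 ∈ Cl (-1/2) 0 := bb_mem le_rfl
  refine ⟨fun i j => ?_, Ch_hom, fun p hp => bb_lt _ hp, fun p hp => bb_lt _ hp, fun k l => ?_, 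
    fun k => ?_, fun k => ?_, fun k => ?_, fun k => ?_, ?_, ?_⟩
  · rw [Ch, Ch, add_comm (i:ℂ) j]; ring
  · exact HG_mul (hg k) (hg l) 1 (by norm_num) (by norm_num)
  · exact HG_mul (hg k) hα 0 (by norm_num) (by norm_num)
  · exact HG_mul hα (hg k) 0 (by norm_num) (by norm_num)
  · exact HG_mul (hg k) hβ 1 (by norm_num) (by norm_num)
  · exact HG_mul hβ (hg k) 1 (by norm_num) (by norm_num)
  · exact HG_mul hα hβ 0 (by norm_num) (by norm_num)
  · exact HG_mul hβ hα 0 (by norm_num) (by norm_num)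

end Zhu
end

section
namespace Zhu
open Filter

lemma cch_refl (y : ℂ) (j : ℕ) : (-1)^j * cch y j = cch (j-1-y) j := by
  induction j with
  | zero => simp
  | succ j ih =>
    have h0 : ((j:ℂ)+1) ≠ 0 := Nat.cast_add_one_ne_zero j
    apply mul_left_cancel₀ h0
    have h1 := cch_succ' ((j:ℂ)-y) j
    have h2 := cch_succ_mul y j
    rw [show (j:ℂ)-y-1 = j-1-y by ring, ← ih] at h1
    push_cast
    rw [show (j:ℂ)+1-1-y = j - y by ring, h1, mul_left_comm, h2]
    ring

lemma cch_refl_nat (i t : ℕ) : (-1)^t * cch (-(i:ℂ)-1) t = cch ((i:ℂ)+t) i := by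
  rw [cch_refl, show (t:ℂ)-1-(-(i:ℂ)-1) = ((i+t:ℕ):ℂ) by push_cast; ring, cch_natCast, Nat.choose_symm_add.symm,
    ← cch_natCast]
  push_cast; rfl

lemma sum_Ico_sym {X : Type} [AddCommGroup X] (f : ℤ → X) (K : ℕ) : 
    ∑ p ∈ Finset.Ico (-(K:ℤ)) K, f p = ∑ t ∈ Finset.range K, f (-(t:ℤ)-1) + ∑ t ∈ Finset.range K, f t := by
  induction K with
  | zero => simp
  | succ K ih =>
    have : Finset.Ico (-((K+1:ℕ):ℤ)) ((K+1:ℕ):ℤ) = insert (-(K:ℤ)-1) (insert (K:ℤ) (Finset.Ico (-(K:ℤ)) K)) := by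
      ext p; simp; omega
    rw [this, Finset.sum_insert (by simp), Finset.sum_insert (by simp), ih, Finset.sum_range_succ, Finset.sum_range_succ]
    abel

variable {V : Type} [AddCommGroup V] [Module ℂ V] {ℓ : ℕ} {A : VOA V} {h : Fin ℓ → V}

/-- creation operators -/
noncomputable def xo (A : VOA V) (h : Fin ℓ → V) (a : Fin ℓ) (k : ℕ) : Module.End ℂ V := A.Y (h a) (-(k+1))
/-- normalised annihilation operators -/
noncomputable def dop (A : VOA V) (h : Fin ℓ → V) (a : Fin ℓ) (k : ℕ) : Module.End ℂ V := ((k:ℂ)+1)⁻¹ • A.Y (h a) (k+1)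

lemma fock_of (H : IsHeisenberg A h) : Fock (xo A h) (dop A h) A.one := by
  refine ⟨fun a b i j v => ?_, fun a b i j v => ?_, fun a i => ?_, fun a v => ?_, fun P h1 h2 => ?_⟩
  · have h0 : ((i:ℂ)+1) ≠ 0 := Nat.cast_add_one_ne_zero i
    have e : (a = b ∧ ((i:ℤ)+1) + -((j:ℤ)+1) = 0) ↔ (a = b ∧ i = j) := by
      constructor <;> rintro ⟨h1, h2⟩ <;> exact ⟨h1, by omega⟩
    simp only [xo, dop, LinearMap.smul_apply, comm_apply H a b ((i:ℤ)+1), smul_add, map_smul, smul_smul, e]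
    congr 2
    split_ifs
    · push_cast; field_simp
    · simp
  · have e : ¬ (a = b ∧ ((i:ℤ)+1) + ((j:ℤ)+1) = 0) := by rintro ⟨h1, h2⟩; omega
    simp only [dop, LinearMap.smul_apply, map_smul, comm_apply H a b ((i:ℤ)+1), if_neg e, zero_smul, add_zero]
    rw [smul_comm]
  · simp only [dop, LinearMap.smul_apply]
    rw [A.create_ge _ _ (by omega), smul_zero]
  · obtain ⟨K, hK⟩ := trunc_nat A (h a) v 1
    refine ⟨K, fun k hk => ?_⟩
    simp only [dop, LinearMap.smul_apply]
    rw [add_comm (k:ℤ) 1, hK k hk, smul_zero]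
  · rw [eq_top_iff]
    intro v _
    exact word_ind H (P := fun v => v ∈ P) (Submodule.zero_mem _) (fun _ _ => add_mem) (fun c u => Submodule.smul_mem _ c) h1
      (fun a n v hv => h2 a n v hv) v

lemma one_notMem (H : IsHeisenberg A h) : A.one ∉ Submodule.span ℂ {w | ∃ a i v, w = xo A h a i v} := by
  have hle : Submodule.span ℂ {w | ∃ a i v, w = xo A h a i v} ≤ ⨆ (j : ℤ) (_ : j ≠ 0), A.wt j := by
    refine Submodule.span_le.2 ?_
    rintro w ⟨a, i, v, rfl⟩
    refine hom_ind A (wt_neg H) (P := fun v => xo A h a i v ∈ ⨆ (j : ℤ) (_ : j ≠ 0), A.wt j) (by simp) 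
      (fun u v hu hv => by rw [map_add]; exact add_mem hu hv) (fun k u hu => ?_) v
    have := cre_wt H a i hu
    exact Submodule.mem_iSup_of_mem _ (Submodule.mem_iSup_of_mem (by omega) this)
  intro h1
  have := (A.internal.submodule_iSupIndep 0).le_bot ⟨A.one_wt, hle h1⟩
  exact A.one_ne_zero (by simpa using this)

lemma um_Y (H : IsHeisenberg A h) (a : Fin ℓ) (p : ℤ) (v : V) : um (xo A h) (dop A h) a p v = A.Y (h a) (-p-1) v := by
  rw [um]
  split_ifs with h1 h2
  · have e : -((p.toNat:ℤ)+1) = -p-1 := by omega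
    rw [xo, e]
  · subst h2; simp [H_zero H]
  · obtain ⟨k, rfl⟩ : ∃ k : ℕ, p = -k-2 := ⟨(-p-2).toNat, by omega⟩
    have e : (-(-(k:ℤ)-2)-2).toNat = k := by omega
    have e2 : ((-(-(k:ℤ)-2)-1 : ℤ):ℂ) = (k:ℂ)+1 := by push_cast; ring
    have h0 : ((k:ℂ)+1) ≠ 0 := Nat.cast_add_one_ne_zero k
    rw [e, e2, dop, smul_smul, mul_inv_cancel₀ h0, one_smul]
    rw [show -(-(k:ℤ)-2)-1 = k+1 by ring]

lemma iterate_sv (H : IsHeisenberg A h) (a b : Fin ℓ) (i j : ℕ) (N : ℤ) (w : V) : ∀ᶠ K : ℕ in atTop,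
    A.Y (sv A h a b i j) N w = ∑ p ∈ Finset.Ico (-(K:ℤ)) K, (cch (p:ℂ) i * cch (((i:ℤ)+j-1-N-p:ℤ):ℂ) j) • 
      NO (xo A h) (dop A h) a b p ((i:ℤ)+j-1-N-p) w := by
  obtain ⟨K2, h2⟩ := trunc_nat A (hv A h b j) w N
  filter_upwards [borcherds_ev A (h a) (hv A h b j) w (-(i+1)) 0 N, eventually_ge_atTop (1 + K2 + i)] with K hK hK1
  have hL : ∑ t ∈ Finset.range K, zchoose 0 t • A.Y (A.Y (h a) (-(i+1) + t) (hv A h b j)) (0 + N - t) w = A.Y (sv A h a b i j) N w := by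
    rw [Finset.sum_eq_single_of_mem 0 (by simp; omega)]
    · simp [zchoose_eq, sv]
    · intro t _ ht
      have := zchoose_natCast 0 t
      rw [Nat.cast_zero] at this
      rw [this, Nat.choose_eq_zero_of_lt (by omega)]; simp
  rw [← hL, hK, sum_Ico_sym]
  simp only [smul_sub, Finset.sum_sub_distrib]
  rw [sub_eq_neg_add]
  have hvm : ∀ (y : ℤ) (v : V), A.Y (hv A h b j) y v = cch (((j:ℤ)-1-y:ℤ):ℂ) j • um (xo A h) (dop A h) b ((j:ℤ)-1-y) v := by
    intro y v
    rw [um_Y H, hv_mode H, cch_refl, LinearMap.smul_apply]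
    push_cast
    congr 4; ring
  congr 1
  · rw [← Finset.sum_neg_distrib]
    refine Finset.sum_congr rfl fun t _ => ?_
    rw [hvm, NO, if_neg (by omega), um_Y H a, ← smul_neg, ← neg_smul, zchoose_eq, smul_smul, smul_smul]
    have e1 : (i:ℤ)+j-1-N-(-(t:ℤ)-1) = (j:ℤ)-1-(N + -(i+1) - t) := by ring
    have e2 : -(-(t:ℤ)-1)-1 = 0 + t := by ring
    rw [e1, e2]
    congr 1
    have h3 := cch_refl_nat i t
    have h4 := cch_refl (-(t:ℂ)-1) i
    rw [show (i:ℂ)-1-(-(t:ℂ)-1) = i + t by ring] at h4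
    have e3 : (((-((i:ℤ)+1)):ℤ):ℂ) = -(i:ℂ)-1 := by push_cast; ring
    have e4 : (((-(t:ℤ)-1):ℤ):ℂ) = -(t:ℂ)-1 := by push_cast; ring
    have e5 : -(-1:ℂ)^(-((i:ℤ)+1)) = (-1)^i := by
      rw [zpow_neg, ← Nat.cast_succ, zpow_natCast, pow_succ]
      rcases neg_one_pow_eq_or ℂ i with h | h <;> simp [h] <;> norm_num
    have e6 : ((-1:ℂ)^i) * (-1)^i = 1 := by rw [← mul_pow]; simp
    rw [e3, e4, h3, ← h4, e5]
    linear_combination cch (-(t:ℂ)-1) i * cch (((j:ℤ)-1-(N + -(i+1) - t):ℤ):ℂ) j * e6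
  · obtain ⟨K', rfl⟩ : ∃ K', K = i + K' := ⟨K - i, by omega⟩
    have hR : ∀ f : ℕ → V, (∀ t, t < i → f t = 0) → ∑ t ∈ Finset.range (i+K'), f t = ∑ t ∈ Finset.range K', f (i+t) := by
      intro f hf
      rw [Finset.sum_range_add, Finset.sum_eq_zero (fun t ht => hf t (Finset.mem_range.1 ht)), zero_add]
    have hL' : ∀ f : ℕ → V, (∀ t, K' ≤ t → f t = 0) → ∑ t ∈ Finset.range (i+K'), f t = ∑ t ∈ Finset.range K', f t := by
      intro f hf
      rw [add_comm i K', Finset.sum_range_add, Finset.sum_eq_zero (s := Finset.range i) (fun t ht => hf _ (by omega)), add_zero]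
    refine (hL' _ ?_).trans (Eq.trans ?_ (hR _ ?_).symm)
    · intro t ht
      rw [h2 _ (by omega)]; simp
    · refine Finset.sum_congr rfl fun t _ => ?_
      rw [hvm, NO, if_pos (by omega), um_Y H a, zchoose_eq, map_smul, smul_smul]
      have e1 : (i:ℤ)+j-1-N-((i+t:ℕ):ℤ) = (j:ℤ)-1-(N + t) := by push_cast; ring
      have e2 : -((i+t:ℕ):ℤ)-1 = 0 + -(i+1) - t := by push_cast; ring
      rw [e1, e2]
      congr 1
      have h3 := cch_refl_nat i t
      have e3 : (((-((i:ℤ)+1)):ℤ):ℂ) = -(i:ℂ)-1 := by push_cast; ring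
      rw [e3, h3]; push_cast; rfl
    · intro t ht
      rw [show (((t:ℕ):ℤ):ℂ) = ((t:ℕ):ℂ) by simp, cch_natCast, Nat.choose_eq_zero_of_lt ht]; simp

lemma F_zm (H : IsHeisenberg A h) (F : V →ₗ[ℂ] ℂ) (hF : ∀ a b w, (fun p q => F (NO (xo A h) (dop A h) a b p q w)) ∈ HG)
    (a b : Fin ℓ) (i j : ℕ) (N : ℤ) (hN : N ≤ -2) (w : V) : F (zm A N (sv A h a b i j) w) = 0 := by
  rw [zm_of A (sv_wt H a b i j), md_bs, bs_apply]
  obtain ⟨g, h1, h2⟩ := hF a b w i j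
  rw [← h2 N hN]
  congr 1
  funext n
  obtain ⟨K, e1, e2⟩ := ((iterate_sv H a b i j n w).and (h1 ((i:ℤ)+j-1-n))).exists
  rw [e1, ← e2, map_sum]
  refine Finset.sum_congr rfl fun p _ => ?_
  rw [map_smul, smul_eq_mul]

lemma F_plus {W : Type} [AddCommGroup W] [Module ℂ W] (S : HeisenbergPlusSetting ℓ V W) {C : ℕ → ℕ → ℂ} {α β : ℤ → ℂ} (hP : Par C α β)
    (s : Fin ℓ → Fin ℓ → ℕ → ℕ → W) (hs : ∀ a b i j, S.ι (s a b i j) = sv S.A S.hgen a b i j)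
    (a0 b0 : Fin ℓ) (hab : a0 ≠ b0) : ∃ F : W →ₗ[ℂ] ℂ, (∀ w ∈ S.B.Osub, F w = 0) ∧ ∀ i j : ℕ, F (s a0 b0 i j) = β i * α j := by
  obtain ⟨F, hF, hF2⟩ := (fock_of S.heis).exists_F hP (one_notMem S.heis) a0 b0 hab
  refine ⟨F ∘ₗ S.ι, fun w hw => ?_, fun i j => ?_⟩
  · refine Osub_gen S (LinearMap.ker (F ∘ₗ S.ι)) s hs (fun a b i j N w hN => ?_) hw
    have hu : s a b i j ∈ S.B.wt ((i+j+2:ℕ):ℤ) := (S.fixedSub.map_wt _ _).2 (by rw [hs]; exact sv_wt S.heis a b i j)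
    rw [LinearMap.mem_ker, LinearMap.comp_apply, iota_zm S hu, hs]
    exact F_zm S.heis F hF a b i j N hN _
  · rw [LinearMap.comp_apply, hs, ← hF2]; rfl
end Zhu
end

section
namespace Zhu

lemma eu_val : 5 * cch (-2) 1 + 25 * cch (-2) 2 + 36 * cch (-2) 3 + 16 * cch (-2) 4 ≠ 0 := by
  simp only [cch_succ, show cch (-2) 0 = 1 from rfl]
  norm_num

lemma et_val : (-16) * (3 * cch (-3/2) 1 + 14 * cch (-3/2) 2 + 19 * cch (-3/2) 3 + 8 * cch (-3/2) 4) ≠ 0 := by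
  simp only [cch_succ, show cch (-3/2) 0 = 1 from rfl]
  norm_num

lemma bb_zero (κ : ℂ) (r : ℕ) : bb κ 0 r = cch κ r := by
  simpa using bb_of κ 0 r

variable {ℓ : ℕ} {V W : Type} [AddCommGroup V] [Module ℂ V] [AddCommGroup W] [Module ℂ W]

lemma s_shift (S : HeisenbergPlusSetting ℓ V W) {s : Fin ℓ → Fin ℓ → ℤ → ℤ → W}
    (hs : ∀ a b m n, S.ι (s a b m n) = SV S.A S.hgen a b m n) (a b : Fin ℓ) (i j : ℕ) :
    S.ι (s a b ((i:ℤ)+1) ((j:ℤ)+1)) = sv S.A S.hgen a b i j := by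
  rw [hs]; rfl

lemma EuW_notMem (S : HeisenbergPlusSetting ℓ V W) {s : Fin ℓ → Fin ℓ → ℤ → ℤ → W}
    (hs : ∀ a b m n, S.ι (s a b m n) = SV S.A S.hgen a b m n) (a b : Fin ℓ) (hab : a ≠ b) :
    EuW s a b ∉ S.B.Osub := by
  intro hmem
  obtain ⟨F, h1, h2⟩ := F_plus S par_one (fun a b (i j : ℕ) => s a b ((i:ℤ)+1) ((j:ℤ)+1)) (s_shift S hs) a b hab
  have h := h1 _ hmem
  have k1 := h2 0 1
  have k2 := h2 0 2
  have k3 := h2 0 3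
  have k4 := h2 0 4
  rw [bb_zero, bb_zero, show cch 0 0 = 1 from rfl, one_mul] at k1 k2 k3 k4
  norm_num at k1 k2 k3 k4
  simp only [EuW, map_add, map_smul, smul_eq_mul, k1, k2, k3, k4] at h
  exact eu_val h

lemma EtW_notMem (S : HeisenbergPlusSetting ℓ V W) {s : Fin ℓ → Fin ℓ → ℤ → ℤ → W}
    (hs : ∀ a b m n, S.ι (s a b m n) = SV S.A S.hgen a b m n) (a b : Fin ℓ) (hab : a ≠ b) :
    EtW s a b ∉ S.B.Osub := by
  intro hmem
  obtain ⟨F, h1, h2⟩ := F_plus S par_half (fun a b (i j : ℕ) => s a b ((i:ℤ)+1) ((j:ℤ)+1)) (s_shift S hs) a b hab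
  have h := h1 _ hmem
  have k1 := h2 0 1
  have k2 := h2 0 2
  have k3 := h2 0 3
  have k4 := h2 0 4
  rw [bb_zero, bb_zero, show cch (-1/2) 0 = 1 from rfl, one_mul] at k1 k2 k3 k4
  simp only [Nat.cast_zero, zero_add, Nat.cast_one, Nat.cast_ofNat, Int.reduceAdd] at k1 k2 k3 k4
  simp only [EtW, map_add, map_smul, smul_eq_mul, k1, k2, k3, k4] at h
  exact et_val h

variable {R : Type} [Ring R] [Algebra ℂ R]

lemma lift_span {f : W →ₗ[ℂ] R} {E : Fin ℓ → Fin ℓ → W} {M : Fin ℓ → Fin ℓ → R} (hE : ∀ a b, f (E a b) = M a b) {x : W}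
    (hx : f x ∈ Submodule.span ℂ {z | ∃ a b, z = M a b}) :
    ∃ y ∈ Submodule.span ℂ {z : W | ∃ a b : Fin ℓ, z = E a b}, f (x - y) = 0 := by
  have hm : Submodule.span ℂ {z | ∃ a b, z = M a b} = (Submodule.span ℂ {z : W | ∃ a b : Fin ℓ, z = E a b}).map f := by
    rw [Submodule.map_span]
    congr 1
    ext z
    constructor
    · rintro ⟨a, b, rfl⟩; exact ⟨_, ⟨a, b, rfl⟩, hE a b⟩
    · rintro ⟨_, ⟨a, b, rfl⟩, rfl⟩; exact ⟨a, b, hE a b⟩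
  rw [hm] at hx
  obtain ⟨y, hy, e⟩ := hx
  exact ⟨y, hy, by rw [map_sub, e, sub_self]⟩
end Zhu
end

/-- Proposition 5.3.4. Let `𝓘^u` (resp. `𝓘^t`) be the span in
`A(𝓗⁺)` of the matrix elements `E^u_{ab}` (resp. `E^t_{ab}`), `1 ≤ a,b ≤ ℓ`
(with `E^*_{aa} = E^*_{a p(a)} * E^*_{p(a) a}`). Then `𝓘^u` and `𝓘^t` are
two-sided ideals of `A(𝓗⁺)`, each isomorphic as an associative algebra to the
`ℓ×ℓ` matrix algebra via `E^*_{ab} ↦ E_{ab}` (i.e. the `E^*_{ab}` are linearly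
independent mod `O(𝓗⁺)` and multiply like matrix units), and
`𝓘^u * 𝓘^t = 𝓘^t * 𝓘^u = 0`. -/
theorem statement17 (ℓ : ℕ) {V W : Type} [AddCommGroup V] [Module ℂ V]
    [AddCommGroup W] [Module ℂ W] (S : HeisenbergPlusSetting ℓ V W)
    (s : Fin ℓ → Fin ℓ → ℤ → ℤ → W)
    (hs : ∀ a b m n, S.ι (s a b m n) = SV S.A S.hgen a b m n)
    (p : Fin ℓ → Fin ℓ) (hp : ∀ a, p a ≠ a) :
    let Eu : Fin ℓ → Fin ℓ → W := fun a b =>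
      if a = b then S.B.star (EuW s a (p a)) (EuW s (p a) a) else EuW s a b
    let Et : Fin ℓ → Fin ℓ → W := fun a b =>
      if a = b then S.B.star (EtW s a (p a)) (EtW s (p a) a) else EtW s a b
    -- 𝓘^u and 𝓘^t are two-sided ideals of A(𝓗⁺)
    (∀ (x : W) (a b : Fin ℓ),
      (∃ y ∈ Submodule.span ℂ {z : W | ∃ a' b' : Fin ℓ, z = Eu a' b'},
        S.B.star x (Eu a b) - y ∈ S.B.Osub) ∧
      (∃ y ∈ Submodule.span ℂ {z : W | ∃ a' b' : Fin ℓ, z = Eu a' b'},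
        S.B.star (Eu a b) x - y ∈ S.B.Osub) ∧
      (∃ y ∈ Submodule.span ℂ {z : W | ∃ a' b' : Fin ℓ, z = Et a' b'},
        S.B.star x (Et a b) - y ∈ S.B.Osub) ∧
      (∃ y ∈ Submodule.span ℂ {z : W | ∃ a' b' : Fin ℓ, z = Et a' b'},
        S.B.star (Et a b) x - y ∈ S.B.Osub)) ∧
    -- matrix unit multiplication rules (so `E^*_{ab} ↦ E_{ab}` is an algebra map)
    (∀ a b c d : Fin ℓ,
      S.B.star (Eu a b) (Eu c d)
        - (if b = c then (1 : ℂ) else 0) • Eu a d ∈ S.B.Osub) ∧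
    (∀ a b c d : Fin ℓ,
      S.B.star (Et a b) (Et c d)
        - (if b = c then (1 : ℂ) else 0) • Et a d ∈ S.B.Osub) ∧
    -- `𝓘 = 𝓘^u ⊕ 𝓘^t`: joint linear independence mod O(𝓗⁺)
    (∀ cu ct : Fin ℓ → Fin ℓ → ℂ,
      (∑ a : Fin ℓ, ∑ b : Fin ℓ, cu a b • Eu a b)
        + (∑ a : Fin ℓ, ∑ b : Fin ℓ, ct a b • Et a b) ∈ S.B.Osub →
      cu = 0 ∧ ct = 0) ∧
    -- `𝓘^u * 𝓘^t = 𝓘^t * 𝓘^u = 0`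
    (∀ a b c d : Fin ℓ,
      S.B.star (Eu a b) (Et c d) ∈ S.B.Osub ∧
      S.B.star (Et c d) (Eu a b) ∈ S.B.Osub) := by
  intro Eu Et
  obtain ⟨R, _, _, ⟨Z⟩⟩ := Zhu.exists_zhu S.B (Zhu.wtB_neg S)
  obtain ⟨Wd, D⟩ := Zhu.exists_rdata S Z (fun a b (i j : ℕ) => s a b ((i:ℤ)+1) ((j:ℤ)+1)) (Zhu.s_shift S hs)
  set T : Fin ℓ → Fin ℓ → ℕ → ℕ → R := fun a b i j => Z.π (s a b ((i:ℤ)+1) ((j:ℤ)+1)) with hT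
  have hO : ∀ w : W, w ∈ S.B.Osub ↔ Z.π w = 0 := fun w => by rw [← Z.ker_eq, LinearMap.mem_ker]
  have hb : ∀ a b : Fin ℓ, a ≠ b → Z.π (s a b 1 2) = Zhu.Xp T a b (Zhu.bn 1) ∧ Z.π (s a b 1 3) = Zhu.Xp T a b (Zhu.bn 2) ∧
      Z.π (s a b 1 4) = Zhu.Xp T a b (Zhu.bn 3) ∧ Z.π (s a b 1 5) = Zhu.Xp T a b (Zhu.bn 4) := fun a b hab =>
    ⟨Zhu.T_bn D hab 1, Zhu.T_bn D hab 2, Zhu.T_bn D hab 3, Zhu.T_bn D hab 4⟩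
  have hu0 : ∀ a b : Fin ℓ, a ≠ b → Z.π (EuW s a b) = Zhu.Xp T a b Zhu.eu := fun a b hab => by
    obtain ⟨h1, h2, h3, h4⟩ := hb a b hab
    simp only [EuW, Zhu.eu, map_add, map_smul, h1, h2, h3, h4]
  have ht0 : ∀ a b : Fin ℓ, a ≠ b → Z.π (EtW s a b) = Zhu.Xp T a b Zhu.et := fun a b hab => by
    obtain ⟨h1, h2, h3, h4⟩ := hb a b hab
    simp only [EtW, Zhu.et, map_add, map_smul, h1, h2, h3, h4]
  have hu : ∀ a b, Z.π (Eu a b) = Zhu.mu p (fun a b => Zhu.Xp T a b Zhu.eu) a b := by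
    intro a b
    by_cases hab : a = b
    · simp only [Eu, Zhu.mu, if_pos hab, Z.map_star, hu0 a (p a) (hp a).symm, hu0 (p a) a (hp a)]
    · simp only [Eu, Zhu.mu, if_neg hab, hu0 a b hab]
  have ht : ∀ a b, Z.π (Et a b) = Zhu.mu p (fun a b => Zhu.Xp T a b Zhu.et) a b := by
    intro a b
    by_cases hab : a = b
    · simp only [Et, Zhu.mu, if_pos hab, Z.map_star, ht0 a (p a) (hp a).symm, ht0 (p a) a (hp a)]
    · simp only [Et, Zhu.mu, if_neg hab, ht0 a b hab]
  have hnu : ∀ a b : Fin ℓ, a ≠ b → Zhu.Xp T a b Zhu.eu ≠ 0 := fun a b hab h =>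
    Zhu.EuW_notMem S hs a b hab ((hO _).2 (by rw [hu0 a b hab, h]))
  have hnt : ∀ a b : Fin ℓ, a ≠ b → Zhu.Xp T a b Zhu.et ≠ 0 := fun a b hab h =>
    Zhu.EtW_notMem S hs a b hab ((hO _).2 (by rw [ht0 a b hab, h]))
  have Mu := Zhu.MU_of D Zhu.EPu
  have Mt := Zhu.MU_of D Zhu.EPt
  simp only [hO]
  refine ⟨fun x a b => ⟨?_, ?_, ?_, ?_⟩, fun a b c d => ?_, fun a b c d => ?_, fun cu ct h => ?_, fun a b c d => ?_⟩
  · refine Zhu.lift_span hu ?_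
    rw [Z.map_star, hu]
    exact Zhu.left_ideal hp D Zhu.EPu _ (Zhu.mu_mem a b)
  · refine Zhu.lift_span hu ?_
    rw [Z.map_star, hu]
    exact Zhu.right_ideal hp D Zhu.EPu _ (Zhu.mu_mem a b)
  · refine Zhu.lift_span ht ?_
    rw [Z.map_star, ht]
    exact Zhu.left_ideal hp D Zhu.EPt _ (Zhu.mu_mem a b)
  · refine Zhu.lift_span ht ?_
    rw [Z.map_star, ht]
    exact Zhu.right_ideal hp D Zhu.EPt _ (Zhu.mu_mem a b)
  · rw [map_sub, Z.map_star, map_smul, hu, hu, hu, Mu.mul hp]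
    split_ifs <;> simp
  · rw [map_sub, Z.map_star, map_smul, ht, ht, ht, Mt.mul hp]
    split_ifs <;> simp
  · simp only [map_add, map_sum, map_smul, hu, ht] at h
    exact ⟨Zhu.mu_indep hp Mu (fun a b c d => (Zhu.ut_orth D hp c d a b).2) hnu cu ct h,
      Zhu.mu_indep hp Mt (fun a b c d => (Zhu.ut_orth D hp a b c d).1) hnt ct cu (by rw [add_comm]; exact h)⟩
  · rw [Z.map_star, Z.map_star, hu, ht]
    exact Zhu.ut_orth D hp a b c d
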